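/- arXiv:1102.3402 — 2 statements merged into one kernel-verified Lean document; each statement's English description precedes it below -/
import Mathlib

section
/- For every ε > 0, the uniform probability measure μ_{n,1} on S_n satisfies μ_{n,1}({π ∈ S_n : |n^{−1/2} ℓ(π) − 2| > ε}) → 0 as n → ∞. -/
open Filter

/-- Number of inversions of a permutation of `Fin n`. -/
def inversions {n : ℕ} (π : Equiv.Perm (Fin n)) : ℕ :=
  (Finset.univ.filter (fun p : Fin n × Fin n => p.1 < p.2 ∧ π p.2 < π p.1)).card

/-- Length of the longest increasing subsequence of a permutation of `Fin n`. -/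
def lisLength {n : ℕ} (π : Equiv.Perm (Fin n)) : ℕ :=
  Finset.univ.powerset.sup fun s : Finset (Fin n) =>
    if ∀ i ∈ s, ∀ j ∈ s, i < j → π i < π j then s.card else 0

/-- The Mallows(n,q) probability of a set of permutations; for `q = 1` this is the uniform
probability measure on `S_n`, assigning probability `1/n!` to each permutation. -/
noncomputable def mallowsProb (n : ℕ) (q : ℝ) (A : Set (Equiv.Perm (Fin n))) : ℝ :=
  (∑ π : Equiv.Perm (Fin n), A.indicator (fun π => q ^ inversions π) π) /
    (∑ π : Equiv.Perm (Fin n), q ^ inversions π)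


/-- Expectation of `f` of a random subset of `C` containing each `i` independently
with probability `p i`. -/
noncomputable def BE {ι : Type*} [DecidableEq ι] (C : Finset ι) (p : ι → ℝ)
    (f : Finset ι → ℝ) : ℝ :=
  ∑ S ∈ C.powerset, (∏ i ∈ S, p i) * (∏ i ∈ C \ S, (1 - p i)) * f S

section BEbasic
variable {ι : Type*} [DecidableEq ι]

theorem BE_empty (p : ι → ℝ) (f : Finset ι → ℝ) : BE ∅ p f = f ∅ := by
  simp [BE]

theorem BE_insert {C : Finset ι} {i : ι} (hi : i ∉ C) (p : ι → ℝ) (f : Finset ι → ℝ) :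
    BE (insert i C) p f
      = p i * BE C p (fun S => f (insert i S)) + (1 - p i) * BE C p f := by
  unfold BE
  rw [Finset.sum_powerset_insert hi, Finset.mul_sum, Finset.mul_sum, add_comm]
  congr 1
  · apply Finset.sum_congr rfl
    intro S hS
    rw [Finset.mem_powerset] at hS
    have h1 : i ∉ S := fun h => hi (hS h)
    have h2 : insert i C \ insert i S = C \ S := by
      ext x; simp only [Finset.mem_sdiff, Finset.mem_insert]
      constructor
      · rintro ⟨rfl | h, h'⟩ <;> tauto
      · rintro ⟨h, h'⟩
        refine ⟨Or.inr h, ?_⟩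
        rintro (rfl | h3)
        · exact hi h
        · exact h' h3
    rw [h2, Finset.prod_insert h1]; ring
  · apply Finset.sum_congr rfl
    intro S hS
    rw [Finset.mem_powerset] at hS
    have h1 : i ∉ S := fun h => hi (hS h)
    rw [Finset.insert_sdiff_of_notMem _ h1, Finset.prod_insert (by simp [hi])]; ring

theorem BE_congr {C : Finset ι} {p : ι → ℝ} {f g : Finset ι → ℝ}
    (h : ∀ S, S ⊆ C → f S = g S) : BE C p f = BE C p g := by
  unfold BE
  apply Finset.sum_congr rfl
  intro S hS
  rw [h S (Finset.mem_powerset.1 hS)]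

theorem BE_congr_p {C : Finset ι} {p q : ι → ℝ} {f : Finset ι → ℝ}
    (h : ∀ i ∈ C, p i = q i) : BE C p f = BE C q f := by
  unfold BE
  apply Finset.sum_congr rfl
  intro S hS
  rw [Finset.mem_powerset] at hS
  have e1 : ∏ i ∈ S, p i = ∏ i ∈ S, q i := Finset.prod_congr rfl (fun i hi => h i (hS hi))
  have e2 : ∏ i ∈ C \ S, (1 - p i) = ∏ i ∈ C \ S, (1 - q i) :=
    Finset.prod_congr rfl (fun i hi => by rw [h i (Finset.sdiff_subset hi)])
  rw [e1, e2]

theorem BE_add (C : Finset ι) (p : ι → ℝ) (f g : Finset ι → ℝ) :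
    BE C p (fun S => f S + g S) = BE C p f + BE C p g := by
  unfold BE; rw [← Finset.sum_add_distrib]
  exact Finset.sum_congr rfl fun _ _ => by ring

theorem BE_sub (C : Finset ι) (p : ι → ℝ) (f g : Finset ι → ℝ) :
    BE C p (fun S => f S - g S) = BE C p f - BE C p g := by
  unfold BE; rw [← Finset.sum_sub_distrib]
  exact Finset.sum_congr rfl fun _ _ => by ring

theorem BE_mul (C : Finset ι) (p : ι → ℝ) (a : ℝ) (f : Finset ι → ℝ) :
    BE C p (fun S => a * f S) = a * BE C p f := by
  unfold BE; rw [Finset.mul_sum]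
  exact Finset.sum_congr rfl fun _ _ => by ring

theorem BE_sum {κ : Type*} (C : Finset ι) (p : ι → ℝ) (s : Finset κ) (f : κ → Finset ι → ℝ) :
    BE C p (fun S => ∑ k ∈ s, f k S) = ∑ k ∈ s, BE C p (f k) := by
  unfold BE; rw [Finset.sum_comm]
  exact Finset.sum_congr rfl fun _ _ => by rw [Finset.mul_sum]

theorem BE_const (C : Finset ι) (p : ι → ℝ) (a : ℝ) : BE C p (fun _ => a) = a := by
  induction C using Finset.induction_on with
  | empty => simp [BE_empty]
  | insert i C hi ih => rw [BE_insert hi, ih]; ring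

theorem BE_mono {C : Finset ι} {p : ι → ℝ} (hp : ∀ i, 0 ≤ p i ∧ p i ≤ 1)
    {f g : Finset ι → ℝ} (h : ∀ S, S ⊆ C → f S ≤ g S) : BE C p f ≤ BE C p g := by
  unfold BE
  apply Finset.sum_le_sum
  intro S hS
  apply mul_le_mul_of_nonneg_left (h S (Finset.mem_powerset.1 hS))
  apply mul_nonneg
  · exact Finset.prod_nonneg fun i _ => (hp i).1
  · exact Finset.prod_nonneg fun i _ => by linarith [(hp i).2]

theorem BE_nonneg {C : Finset ι} {p : ι → ℝ} (hp : ∀ i, 0 ≤ p i ∧ p i ≤ 1)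
    {f : Finset ι → ℝ} (h : ∀ S, S ⊆ C → 0 ≤ f S) : 0 ≤ BE C p f := by
  have := BE_mono hp (f := fun _ => 0) (g := f) h
  rwa [BE_const] at this

theorem BE_union {A B : Finset ι} (hd : Disjoint A B) (p : ι → ℝ) (f : Finset ι → ℝ) :
    BE (A ∪ B) p f = BE A p (fun S => BE B p (fun T => f (S ∪ T))) := by
  induction A using Finset.induction_on generalizing f with
  | empty => simp [BE_empty]
  | insert i A hi ih =>
    rw [Finset.disjoint_insert_left] at hd
    rw [Finset.insert_union, BE_insert (by simp [hi, hd.1]), BE_insert hi, ih hd.2, ih hd.2]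
    simp only [Finset.insert_union]

theorem BE_inter {C D : Finset ι} (hD : D ⊆ C) (p : ι → ℝ) (f : Finset ι → ℝ) :
    BE C p (fun S => f (S ∩ D)) = BE D p f := by
  have : C = D ∪ (C \ D) := by simp [hD]
  rw [this, BE_union Finset.disjoint_sdiff]
  apply BE_congr
  intro S hS
  rw [← BE_const (C \ D) p (f S)]
  apply BE_congr
  intro T hT
  congr 1
  ext x
  have h1 := @hS x
  have h2 := @hT x
  simp only [Finset.mem_sdiff, Finset.mem_inter, Finset.mem_union] at *
  tauto

theorem BE_image {κ : Type*} [DecidableEq κ] (φ : ι → κ) (C : Finset ι) (D : Finset κ)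
    (hD : ∀ c ∈ C, φ c ∈ D) (p : ι → ℝ) (f : Finset κ → ℝ) :
    BE C p (fun S => f (S.image φ))
      = BE D (fun d => 1 - ∏ c ∈ C.filter (fun c => φ c = d), (1 - p c)) f := by
  induction C using Finset.induction_on generalizing f with
  | empty =>
    simp only [BE_empty, Finset.image_empty, Finset.filter_empty, Finset.prod_empty, sub_self]
    clear hD
    induction D using Finset.induction_on generalizing f with
    | empty => simp [BE_empty]
    | insert d D hd ih => rw [BE_insert hd, ← ih f]; simp
  | insert c C hc ih =>
    have hD' : ∀ c ∈ C, φ c ∈ D := fun x hx => hD x (Finset.mem_insert_of_mem hx)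
    rw [BE_insert hc]
    simp only [Finset.image_insert]
    rw [ih hD' f, ih hD' (fun S => f (insert (φ c) S))]
    obtain ⟨D', hd', rfl⟩ : ∃ D', φ c ∉ D' ∧ D = insert (φ c) D' :=
      ⟨D.erase (φ c), by simp, by rw [Finset.insert_erase (hD c (by simp))]⟩
    rw [BE_insert hd', BE_insert hd', BE_insert hd']
    have e : ∀ g : Finset κ → ℝ, BE D' (fun d => 1 - ∏ c ∈ (insert c C).filter (fun c => φ c = d), (1 - p c)) g
        = BE D' (fun d => 1 - ∏ c ∈ C.filter (fun c => φ c = d), (1 - p c)) g := by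
      intro g
      apply BE_congr_p
      intro d hd
      have : φ c ≠ d := by rintro rfl; exact hd' hd
      rw [Finset.filter_insert, if_neg this]
    rw [e, e]
    simp only [Finset.filter_insert, if_true, Finset.insert_idem]
    rw [Finset.prod_insert (by simp [hc])]
    ring

/-- Cauchy–Schwarz (Jensen) for the square. -/
theorem BE_sq_le {C : Finset ι} {p : ι → ℝ} (hp : ∀ i, 0 ≤ p i ∧ p i ≤ 1)
    (f : Finset ι → ℝ) : (BE C p f) ^ 2 ≤ BE C p (fun S => f S ^ 2) := by
  have h := BE_nonneg (C := C) hp (f := fun S => (f S - BE C p f) ^ 2) (fun S _ => sq_nonneg _)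
  have e : BE C p (fun S => (f S - BE C p f) ^ 2)
      = BE C p (fun S => f S ^ 2 + ((-2 * BE C p f) * f S + (BE C p f) ^ 2)) :=
    BE_congr fun S _ => by ring
  rw [e, BE_add, BE_add, BE_mul, BE_const] at h
  nlinarith

theorem BE_var (C : Finset ι) (p : ι → ℝ) (f : Finset ι → ℝ) (m : ℝ) (hm : m = BE C p f) :
    BE C p (fun S => (f S - m) ^ 2) = BE C p (fun S => f S ^ 2) - m ^ 2 := by
  have e : BE C p (fun S => (f S - m) ^ 2)
      = BE C p (fun S => f S ^ 2 + ((-2 * m) * f S + m ^ 2)) :=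
    BE_congr fun S _ => by ring
  rw [e, BE_add, BE_add, BE_mul, BE_const, ← hm]
  ring

theorem efron_stein {p : ι → ℝ} (hp : ∀ i, 0 ≤ p i ∧ p i ≤ 1) (C : Finset ι)
    (f : Finset ι → ℝ) :
    BE C p (fun S => f S ^ 2) - (BE C p f) ^ 2 ≤
      ∑ i ∈ C, p i * (1 - p i) * BE C p (fun S => (f (insert i S) - f (S.erase i)) ^ 2) := by
  induction C using Finset.induction_on generalizing f with
  | empty => simp [BE_empty]
  | insert i C hi ih =>
    rw [Finset.sum_insert hi]
    have h1 := ih (fun S => f (insert i S))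
    have h0 := ih f
    have hsum : ∑ j ∈ C, p j * (1 - p j) *
        BE (insert i C) p (fun S => (f (insert j S) - f (S.erase j)) ^ 2)
        = p i * (∑ j ∈ C, p j * (1 - p j) *
        BE C p (fun S => (f (insert i (insert j S)) - f (insert i (S.erase j))) ^ 2)) +
        (1 - p i) * (∑ j ∈ C, p j * (1 - p j) *
        BE C p (fun S => (f (insert j S) - f (S.erase j)) ^ 2)) := by
      rw [Finset.mul_sum, Finset.mul_sum, ← Finset.sum_add_distrib]
      apply Finset.sum_congr rfl
      intro j hj
      have hij : i ≠ j := by rintro rfl; exact hi hj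
      rw [BE_insert hi]
      have : BE C p (fun S => (f (insert j (insert i S)) - f ((insert i S).erase j)) ^ 2)
        = BE C p (fun S => (f (insert i (insert j S)) - f (insert i (S.erase j))) ^ 2) := by
        apply BE_congr
        intro S _
        rw [Finset.insert_comm, Finset.erase_insert_of_ne hij]
      rw [this]; ring
    rw [hsum]
    have hD : BE (insert i C) p (fun S => (f (insert i S) - f (S.erase i)) ^ 2)
        = BE C p (fun S => (f (insert i S) - f S) ^ 2) := by
      rw [BE_insert hi]
      have e1 : BE C p (fun S => (f (insert i (insert i S)) - f ((insert i S).erase i)) ^ 2)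
        = BE C p (fun S => (f (insert i S) - f S) ^ 2) := by
        apply BE_congr
        intro S hS
        rw [Finset.insert_idem, Finset.erase_insert (fun h => hi (hS h))]
      have e2 : BE C p (fun S => (f (insert i S) - f (S.erase i)) ^ 2)
        = BE C p (fun S => (f (insert i S) - f S) ^ 2) := by
        apply BE_congr
        intro S hS
        rw [Finset.erase_eq_of_notMem (fun h => hi (hS h))]
      rw [e1, e2]; ring
    rw [hD, BE_insert hi, BE_insert hi]
    have hJ := BE_sq_le (C := C) hp (fun S => f (insert i S) - f S)
    rw [BE_sub] at hJ
    have hpi := hp i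
    set X := BE C p (fun S => f (insert i S))
    set Y := BE C p f
    have hpp : 0 ≤ p i * (1 - p i) := mul_nonneg hpi.1 (by linarith)
    have k1 := mul_le_mul_of_nonneg_left hJ hpp
    have k2 := mul_le_mul_of_nonneg_left h1 hpi.1
    have k3 := mul_le_mul_of_nonneg_left h0 (by linarith : 0 ≤ 1 - p i)
    nlinarith

theorem BE_mem {C : Finset ι} {i : ι} (hi : i ∈ C) (p : ι → ℝ) (h : Finset ι → ℝ) :
    BE C p (fun S => if i ∈ S then h S else 0) = p i * BE C p (fun S => h (insert i S)) := by
  obtain ⟨D, hd, rfl⟩ : ∃ D, i ∉ D ∧ C = insert i D :=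
    ⟨C.erase i, by simp, by rw [Finset.insert_erase hi]⟩
  rw [BE_insert hd, BE_insert hd]
  have e : BE D p (fun S => if i ∈ S then h S else 0) = 0 := by
    refine Eq.trans (BE_congr (g := fun _ => 0) ?_) (BE_const D p 0)
    intro S hS
    rw [if_neg (fun h => hd (hS h))]
  rw [e]
  simp only [Finset.mem_insert_self, if_true, Finset.insert_idem]
  ring

/-- Variance bound for self-bounding functions. -/
theorem var_self_bounding {p : ι → ℝ} (hp : ∀ i, 0 ≤ p i ∧ p i ≤ 1) (C : Finset ι)
    (f : Finset ι → ℝ) (h1 : ∀ S i, f (S.erase i) ≤ f S) (h2 : ∀ S i, f S ≤ f (S.erase i) + 1)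
    (h3 : ∀ S, ∑ i ∈ S, (f S - f (S.erase i)) ≤ f S) :
    BE C p (fun S => (f S - BE C p f) ^ 2) ≤ BE C p f := by
  rw [BE_var C p f _ rfl]
  refine (efron_stein hp C f).trans ?_
  have key : ∀ i ∈ C, p i * (1 - p i) * BE C p (fun S => (f (insert i S) - f (S.erase i)) ^ 2)
      ≤ BE C p (fun S => if i ∈ S then f S - f (S.erase i) else 0) := by
    intro i hi
    rw [BE_mem hi]
    have hE : ∀ S : Finset ι, (insert i S).erase i = S.erase i := by
      intro S; ext x; simp only [Finset.mem_erase, Finset.mem_insert]; tauto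
    have : BE C p (fun S => (f (insert i S) - f (S.erase i)) ^ 2)
        ≤ BE C p (fun S => f (insert i S) - f ((insert i S).erase i)) := by
      apply BE_mono hp
      intro S _
      have a := h1 (insert i S) i
      have b := h2 (insert i S) i
      rw [hE] at *
      nlinarith
    have hpi := hp i
    have hn : 0 ≤ BE C p (fun S => (f (insert i S) - f (S.erase i)) ^ 2) :=
      BE_nonneg hp fun S _ => sq_nonneg _
    calc _ ≤ p i * BE C p (fun S => (f (insert i S) - f (S.erase i)) ^ 2) := by
          apply mul_le_mul_of_nonneg_right _ hn
          nlinarith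
      _ ≤ _ := mul_le_mul_of_nonneg_left this hpi.1
  refine (Finset.sum_le_sum key).trans ?_
  rw [← BE_sum]
  apply BE_mono hp
  intro S hS
  rw [← Finset.sum_filter]
  have : C.filter (fun i => i ∈ S) = S := by
    ext x; simp only [Finset.mem_filter]; exact ⟨fun h => h.2, fun h => ⟨hS h, h⟩⟩
  rw [this]
  exact h3 S

/-- Chebyshev. -/
theorem BE_cheb {p : ι → ℝ} (hp : ∀ i, 0 ≤ p i ∧ p i ≤ 1) (C : Finset ι)
    (f : Finset ι → ℝ) (P : Finset ι → Prop) [DecidablePred P] (m d : ℝ) (hd : 0 < d)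
    (hP : ∀ S, S ⊆ C → P S → d ≤ |f S - m|) :
    BE C p (fun S => if P S then 1 else 0) ≤ BE C p (fun S => (f S - m) ^ 2) / d ^ 2 := by
  rw [le_div_iff₀ (by positivity), mul_comm, ← BE_mul]
  apply BE_mono hp
  intro S hS
  split_ifs with h
  · have := hP S hS h
    rw [mul_one, ← sq_abs (f S - m)]
    gcongr
  · rw [mul_zero]; positivity

/-- First absolute moment from the second moment. -/
theorem BE_abs {p : ι → ℝ} (hp : ∀ i, 0 ≤ p i ∧ p i ≤ 1) (C : Finset ι)
    (f : Finset ι → ℝ) (s : ℝ) (hs : 0 < s) :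
    BE C p (fun S => |f S|) ≤ s + BE C p (fun S => f S ^ 2) / s := by
  have : BE C p (fun S => f S ^ 2) / s = BE C p (fun S => s⁻¹ * f S ^ 2) := by
    rw [BE_mul]; field_simp
  rw [this]
  have h0 : s = BE C p (fun _ => s) := (BE_const C p s).symm
  refine le_trans ?_ (le_of_eq (congrArg (· + BE C p (fun S => s⁻¹ * f S ^ 2)) h0.symm))
  rw [← BE_add]
  apply BE_mono hp
  intro S _
  rw [← sq_abs]
  have h : 0 ≤ s⁻¹ * (s - |f S|) ^ 2 := by positivity
  have e : s⁻¹ * (s - |f S|) ^ 2 = s - 2 * |f S| + s⁻¹ * |f S| ^ 2 := by field_simp; ring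
  have := abs_nonneg (f S)
  linarith
end BEbasic


/-- Strict order in both coordinates. -/
def Slt (x y : ℕ × ℕ) : Prop := x.1 < y.1 ∧ x.2 < y.2

/-- A set of points forming a strictly increasing chain. -/
def IsCh (T : Finset (ℕ × ℕ)) : Prop := ∀ x ∈ T, ∀ y ∈ T, x ≠ y → Slt x y ∨ Slt y x

open Classical in
/-- Length of the longest strict chain. -/
noncomputable def chainLen (S : Finset (ℕ × ℕ)) : ℕ :=
  (S.powerset.filter IsCh).sup Finset.card

theorem IsCh.subset {T U : Finset (ℕ × ℕ)} (h : IsCh T) (hU : U ⊆ T) : IsCh U :=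
  fun x hx y hy => h x (hU hx) y (hU hy)

theorem card_le_chainLen {S T : Finset (ℕ × ℕ)} (hT : T ⊆ S) (h : IsCh T) :
    T.card ≤ chainLen S := by
  classical
  unfold chainLen
  apply Finset.le_sup (f := Finset.card)
  simp [hT, h]

theorem exists_chain (S : Finset (ℕ × ℕ)) : ∃ T ⊆ S, IsCh T ∧ T.card = chainLen S := by
  classical
  have hne : (S.powerset.filter IsCh).Nonempty := ⟨∅, by simp [IsCh]⟩
  obtain ⟨T, hT, h⟩ := Finset.exists_mem_eq_sup _ hne Finset.card
  simp only [Finset.mem_filter, Finset.mem_powerset] at hT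
  exact ⟨T, hT.1, hT.2, h.symm⟩

theorem chainLen_mono {S S' : Finset (ℕ × ℕ)} (h : S ⊆ S') : chainLen S ≤ chainLen S' := by
  obtain ⟨T, hT, hc, he⟩ := exists_chain S
  rw [← he]; exact card_le_chainLen (hT.trans h) hc

theorem chainLen_empty : chainLen ∅ = 0 := by
  obtain ⟨T, hT, hc, he⟩ := exists_chain ∅
  rw [← he, Finset.subset_empty.1 hT]; rfl

theorem chainLen_image_le (φ : ℕ × ℕ → ℕ × ℕ) (S : Finset (ℕ × ℕ))
    (h : ∀ x y, Slt (φ x) (φ y) → Slt x y) : chainLen (S.image φ) ≤ chainLen S := by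
  classical
  obtain ⟨T, hT, hc, he⟩ := exists_chain (S.image φ)
  obtain ⟨U, hU, hinj, rfl⟩ := Finset.exists_subset_injOn_image_eq_of_surjOn (f := φ) (S : Set (ℕ × ℕ)) T
    (by
      intro y hy
      have := hT hy
      rw [Finset.mem_image] at this
      exact this)
  rw [Finset.coe_subset] at hU
  rw [← he, Finset.card_image_of_injOn hinj]
  apply card_le_chainLen hU
  intro x hx y hy hxy
  have := hc (φ x) (Finset.mem_image_of_mem _ hx) (φ y) (Finset.mem_image_of_mem _ hy)
    (fun e => hxy (hinj hx hy e))
  exact this.imp (h _ _) (h _ _)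

theorem chainLen_le_image (φ : ℕ × ℕ → ℕ × ℕ) (S : Finset (ℕ × ℕ))
    (h : ∀ x y, Slt x y → Slt (φ x) (φ y)) : chainLen S ≤ chainLen (S.image φ) := by
  classical
  obtain ⟨T, hT, hc, he⟩ := exists_chain S
  have hinj : Set.InjOn φ T := by
    intro x hx y hy hxy
    by_contra hne
    rcases hc x hx y hy hne with h1 | h1
    · have := h _ _ h1; rw [hxy] at this; exact lt_irrefl _ this.1
    · have := h _ _ h1; rw [hxy] at this; exact lt_irrefl _ this.1
  rw [← he, ← Finset.card_image_of_injOn hinj]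
  apply card_le_chainLen (Finset.image_subset_image hT)
  intro x hx y hy hxy
  rw [Finset.mem_image] at hx hy
  obtain ⟨x, hx, rfl⟩ := hx
  obtain ⟨y, hy, rfl⟩ := hy
  exact (hc x hx y hy (fun e => hxy (e ▸ rfl))).imp (h _ _) (h _ _)

theorem IsCh_insert {T : Finset (ℕ × ℕ)} {z : ℕ × ℕ} (h : IsCh T) (hz : ∀ x ∈ T, Slt x z) :
    IsCh (insert z T) := by
  intro x hx y hy hxy
  rw [Finset.mem_insert] at hx hy
  rcases hx with rfl | hx <;> rcases hy with rfl | hy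
  · exact absurd rfl hxy
  · exact Or.inr (hz y hy)
  · exact Or.inl (hz x hx)
  · exact h x hx y hy hxy

theorem IsCh_union {T U : Finset (ℕ × ℕ)} (h : IsCh T) (h' : IsCh U)
    (hz : ∀ x ∈ T, ∀ y ∈ U, Slt x y) : IsCh (T ∪ U) := by
  intro x hx y hy hxy
  rw [Finset.mem_union] at hx hy
  rcases hx with hx | hx <;> rcases hy with hy | hy
  · exact h x hx y hy hxy
  · exact Or.inl (hz x hx y hy)
  · exact Or.inr (hz y hy x hx)
  · exact h' x hx y hy hxy

theorem chainLen_union {S S' : Finset (ℕ × ℕ)} (hz : ∀ x ∈ S, ∀ y ∈ S', Slt x y) :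
    chainLen S + chainLen S' ≤ chainLen (S ∪ S') := by
  obtain ⟨T, hT, hc, he⟩ := exists_chain S
  obtain ⟨T', hT', hc', he'⟩ := exists_chain S'
  have hd : Disjoint T T' := by
    rw [Finset.disjoint_left]
    intro x hx hx'
    exact lt_irrefl _ (hz x (hT hx) x (hT' hx')).1
  rw [← he, ← he', ← Finset.card_union_of_disjoint hd]
  exact card_le_chainLen (Finset.union_subset_union hT hT')
    (IsCh_union hc hc' fun x hx y hy => hz x (hT hx) y (hT' hy))

theorem chainLen_self_bounding :
    (∀ (S : Finset (ℕ × ℕ)) i, (chainLen (S.erase i) : ℝ) ≤ chainLen S) ∧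
    (∀ (S : Finset (ℕ × ℕ)) i, (chainLen S : ℝ) ≤ chainLen (S.erase i) + 1) ∧
    (∀ S : Finset (ℕ × ℕ), ∑ i ∈ S, ((chainLen S : ℝ) - chainLen (S.erase i)) ≤ chainLen S) := by
  have h1 : ∀ (S : Finset (ℕ × ℕ)) i, (chainLen (S.erase i) : ℝ) ≤ chainLen S := fun S i => by
    exact_mod_cast chainLen_mono (Finset.erase_subset i S)
  have h2 : ∀ (S : Finset (ℕ × ℕ)) i, (chainLen S : ℝ) ≤ chainLen (S.erase i) + 1 := by
    intro S i
    obtain ⟨T, hT, hc, he⟩ := exists_chain S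
    have : (T.erase i).card ≤ chainLen (S.erase i) :=
      card_le_chainLen (Finset.erase_subset_erase i hT) (hc.subset (Finset.erase_subset i T))
    have h' := Finset.pred_card_le_card_erase (s := T) (a := i)
    exact_mod_cast (by omega : chainLen S ≤ chainLen (S.erase i) + 1)
  refine ⟨h1, h2, ?_⟩
  intro S
  obtain ⟨T, hT, hc, he⟩ := exists_chain S
  calc ∑ i ∈ S, ((chainLen S : ℝ) - chainLen (S.erase i))
      ≤ ∑ i ∈ S, (if i ∈ T then (1 : ℝ) else 0) := by
        apply Finset.sum_le_sum
        intro i hi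
        split_ifs with h
        · linarith [h2 S i]
        · have : T.card ≤ chainLen (S.erase i) := by
            apply card_le_chainLen _ hc
            intro x hx
            rw [Finset.mem_erase]
            exact ⟨fun e => h (e ▸ hx), hT hx⟩
          rw [he] at this
          have : (chainLen S : ℝ) ≤ chainLen (S.erase i) := by exact_mod_cast this
          linarith
    _ = (chainLen S : ℝ) := by
        rw [← Finset.sum_filter, Finset.filter_mem_eq_inter, Finset.inter_eq_right.2 hT]
        simp [he]

theorem card_inter_self_bounding {ι : Type*} [DecidableEq ι] (R : Finset ι) :
    (∀ (S : Finset ι) i, (((S.erase i) ∩ R).card : ℝ) ≤ (S ∩ R).card) ∧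
    (∀ (S : Finset ι) i, ((S ∩ R).card : ℝ) ≤ ((S.erase i) ∩ R).card + 1) ∧
    (∀ S : Finset ι, ∑ i ∈ S, (((S ∩ R).card : ℝ) - ((S.erase i) ∩ R).card) ≤ (S ∩ R).card) := by
  have h1 : ∀ (S : Finset ι) i, (((S.erase i) ∩ R).card : ℝ) ≤ (S ∩ R).card := fun S i => by
    exact_mod_cast Finset.card_le_card (Finset.inter_subset_inter_right (Finset.erase_subset i S))
  have h2 : ∀ (S : Finset ι) i, ((S ∩ R).card : ℝ) ≤ ((S.erase i) ∩ R).card + 1 := by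
    intro S i
    rw [Finset.erase_inter]
    have h' := Finset.pred_card_le_card_erase (s := S ∩ R) (a := i)
    exact_mod_cast (by omega : (S ∩ R).card ≤ ((S ∩ R).erase i).card + 1)
  refine ⟨h1, h2, ?_⟩
  intro S
  calc ∑ i ∈ S, (((S ∩ R).card : ℝ) - ((S.erase i) ∩ R).card)
      ≤ ∑ i ∈ S, (if i ∈ R then (1 : ℝ) else 0) := by
        apply Finset.sum_le_sum
        intro i hi
        split_ifs with h
        · linarith [h2 S i]
        · rw [Finset.erase_inter, Finset.erase_eq_of_notMem (by simp [h])]; simp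
    _ = ((S ∩ R).card : ℝ) := by
        rw [← Finset.sum_filter, Finset.filter_mem_eq_inter]
        simp

theorem BE_card_inter {ι : Type*} [DecidableEq ι] (C R : Finset ι) (hR : R ⊆ C) (p : ι → ℝ) :
    BE C p (fun S => ((S ∩ R).card : ℝ)) = ∑ i ∈ R, p i := by
  have e : BE C p (fun S => ((S ∩ R).card : ℝ))
      = BE C p (fun S => ∑ i ∈ R, if i ∈ S then (1 : ℝ) else 0) := by
    apply BE_congr
    intro S _
    rw [← Finset.sum_filter, Finset.filter_mem_eq_inter, Finset.inter_comm]; simp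
  rw [e, BE_sum]
  apply Finset.sum_congr rfl
  intro i hi
  rw [BE_mem (hR hi) p (fun _ => 1), BE_const, mul_one]

/-- Last passage function with sources on the `x`-axis and sinks on the `y`-axis. -/
noncomputable def HH (S : Finset (ℕ × ℕ)) : ℕ → ℕ → ℕ
  | 0, 0 => 0
  | i + 1, 0 => HH S i 0 + (if (i + 1, 0) ∈ S then 1 else 0)
  | 0, j + 1 => HH S 0 j + (if (0, j + 1) ∈ S then 1 else 0)
  | i + 1, j + 1 => max (max (HH S i (j + 1)) (HH S (i + 1) j))
      (HH S i j + (if (i + 1, j + 1) ∈ S then 1 else 0))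
termination_by i j => i + j

theorem HH_00 (S : Finset (ℕ × ℕ)) : HH S 0 0 = 0 := by rw [HH]
theorem HH_s0 (S : Finset (ℕ × ℕ)) (i : ℕ) :
    HH S (i + 1) 0 = HH S i 0 + (if (i + 1, 0) ∈ S then 1 else 0) := by rw [HH]
theorem HH_0s (S : Finset (ℕ × ℕ)) (j : ℕ) :
    HH S 0 (j + 1) = HH S 0 j + (if (0, j + 1) ∈ S then 1 else 0) := by rw [HH]
theorem HH_ss (S : Finset (ℕ × ℕ)) (i j : ℕ) :
    HH S (i + 1) (j + 1) = max (max (HH S i (j + 1)) (HH S (i + 1) j))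
      (HH S i j + (if (i + 1, j + 1) ∈ S then 1 else 0)) := by rw [HH]

theorem HH_inc (S : Finset (ℕ × ℕ)) (n : ℕ) : ∀ i j, i + j ≤ n →
    (HH S i j ≤ HH S (i + 1) j ∧ HH S (i + 1) j ≤ HH S i j + 1) ∧
    (HH S i j ≤ HH S i (j + 1) ∧ HH S i (j + 1) ≤ HH S i j + 1) := by
  induction n with
  | zero =>
    intro i j h
    obtain rfl : i = 0 := by omega
    obtain rfl : j = 0 := by omega
    rw [HH_s0, HH_0s]; split_ifs <;> omega
  | succ n ih =>
    intro i j h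
    constructor
    · rcases j with _ | j
      · rw [HH_s0]; split_ifs <;> omega
      · have := ih i j (by omega)
        rw [HH_ss]; split_ifs <;> omega
    · rcases i with _ | i
      · rw [HH_0s]; split_ifs <;> omega
      · have := ih i j (by omega)
        rw [HH_ss]; split_ifs <;> omega

theorem HH_x (S : Finset (ℕ × ℕ)) (i j : ℕ) :
    HH S i j ≤ HH S (i + 1) j ∧ HH S (i + 1) j ≤ HH S i j + 1 := (HH_inc S _ i j le_rfl).1
theorem HH_y (S : Finset (ℕ × ℕ)) (i j : ℕ) :
    HH S i j ≤ HH S i (j + 1) ∧ HH S i (j + 1) ≤ HH S i j + 1 := (HH_inc S _ i j le_rfl).2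

theorem HH_mono (S : Finset (ℕ × ℕ)) {i i' j j' : ℕ} (h : i ≤ i') (hjj : j ≤ j') :
    HH S i j ≤ HH S i' j' :=
  (monotone_nat_of_le_succ (fun k => (HH_x S k j).1) h).trans
    (monotone_nat_of_le_succ (fun k => (HH_y S i' k).1) hjj)

/-- Interior rectangle. -/
abbrev Rect (a b c d : ℕ) : Finset (ℕ × ℕ) := Finset.Ioc a b ×ˢ Finset.Ioc c d

theorem card_le_HH (S : Finset (ℕ × ℕ)) (k : ℕ) : ∀ (T : Finset (ℕ × ℕ)) (i j : ℕ), T.card = k →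
    IsCh T → T ⊆ S → T ⊆ Rect 0 i 0 j → T.card ≤ HH S i j := by
  induction k with
  | zero => intro T i j h; omega
  | succ k ih =>
    intro T i j h hc hS hR
    have hne : T.Nonempty := by rw [← Finset.card_pos]; omega
    obtain ⟨z, hz, hmax⟩ := Finset.exists_max_image T Prod.fst hne
    have hzR := hR hz
    obtain ⟨z1, z2⟩ := z
    simp only [Finset.mem_product, Finset.mem_Ioc] at hzR
    have hcard : (T.erase (z1, z2)).card = k := by rw [Finset.card_erase_of_mem hz]; omega
    obtain ⟨a, rfl⟩ : ∃ a, z1 = a + 1 := ⟨z1 - 1, by omega⟩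
    obtain ⟨b, rfl⟩ : ∃ b, z2 = b + 1 := ⟨z2 - 1, by omega⟩
    have := ih (T.erase (a + 1, b + 1)) a b hcard (hc.subset (Finset.erase_subset _ _))
      ((Finset.erase_subset _ _).trans hS) (by
        intro x hx
        rw [Finset.mem_erase] at hx
        have hxR := hR hx.2
        have h1 := hmax x hx.2
        have h2 := hc x hx.2 _ hz hx.1
        simp only [Finset.mem_product, Finset.mem_Ioc, Slt] at *
        omega)
    have h3 := HH_mono S (i := a + 1) (j := b + 1) hzR.1.2 hzR.2.2
    rw [HH_ss, if_pos (hS hz)] at h3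
    omega

theorem chainLen_le_HH (S : Finset (ℕ × ℕ)) (i j : ℕ) :
    chainLen (S ∩ Rect 0 i 0 j) ≤ HH S i j := by
  obtain ⟨T, hT, hc, he⟩ := exists_chain (S ∩ Rect 0 i 0 j)
  rw [← he]
  exact card_le_HH S _ T i j rfl hc (hT.trans Finset.inter_subset_left)
    (hT.trans Finset.inter_subset_right)

theorem chainLen_add (S : Finset (ℕ × ℕ)) (a b i j : ℕ) (ha : a ≤ i) (hb : b ≤ j) :
    chainLen (S ∩ Rect a i b j) + (if (i + 1, j + 1) ∈ S then 1 else 0)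
      ≤ chainLen (S ∩ Rect a (i + 1) b (j + 1)) := by
  split_ifs with h
  · obtain ⟨T, hT, hc, he⟩ := exists_chain (S ∩ Rect a i b j)
    have hlt : ∀ x ∈ T, Slt x (i + 1, j + 1) := by
      intro x hx
      have := hT hx
      simp only [Finset.mem_inter, Finset.mem_product, Finset.mem_Ioc, Slt] at *
      omega
    have hn : (i + 1, j + 1) ∉ T := fun hx => lt_irrefl _ (hlt _ hx).1
    rw [← he, ← Finset.card_insert_of_notMem hn]
    apply card_le_chainLen _ (IsCh_insert hc hlt)
    intro x hx
    rw [Finset.mem_insert] at hx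
    rcases hx with rfl | hx
    · simp [h]; omega
    · have := hT hx
      simp only [Finset.mem_inter, Finset.mem_product, Finset.mem_Ioc] at *
      refine ⟨this.1, ?_⟩
      omega
  · rw [add_zero]
    apply chainLen_mono
    intro x hx
    simp only [Finset.mem_inter, Finset.mem_product, Finset.mem_Ioc] at *
    refine ⟨hx.1, ?_⟩
    omega

theorem chainLen_rect_mono (S : Finset (ℕ × ℕ)) {a b i j a' b' i' j' : ℕ} (ha : a' ≤ a)
    (hb : b' ≤ b) (hi : i ≤ i') (hj : j ≤ j') :
    chainLen (S ∩ Rect a i b j) ≤ chainLen (S ∩ Rect a' i' b' j') := by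
  apply chainLen_mono
  intro x hx
  simp only [Finset.mem_inter, Finset.mem_product, Finset.mem_Ioc] at *
  refine ⟨hx.1, ?_⟩
  omega

theorem HH_row0 (S : Finset (ℕ × ℕ)) (i : ℕ) :
    HH S i 0 = (S ∩ (Finset.Ioc 0 i ×ˢ {0})).card := by
  induction i with
  | zero => simp [HH_00]
  | succ i ih =>
    have : Finset.Ioc 0 (i + 1) ×ˢ ({0} : Finset ℕ) = insert (i + 1, 0) (Finset.Ioc 0 i ×ˢ {0}) := by
      ext ⟨x, y⟩
      simp only [Finset.mem_product, Finset.mem_Ioc, Finset.mem_singleton, Finset.mem_insert,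
        Prod.mk.injEq]
      omega
    rw [HH_s0, ih, this]
    split_ifs with h
    · rw [Finset.inter_insert_of_mem h, Finset.card_insert_of_notMem (by simp)]
    · rw [Finset.inter_insert_of_notMem h]; rfl

theorem HH_col0 (S : Finset (ℕ × ℕ)) (j : ℕ) :
    HH S 0 j = (S ∩ ({0} ×ˢ Finset.Ioc 0 j)).card := by
  induction j with
  | zero => simp [HH_00]
  | succ i ih =>
    have : ({0} : Finset ℕ) ×ˢ Finset.Ioc 0 (i + 1) = insert (0, i + 1) ({0} ×ˢ Finset.Ioc 0 i) := by
      ext ⟨x, y⟩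
      simp only [Finset.mem_product, Finset.mem_Ioc, Finset.mem_singleton, Finset.mem_insert,
        Prod.mk.injEq]
      omega
    rw [HH_0s, ih, this]
    split_ifs with h
    · rw [Finset.inter_insert_of_mem h, Finset.card_insert_of_notMem (by simp)]
    · rw [Finset.inter_insert_of_notMem h]; rfl

/-- Exit point decomposition. -/
theorem HH_exit (S : Finset (ℕ × ℕ)) (n : ℕ) : ∀ i j, i + j ≤ n →
    (∃ z ≤ i, HH S i j ≤ HH S z 0 + chainLen (S ∩ Rect z i 0 j)) ∨
    (∃ z ≤ j, HH S i j ≤ HH S 0 z + chainLen (S ∩ Rect 0 i z j)) := by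
  induction n with
  | zero =>
    intro i j h
    obtain rfl : i = 0 := by omega
    obtain rfl : j = 0 := by omega
    exact Or.inl ⟨0, le_rfl, by omega⟩
  | succ n ih =>
    intro i j h
    rcases i with _ | i
    · exact Or.inr ⟨j, le_rfl, by omega⟩
    rcases j with _ | j
    · exact Or.inl ⟨i + 1, le_rfl, by omega⟩
    rw [HH_ss]
    rcases le_total (max (HH S i (j + 1)) (HH S (i + 1) j))
      (HH S i j + (if (i + 1, j + 1) ∈ S then 1 else 0)) with h1 | h1
    · rw [max_eq_right h1]
      rcases ih i j (by omega) with ⟨z, hz, h2⟩ | ⟨z, hz, h2⟩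
      · refine Or.inl ⟨z, by omega, ?_⟩
        have := chainLen_add S z 0 i j hz (by omega)
        omega
      · refine Or.inr ⟨z, by omega, ?_⟩
        have := chainLen_add S 0 z i j (by omega) hz
        omega
    · rw [max_eq_left h1]
      rcases le_total (HH S i (j + 1)) (HH S (i + 1) j) with h3 | h3
      · rw [max_eq_right h3]
        rcases ih (i + 1) j (by omega) with ⟨z, hz, h2⟩ | ⟨z, hz, h2⟩
        · refine Or.inl ⟨z, by omega, ?_⟩
          have := chainLen_rect_mono S (le_refl z) (le_refl 0) (le_refl (i + 1)) (by omega : j ≤ j + 1)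
          omega
        · refine Or.inr ⟨z, by omega, ?_⟩
          have := chainLen_rect_mono S (le_refl 0) (le_refl z) (le_refl (i + 1)) (by omega : j ≤ j + 1)
          omega
      · rw [max_eq_left h3]
        rcases ih i (j + 1) (by omega) with ⟨z, hz, h2⟩ | ⟨z, hz, h2⟩
        · refine Or.inl ⟨z, by omega, ?_⟩
          have := chainLen_rect_mono S (le_refl z) (le_refl 0) (by omega : i ≤ i + 1) (le_refl (j + 1))
          omega
        · refine Or.inr ⟨z, by omega, ?_⟩
          have := chainLen_rect_mono S (le_refl 0) (le_refl z) (by omega : i ≤ i + 1) (le_refl (j + 1))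
          omega


/-- Vertical increments along a row. -/
def rowB (A : Finset ℕ) (T : Finset (ℕ × ℕ)) (j : ℕ) : ℕ → Bool
  | 0 => decide ((0, j) ∈ T)
  | n + 1 => if n + 1 ∈ A then false else (rowB A T j n || decide ((n + 1, j) ∈ T))

/-- New horizontal increments after a row. -/
def rowA (A : Finset ℕ) (T : Finset (ℕ × ℕ)) (j : ℕ) : ℕ → Finset ℕ
  | 0 => ∅
  | n + 1 => if rowB A T j n = false ∧ (n + 1 ∈ A ∨ (n + 1, j) ∈ T)
      then insert (n + 1) (rowA A T j n) else rowA A T j n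

theorem rowB_congr {A A' : Finset ℕ} {T T' : Finset (ℕ × ℕ)} {j n : ℕ}
    (h : ∀ i ≤ n, (i ∈ A ↔ i ∈ A')) (h' : ∀ i ≤ n, ((i, j) ∈ T ↔ (i, j) ∈ T')) :
    rowB A T j n = rowB A' T' j n := by
  induction n with
  | zero => simp only [rowB, h' 0 le_rfl]
  | succ n ih =>
    simp only [rowB, h (n + 1) le_rfl, h' (n + 1) le_rfl]
    rw [ih (fun i hi => h i (by omega)) (fun i hi => h' i (by omega))]

theorem rowA_congr {A A' : Finset ℕ} {T T' : Finset (ℕ × ℕ)} {j n : ℕ}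
    (h : ∀ i ≤ n, (i ∈ A ↔ i ∈ A')) (h' : ∀ i ≤ n, ((i, j) ∈ T ↔ (i, j) ∈ T')) :
    rowA A T j n = rowA A' T' j n := by
  induction n with
  | zero => rfl
  | succ n ih =>
    have e := rowB_congr (n := n) (fun i hi => h i (by omega)) (fun i hi => h' i (by omega))
    have e2 := ih (fun i hi => h i (by omega)) (fun i hi => h' i (by omega))
    simp only [rowA, h (n + 1) le_rfl, h' (n + 1) le_rfl, e, e2]

theorem row_stationary (α p : ℝ) (hrel : α * α = p * (1 - α) * (1 - α)) (P : ℕ × ℕ → ℝ) (j : ℕ)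
    (hP0 : P (0, j) = α) (hP : ∀ i, P (i + 1, j) = p) (n : ℕ) :
    ∀ f : Finset ℕ → Bool → ℝ,
    BE (Finset.Icc 1 n) (fun _ => α) (fun A => BE (Finset.range (n + 1) ×ˢ {j}) P
      (fun T => f (rowA A T j n) (rowB A T j n)))
    = α * BE (Finset.Icc 1 n) (fun _ => α) (fun A => f A true)
      + (1 - α) * BE (Finset.Icc 1 n) (fun _ => α) (fun A => f A false) := by
  induction n with
  | zero =>
    intro f
    have e : Finset.range (0 + 1) ×ˢ ({j} : Finset ℕ) = insert (0, j) ∅ := by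
      ext ⟨x, y⟩; simp
    have e' : Finset.Icc 1 0 = (∅ : Finset ℕ) := rfl
    rw [e, e']
    simp only [BE_empty]
    rw [BE_insert (by simp)]
    simp [BE_empty, rowA, rowB, hP0]
  | succ n ih =>
    intro f
    have e1 : Finset.Icc 1 (n + 1) = insert (n + 1) (Finset.Icc 1 n) := by
      ext x; simp only [Finset.mem_Icc, Finset.mem_insert]; omega
    have e2 : Finset.range (n + 1 + 1) ×ˢ ({j} : Finset ℕ)
        = insert (n + 1, j) (Finset.range (n + 1) ×ˢ {j}) := by
      ext ⟨x, y⟩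
      simp only [Finset.mem_product, Finset.mem_range, Finset.mem_singleton, Finset.mem_insert,
        Prod.mk.injEq]
      omega
    have hn1 : n + 1 ∉ Finset.Icc 1 n := by simp
    have hn2 : (n + 1, j) ∉ Finset.range (n + 1) ×ˢ ({j} : Finset ℕ) := by simp
    rw [e1, e2]
    rw [BE_insert hn1, BE_insert hn1, BE_insert hn1]
    set C := Finset.Icc 1 n with hC
    set R := Finset.range (n + 1) ×ˢ ({j} : Finset ℕ) with hR
    have hA : ∀ A ⊆ C, n + 1 ∉ A := fun A h h' => hn1 (h h')
    have hT : ∀ T ⊆ R, (n + 1, j) ∉ T := fun A h h' => hn2 (h h')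
    have i1 : ∀ (A : Finset ℕ), ∀ i ≤ n, (i ∈ insert (n + 1) A ↔ i ∈ A) := by
      intro A i hi; rw [Finset.mem_insert]
      constructor
      · rintro (h | h)
        · omega
        · exact h
      · exact Or.inr
    have i2 : ∀ (T : Finset (ℕ × ℕ)), ∀ i ≤ n, ((i, j) ∈ insert (n + 1, j) T ↔ (i, j) ∈ T) := by
      intro A i hi; rw [Finset.mem_insert, Prod.mk.injEq]
      constructor
      · rintro (h | h)
        · omega
        · exact h
      · exact Or.inr
    -- the case `n + 1 ∈ A`
    have c1 : BE C (fun _ => α) (fun A => BE (insert (n + 1, j) R) P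
        (fun T => f (rowA (insert (n + 1) A) T j (n + 1)) (rowB (insert (n + 1) A) T j (n + 1))))
        = BE C (fun _ => α) (fun A => BE R P (fun T =>
          (fun (A : Finset ℕ) (b : Bool) => f (if b = false then insert (n + 1) A else A) false)
            (rowA A T j n) (rowB A T j n))) := by
      apply BE_congr
      intro A hAC
      rw [BE_insert hn2]
      have k1 : BE R P (fun T => f (rowA (insert (n + 1) A) (insert (n + 1, j) T) j (n + 1))
          (rowB (insert (n + 1) A) (insert (n + 1, j) T) j (n + 1)))
          = BE R P (fun T => f (if rowB A T j n = false then insert (n + 1) (rowA A T j n)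
            else rowA A T j n) false) := by
        apply BE_congr
        intro T hTR
        simp only [rowA, rowB, Finset.mem_insert_self, if_true, true_or, and_true,
          rowB_congr (i1 A) (i2 T), rowA_congr (i1 A) (i2 T)]
      have k2 : BE R P (fun T => f (rowA (insert (n + 1) A) T j (n + 1))
          (rowB (insert (n + 1) A) T j (n + 1)))
          = BE R P (fun T => f (if rowB A T j n = false then insert (n + 1) (rowA A T j n)
            else rowA A T j n) false) := by
        apply BE_congr
        intro T hTR
        simp only [rowA, rowB, Finset.mem_insert_self, if_true, true_or, and_true,
          rowB_congr (i1 A) (fun i _ => Iff.rfl : ∀ i ≤ n, ((i, j) ∈ T ↔ (i, j) ∈ T)),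
          rowA_congr (i1 A) (fun i _ => Iff.rfl : ∀ i ≤ n, ((i, j) ∈ T ↔ (i, j) ∈ T))]
      rw [k1, k2]; ring
    have c0 : BE C (fun _ => α) (fun A => BE (insert (n + 1, j) R) P
        (fun T => f (rowA A T j (n + 1)) (rowB A T j (n + 1))))
        = p * BE C (fun _ => α) (fun A => BE R P (fun T =>
          (fun (A : Finset ℕ) (b : Bool) => f (if b = false then insert (n + 1) A else A) true)
            (rowA A T j n) (rowB A T j n)))
          + (1 - p) * BE C (fun _ => α) (fun A => BE R P (fun T =>
            f (rowA A T j n) (rowB A T j n))) := by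
      rw [← BE_mul, ← BE_mul, ← BE_add]
      apply BE_congr
      intro A hAC
      rw [BE_insert hn2, hP]
      have k1 : BE R P (fun T => f (rowA A (insert (n + 1, j) T) j (n + 1))
          (rowB A (insert (n + 1, j) T) j (n + 1)))
          = BE R P (fun T => f (if rowB A T j n = false then insert (n + 1) (rowA A T j n)
            else rowA A T j n) true) := by
        apply BE_congr
        intro T hTR
        simp only [rowA, rowB, Finset.mem_insert_self, if_neg (hA A hAC), or_true, and_true,
          decide_true, Bool.or_true,
          rowB_congr (fun i _ => Iff.rfl : ∀ i ≤ n, (i ∈ A ↔ i ∈ A)) (i2 T),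
          rowA_congr (fun i _ => Iff.rfl : ∀ i ≤ n, (i ∈ A ↔ i ∈ A)) (i2 T)]
      have k2 : BE R P (fun T => f (rowA A T j (n + 1)) (rowB A T j (n + 1)))
          = BE R P (fun T => f (rowA A T j n) (rowB A T j n)) := by
        apply BE_congr
        intro T hTR
        simp [rowA, rowB, hA A hAC, hT T hTR]
      rw [k1, k2]
    have d1 := c1.trans
      (ih (fun (A : Finset ℕ) (b : Bool) => f (if b = false then insert (n + 1) A else A) false))
    have d0 := ih (fun (A : Finset ℕ) (b : Bool) =>
      f (if b = false then insert (n + 1) A else A) true)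
    rw [d1, c0, d0, ih f]
    simp only [if_true, Bool.true_eq_false, if_false]
    linear_combination (BE C (fun _ => α) (fun A => f A false) - BE C (fun _ => α)
      (fun A => f (insert (n + 1) A) true)) * hrel

/-- Positions of the horizontal increments on row `j`. -/
noncomputable def Aset (S : Finset (ℕ × ℕ)) (n j : ℕ) : Finset ℕ :=
  (Finset.Icc 1 n).filter (fun i => HH S i j = HH S (i - 1) j + 1)

theorem mem_Aset_succ (S : Finset (ℕ × ℕ)) {N n j : ℕ} (h : n + 1 ≤ N) :
    n + 1 ∈ Aset S N j ↔ HH S (n + 1) j = HH S n j + 1 := by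
  simp [Aset]; omega

theorem Aset_succ (S : Finset (ℕ × ℕ)) (n j : ℕ) : Aset S (n + 1) j =
    if HH S (n + 1) j = HH S n j + 1 then insert (n + 1) (Aset S n j) else Aset S n j := by
  have e1 : Finset.Icc 1 (n + 1) = insert (n + 1) (Finset.Icc 1 n) := by
    ext x; simp only [Finset.mem_Icc, Finset.mem_insert]; omega
  rw [Aset, e1, Finset.filter_insert]; rfl

theorem rowB_HH (S : Finset (ℕ × ℕ)) (N j n : ℕ) (h : n ≤ N) :
    rowB (Aset S N j) S (j + 1) n = decide (HH S n (j + 1) = HH S n j + 1) := by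
  induction n with
  | zero =>
    simp only [rowB, HH_0s]; split_ifs with h <;> simp [h]
  | succ n ih =>
    simp only [rowB, ih (by omega), mem_Aset_succ S h]
    have a1 := HH_x S n j
    have a2 := HH_y S n j
    rw [HH_ss]
    split_ifs with h1 h2 h2
    · symm; rw [decide_eq_false_iff_not]; omega
    · symm; rw [decide_eq_false_iff_not]; omega
    · simp [h2]; omega
    · simp [h2]; omega

theorem rowA_HH (S : Finset (ℕ × ℕ)) (N j n : ℕ) (h : n ≤ N) :
    rowA (Aset S N j) S (j + 1) n = Aset S n (j + 1) := by
  induction n with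
  | zero => rfl
  | succ n ih =>
    simp only [rowA, ih (by omega), mem_Aset_succ S h, rowB_HH S N j n (by omega), Aset_succ S n (j+1)]
    have a1 := HH_x S n j
    have a2 := HH_y S n j
    have : (decide (HH S n (j + 1) = HH S n j + 1) = false ∧
        (HH S (n + 1) j = HH S n j + 1 ∨ (n + 1, j + 1) ∈ S)) ↔
        HH S (n + 1) (j + 1) = HH S n (j + 1) + 1 := by
      rw [HH_ss, decide_eq_false_iff_not]
      split_ifs with h2
      · simp only [h2, or_true, and_true]; omega
      · simp only [h2, or_false]; omega
    simp only [this]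

theorem HH_congr (S S' : Finset (ℕ × ℕ)) (k : ℕ) : ∀ i j, i + j ≤ k →
    (∀ i' ≤ i, ∀ j' ≤ j, ((i', j') ∈ S ↔ (i', j') ∈ S')) → HH S i j = HH S' i j := by
  induction k with
  | zero =>
    intro i j h _
    obtain rfl : i = 0 := by omega
    obtain rfl : j = 0 := by omega
    rw [HH_00, HH_00]
  | succ k ih =>
    intro i j h hh
    rcases i with _ | i <;> rcases j with _ | j
    · rw [HH_00, HH_00]
    · rw [HH_0s, HH_0s, ih 0 j (by omega) (fun a ha b hb => hh a (by omega) b (by omega))]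
      simp only [hh 0 le_rfl (j + 1) le_rfl]
    · rw [HH_s0, HH_s0, ih i 0 (by omega) (fun a ha b hb => hh a (by omega) b (by omega))]
      simp only [hh (i + 1) le_rfl 0 le_rfl]
    · rw [HH_ss, HH_ss, ih i j (by omega) (fun a ha b hb => hh a (by omega) b (by omega)),
        ih i (j + 1) (by omega) (fun a ha b hb => hh a (by omega) b (by omega)),
        ih (i + 1) j (by omega) (fun a ha b hb => hh a (by omega) b (by omega))]
      simp only [hh (i + 1) le_rfl (j + 1) le_rfl]

theorem Aset_congr (S S' : Finset (ℕ × ℕ)) (n j : ℕ)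
    (h : ∀ i' ≤ n, ∀ j' ≤ j, ((i', j') ∈ S ↔ (i', j') ∈ S')) : Aset S n j = Aset S' n j := by
  unfold Aset
  apply Finset.filter_congr
  intro i hi
  rw [Finset.mem_Icc] at hi
  rw [HH_congr S S' _ i j le_rfl (fun a ha b hb => h a (by omega) b (by omega)),
    HH_congr S S' _ (i - 1) j le_rfl (fun a ha b hb => h a (by omega) b (by omega))]

/-- Probabilities for the stationary model. -/
noncomputable def Pst (α p : ℝ) (x : ℕ × ℕ) : ℝ := if x.1 = 0 ∨ x.2 = 0 then α else p

/-- Full grid including the boundary. -/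
abbrev Gr (n m : ℕ) : Finset (ℕ × ℕ) := Finset.range (n + 1) ×ˢ Finset.range (m + 1)

theorem Aset_law (α p : ℝ) (hrel : α * α = p * (1 - α) * (1 - α)) (n m : ℕ) :
    ∀ f : Finset ℕ → ℝ, BE (Gr n m) (Pst α p) (fun S => f (Aset S n m))
      = BE (Finset.Icc 1 n) (fun _ => α) f := by
  induction m with
  | zero =>
    induction n with
    | zero =>
      intro f
      have e : Finset.Icc 1 0 = (∅ : Finset ℕ) := rfl
      rw [e, BE_empty, ← BE_const (Gr 0 0) (Pst α p) (f ∅)]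
      rfl
    | succ n ih =>
      intro f
      have e1 : Finset.Icc 1 (n + 1) = insert (n + 1) (Finset.Icc 1 n) := by
        ext x; simp only [Finset.mem_Icc, Finset.mem_insert]; omega
      have e2 : Gr (n + 1) 0 = insert (n + 1, 0) (Gr n 0) := by
        ext ⟨x, y⟩
        simp only [Finset.mem_product, Finset.mem_range, Finset.mem_insert, Prod.mk.injEq]
        omega
      have hn : (n + 1, 0) ∉ Gr n 0 := by simp
      rw [e1, e2, BE_insert hn, BE_insert (by simp), ← ih, ← ih]
      have hp : Pst α p (n + 1, 0) = α := by simp [Pst]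
      rw [hp]
      congr 1
      · congr 1
        apply BE_congr
        intro S hS
        rw [Aset_succ, HH_s0, if_pos (Finset.mem_insert_self _ _), if_pos rfl,
          Aset_congr (insert (n + 1, 0) S) S]
        intro a ha b hb
        rw [Finset.mem_insert, Prod.mk.injEq]
        constructor
        · rintro (h | h)
          · omega
          · exact h
        · exact Or.inr
      · congr 1
        apply BE_congr
        intro S hS
        rw [Aset_succ, HH_s0, if_neg (fun h => hn (hS h)), if_neg (by omega)]
  | succ m ih =>
    intro f
    have e2 : Gr n (m + 1) = Gr n m ∪ Finset.range (n + 1) ×ˢ {m + 1} := by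
      ext ⟨x, y⟩
      simp only [Finset.mem_product, Finset.mem_range, Finset.mem_union, Finset.mem_singleton]
      omega
    have hd : Disjoint (Gr n m) (Finset.range (n + 1) ×ˢ {m + 1}) := by
      rw [Finset.disjoint_left]
      rintro ⟨x, y⟩
      simp only [Finset.mem_product, Finset.mem_range, Finset.mem_singleton]
      omega
    rw [e2, BE_union hd]
    have key : BE (Gr n m) (Pst α p) (fun S => BE (Finset.range (n + 1) ×ˢ {m + 1}) (Pst α p)
        (fun T => f (Aset (S ∪ T) n (m + 1))))
        = BE (Gr n m) (Pst α p) (fun S => (fun A => BE (Finset.range (n + 1) ×ˢ {m + 1}) (Pst α p)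
        (fun T => f (rowA A T (m + 1) n))) (Aset S n m)) := by
      apply BE_congr
      intro S hS
      apply BE_congr
      intro T hT
      have a1 : Aset S n m = Aset (S ∪ T) n m := by
        apply Aset_congr
        intro a ha b hb
        rw [Finset.mem_union]
        constructor
        · exact Or.inl
        · rintro (h | h)
          · exact h
          · have := hT h
            simp only [Finset.mem_product, Finset.mem_range, Finset.mem_singleton] at this
            omega
      rw [a1, ← rowA_HH (S ∪ T) n m n le_rfl]
      congr 1
      apply rowA_congr (fun i _ => Iff.rfl)
      intro i hi
      rw [Finset.mem_union]
      constructor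
      · rintro (h | h)
        · have := hS h
          simp only [Finset.mem_product, Finset.mem_range] at this
          omega
        · exact h
      · exact Or.inr
    have key2 := key.trans (ih (fun A => BE (Finset.range (n + 1) ×ˢ {m + 1}) (Pst α p)
        (fun T => f (rowA A T (m + 1) n))))
    rw [key2]
    have := row_stationary α p hrel (Pst α p) (m + 1) (by simp [Pst]) (by intro i; simp [Pst]) n
      (fun A _ => f A)
    rw [this]; ring

theorem HH_eq (S : Finset (ℕ × ℕ)) (n m : ℕ) : HH S n m = HH S 0 m + (Aset S n m).card := by
  induction n with
  | zero => simp [Aset]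
  | succ n ih =>
    rw [Aset_succ]
    have := HH_x S n m
    split_ifs with h
    · rw [Finset.card_insert_of_notMem (by simp [Aset])]; omega
    · omega

theorem HH_mean (α p : ℝ) (hrel : α * α = p * (1 - α) * (1 - α)) (n m : ℕ) :
    BE (Gr n m) (Pst α p) (fun S => (HH S n m : ℝ)) = m * α + n * α := by
  have : BE (Gr n m) (Pst α p) (fun S => (HH S n m : ℝ))
      = BE (Gr n m) (Pst α p) (fun S => ((S ∩ ({0} ×ˢ Finset.Ioc 0 m)).card : ℝ)
        + (fun A => (A.card : ℝ)) (Aset S n m)) := by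
    apply BE_congr
    intro S _
    rw [HH_eq, HH_col0]; push_cast; rfl
  rw [this, BE_add, Aset_law α p hrel n m (fun A => (A.card : ℝ)), BE_card_inter]
  · have e := BE_card_inter (Finset.Icc 1 n) (Finset.Icc 1 n) subset_rfl (fun _ => α)
    have e' : BE (Finset.Icc 1 n) (fun _ => α) (fun A => (A.card : ℝ))
        = BE (Finset.Icc 1 n) (fun _ => α) (fun A => ((A ∩ Finset.Icc 1 n).card : ℝ)) := by
      apply BE_congr
      intro S hS
      rw [Finset.inter_eq_left.2 hS]
    rw [e', e]
    congr 1
    · rw [Finset.sum_congr rfl (g := fun _ => α)]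
      · simp
      · rintro ⟨a, b⟩ h
        simp only [Finset.mem_product, Finset.mem_singleton] at h
        simp [Pst, h.1]
    · simp
  · rintro ⟨a, b⟩
    simp only [Finset.mem_product, Finset.mem_singleton, Finset.mem_Ioc, Finset.mem_range]
    omega


/-- Mean longest chain length in an `a × b` grid of independent Bernoulli cells. -/
noncomputable def EL (a b : ℕ) (p : ℝ) : ℝ :=
  BE (Rect 0 a 0 b) (fun _ => p) (fun S => (chainLen S : ℝ))

/-- Probability that a Poisson cell of mass `q` is occupied. -/
noncomputable def pq (q : ℝ) : ℝ := 1 - Real.exp (-q)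

theorem pq_nonneg {q : ℝ} (h : 0 ≤ q) : 0 ≤ pq q := by
  unfold pq; have := Real.exp_le_one_iff.2 (by linarith : -q ≤ 0); linarith
theorem pq_le_one (q : ℝ) : pq q ≤ 1 := by
  unfold pq; have := Real.exp_pos (-q); linarith
theorem pq_le (q : ℝ) : pq q ≤ q := by
  unfold pq; have := Real.add_one_le_exp (-q); linarith
theorem pq_ge {q : ℝ} (h : 0 ≤ q) : q / (1 + q) ≤ pq q := by
  unfold pq
  have h1 := Real.add_one_le_exp q
  rw [Real.exp_neg]
  have : (Real.exp q)⁻¹ ≤ (1 + q)⁻¹ := inv_anti₀ (by linarith) (by linarith)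
  have e : q / (1 + q) = 1 - (1 + q)⁻¹ := by field_simp; ring
  linarith

theorem EL_translate (x y a b : ℕ) (p : ℝ) :
    BE (Rect a (a + x) b (b + y)) (fun _ => p) (fun S => (chainLen S : ℝ)) = EL x y p := by
  have h := BE_image (fun z : ℕ × ℕ => (z.1 + a, z.2 + b)) (Rect 0 x 0 y) (Rect a (a + x) b (b + y))
    (by
      rintro ⟨i, j⟩
      simp only [Finset.mem_product, Finset.mem_Ioc]; omega) (fun _ => p)
    (fun S => (chainLen S : ℝ))
  have e1 : BE (Rect 0 x 0 y) (fun _ => p)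
      (fun S => (chainLen (S.image (fun z : ℕ × ℕ => (z.1 + a, z.2 + b))) : ℝ)) = EL x y p := by
    apply BE_congr
    intro S _
    congr 1
    apply le_antisymm
    · apply chainLen_image_le
      rintro ⟨i, j⟩ ⟨i', j'⟩
      simp only [Slt]; omega
    · apply chainLen_le_image
      rintro ⟨i, j⟩ ⟨i', j'⟩
      simp only [Slt]; omega
  rw [← e1, h]
  apply BE_congr_p
  rintro ⟨i, j⟩ hij
  have : (Rect 0 x 0 y).filter (fun c => (c.1 + a, c.2 + b) = (i, j)) = {(i - a, j - b)} := by
    ext ⟨u, v⟩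
    simp only [Finset.mem_product, Finset.mem_Ioc, Finset.mem_filter, Finset.mem_singleton,
      Prod.mk.injEq] at *
    omega
  rw [this]; simp

theorem EL_split (a b r s : ℕ) (hr : 1 ≤ r) (hs : 1 ≤ s) (q : ℝ) (hq : 0 ≤ q) :
    EL a b (pq (r * s * q)) ≤ EL (r * a) (s * b) (pq q) := by
  have hdiv : ∀ r i a : ℕ, 1 ≤ r → 0 < i → i ≤ r * a → (i - 1) / r + 1 ≤ a := by
    intro r i a hr hi h
    have : (i - 1) / r < a := by
      rw [Nat.div_lt_iff_lt_mul (by omega), mul_comm]; omega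
    omega
  have h := BE_image (fun z : ℕ × ℕ => ((z.1 - 1) / r + 1, (z.2 - 1) / s + 1))
    (Rect 0 (r * a) 0 (s * b)) (Rect 0 a 0 b)
    (by
      rintro ⟨i, j⟩
      simp only [Finset.mem_product, Finset.mem_Ioc]
      rintro ⟨⟨h1, h2⟩, h3, h4⟩
      exact ⟨⟨Nat.succ_pos _, hdiv r i a hr h1 h2⟩, Nat.succ_pos _, hdiv s j b hs h3 h4⟩) (fun _ => pq q)
    (fun S => (chainLen S : ℝ))
  have e1 : EL a b (pq (r * s * q)) = BE (Rect 0 (r * a) 0 (s * b)) (fun _ => pq q)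
    (fun S => (chainLen (S.image
      (fun z : ℕ × ℕ => ((z.1 - 1) / r + 1, (z.2 - 1) / s + 1))) : ℝ)) := by
    rw [h]
    apply BE_congr_p
    rintro ⟨i, j⟩ hij
    have hfib : ∀ r i u a : ℕ, 1 ≤ r → 0 < i → i ≤ a →
        ((0 < u ∧ u ≤ r * a) ∧ (u - 1) / r + 1 = i ↔ (r * (i - 1) < u ∧ u ≤ r * (i - 1) + r)) := by
      intro r i u a hr hi hia
      obtain ⟨i, rfl⟩ : ∃ i', i = i' + 1 := ⟨i - 1, by omega⟩
      have e : (u - 1) / r + 1 = i + 1 ↔ (u - 1) / r = i := by omega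
      rw [e, Nat.div_eq_iff (by omega)]
      have hle : r * (i + 1) ≤ r * a := Nat.mul_le_mul_left r hia
      rw [Nat.mul_add, Nat.mul_one] at hle
      have e3 : i * r = r * i := Nat.mul_comm _ _
      simp only [Nat.add_sub_cancel, e3]
      omega
    have : (Rect 0 (r * a) 0 (s * b)).filter
        (fun c => ((c.1 - 1) / r + 1, (c.2 - 1) / s + 1) = (i, j))
        = Rect (r * (i - 1)) (r * (i - 1) + r) (s * (j - 1)) (s * (j - 1) + s) := by
      simp only [Finset.mem_product, Finset.mem_Ioc] at hij
      ext ⟨u, v⟩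
      simp only [Finset.mem_product, Finset.mem_Ioc, Finset.mem_filter, Prod.mk.injEq]
      have h1 := hfib r i u a hr hij.1.1 hij.1.2
      have h2 := hfib s j v b hs hij.2.1 hij.2.2
      tauto
    simp only [this]
    rw [Finset.prod_const, Finset.card_product, Nat.card_Ioc, Nat.card_Ioc]
    simp only [Nat.add_sub_cancel_left, pq]
    rw [sub_sub_cancel, ← Real.exp_nat_mul]
    congr 2
    push_cast; ring
  rw [e1]
  apply BE_mono (fun _ => ⟨pq_nonneg hq, pq_le_one q⟩)
  intro S _
  norm_cast
  apply chainLen_image_le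
  rintro ⟨i, j⟩ ⟨i', j'⟩
  simp only [Slt]
  rintro ⟨h1, h2⟩
  constructor
  · by_contra hc
    have := Nat.div_le_div_right (c := r) (by omega : i' - 1 ≤ i - 1)
    omega
  · by_contra hc
    have := Nat.div_le_div_right (c := s) (by omega : j' - 1 ≤ j - 1)
    omega

theorem EL_super (N k : ℕ) (p : ℝ) (hp : 0 ≤ p ∧ p ≤ 1) :
    (k : ℝ) * EL N N p ≤ EL (k * N) (k * N) p := by
  induction k with
  | zero =>
    simp only [Nat.cast_zero, zero_mul]
    exact BE_nonneg (fun _ => hp) fun S _ => Nat.cast_nonneg _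
  | succ k ih =>
    have h1 : EL (k * N) (k * N) p = BE (Rect 0 ((k + 1) * N) 0 ((k + 1) * N)) (fun _ => p)
        (fun S => (chainLen (S ∩ Rect 0 (k * N) 0 (k * N)) : ℝ)) := by
      rw [BE_inter (f := fun S => (chainLen S : ℝ))]
      · rfl
      · have : k * N ≤ (k + 1) * N := Nat.mul_le_mul_right N (by omega)
        rintro ⟨x, y⟩
        simp only [Finset.mem_product, Finset.mem_Ioc]; omega
    have h2 : EL N N p = BE (Rect 0 ((k + 1) * N) 0 ((k + 1) * N)) (fun _ => p)
        (fun S => (chainLen (S ∩ Rect (k * N) (k * N + N) (k * N) (k * N + N)) : ℝ)) := by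
      rw [BE_inter (f := fun S => (chainLen S : ℝ))]
      · exact (EL_translate N N (k * N) (k * N) p).symm
      · have : (k + 1) * N = k * N + N := by ring
        rw [this]
        rintro ⟨x, y⟩
        simp only [Finset.mem_product, Finset.mem_Ioc]; omega
    have : ((k + 1 : ℕ) : ℝ) * EL N N p = k * EL N N p + EL N N p := by push_cast; ring
    rw [this]
    refine (add_le_add_left ih _).trans ?_
    rw [h1, h2, ← BE_add]
    apply BE_mono (fun _ => hp)
    intro S _
    norm_cast
    refine (chainLen_union ?_).trans (chainLen_mono ?_)
    · rintro ⟨x, y⟩ hx ⟨x', y'⟩ hy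
      simp only [Finset.mem_inter, Finset.mem_product, Finset.mem_Ioc, Slt] at *
      omega
    · exact Finset.union_subset Finset.inter_subset_left Finset.inter_subset_left

/-- The stationary boundary density. -/
noncomputable def al (p : ℝ) : ℝ := √p / (1 + √p)

theorem al_rel {p : ℝ} (hp : 0 ≤ p) : al p * al p = p * (1 - al p) * (1 - al p) := by
  unfold al
  have h := Real.sqrt_nonneg p
  have e : 1 - √p / (1 + √p) = 1 / (1 + √p) := by field_simp; ring
  rw [e]
  have := Real.mul_self_sqrt hp
  field_simp
  nlinarith

theorem al_nonneg (p : ℝ) : 0 ≤ al p := by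
  unfold al; positivity
theorem al_le_sqrt (p : ℝ) : al p ≤ √p := by
  unfold al; have := Real.sqrt_nonneg p; apply div_le_self this; linarith
theorem al_le_one (p : ℝ) : al p ≤ 1 := by
  unfold al; have := Real.sqrt_nonneg p
  rw [div_le_one (by linarith)]; linarith

theorem Pst_mem {p : ℝ} (hp : 0 ≤ p ∧ p ≤ 1) (x : ℕ × ℕ) :
    0 ≤ Pst (al p) p x ∧ Pst (al p) p x ≤ 1 := by
  unfold Pst
  split_ifs
  · exact ⟨al_nonneg p, al_le_one p⟩
  · exact hp

/-- Interior functionals in the stationary model. -/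
theorem BE_interior (n a b c d : ℕ) (hb : b ≤ n) (hd : d ≤ n) (α p : ℝ) (F : Finset (ℕ × ℕ) → ℝ) :
    BE (Gr n n) (Pst α p) (fun S => F (S ∩ Rect a b c d)) = BE (Rect a b c d) (fun _ => p) F := by
  rw [BE_inter]
  · apply BE_congr_p
    rintro ⟨x, y⟩
    simp only [Finset.mem_product, Finset.mem_Ioc]
    intro h
    simp only [Pst]
    rw [if_neg (by omega)]
  · rintro ⟨x, y⟩
    simp only [Finset.mem_product, Finset.mem_Ioc, Finset.mem_range]; omega

theorem EL_le (n : ℕ) (q : ℝ) (hq : 0 ≤ q) : EL n n (pq q) ≤ 2 * (n * √q) := by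
  have hp : 0 ≤ pq q ∧ pq q ≤ 1 := ⟨pq_nonneg hq, pq_le_one q⟩
  have h := HH_mean (al (pq q)) (pq q) (al_rel hp.1) n n
  have h2 := BE_interior n 0 n 0 n le_rfl le_rfl (al (pq q)) (pq q) (fun S => (chainLen S : ℝ))
  have h3 : BE (Gr n n) (Pst (al (pq q)) (pq q)) (fun S => (chainLen (S ∩ Rect 0 n 0 n) : ℝ))
      ≤ BE (Gr n n) (Pst (al (pq q)) (pq q)) (fun S => (HH S n n : ℝ)) := by
    apply BE_mono (Pst_mem hp)
    intro S _
    exact_mod_cast chainLen_le_HH S n n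
  have h4 : al (pq q) ≤ √q := (al_le_sqrt _).trans (Real.sqrt_le_sqrt (pq_le q))
  have h5 : (n : ℝ) * al (pq q) ≤ n * √q := mul_le_mul_of_nonneg_left h4 (Nat.cast_nonneg n)
  have : EL n n (pq q) = BE (Rect 0 n 0 n) (fun _ => pq q) (fun S => (chainLen S : ℝ)) := rfl
  linarith

theorem al_ge {q : ℝ} (hq : 0 ≤ q) : √q / (1 + 2 * √q) ≤ al (pq q) := by
  have h1 := pq_ge hq
  set s := √q with hs
  have hs0 : 0 ≤ s := Real.sqrt_nonneg q
  have hq2 : q = s ^ 2 := (Real.sq_sqrt hq).symm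
  have h2 : s / (1 + s) ≤ √(pq q) := by
    apply Real.le_sqrt_of_sq_le
    refine le_trans ?_ h1
    rw [hq2, div_pow]
    apply div_le_div_of_nonneg_left <;> nlinarith
  unfold al
  set u := √(pq q)
  have hu : 0 ≤ u := Real.sqrt_nonneg _
  rw [div_le_iff₀ (by linarith)] at h2
  rw [div_le_div_iff₀ (by linarith) (by linarith)]
  nlinarith

/-- Mean absolute deviation of chain length. -/
theorem chain_dev (C : Finset (ℕ × ℕ)) (p : ℝ) (hp : 0 ≤ p ∧ p ≤ 1) (v t : ℝ) (ht : 0 < t)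
    (hv : BE C (fun _ => p) (fun S => (chainLen S : ℝ)) ≤ v * t) :
    BE C (fun _ => p) (fun S => |(chainLen S : ℝ) - BE C (fun _ => p) (fun S => (chainLen S : ℝ))|)
      ≤ (1 + v) * √t := by
  have h1 := var_self_bounding (fun _ => hp) C (fun S => (chainLen S : ℝ))
    chainLen_self_bounding.1 chainLen_self_bounding.2.1 chainLen_self_bounding.2.2
  have hst : 0 < √t := Real.sqrt_pos.2 ht
  have h2 := BE_abs (p := fun _ : ℕ × ℕ => p) (fun _ => hp) C
    (fun S => (chainLen S : ℝ) - BE C (fun _ => p) (fun S => (chainLen S : ℝ))) (√t) hst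
  refine h2.trans ?_
  have : BE C (fun _ => p) (fun S => ((chainLen S : ℝ) -
      BE C (fun _ => p) (fun S => (chainLen S : ℝ))) ^ 2) / √t ≤ v * √t := by
    rw [div_le_iff₀ hst, mul_assoc, Real.mul_self_sqrt ht.le]
    linarith
  linarith

theorem card_dev {ι : Type*} [DecidableEq ι] (C R : Finset ι) (hR : R ⊆ C) (P : ι → ℝ)
    (hp : ∀ i, 0 ≤ P i ∧ P i ≤ 1) (m t : ℝ) (ht : 0 < t)
    (hm : ∑ i ∈ R, P i = m) (hv : m ≤ t) :
    BE C P (fun S => |((S ∩ R).card : ℝ) - m|) ≤ 2 * √t := by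
  have hh := card_inter_self_bounding R
  have h1 := var_self_bounding hp C (fun S => ((S ∩ R).card : ℝ)) hh.1 hh.2.1 hh.2.2
  rw [BE_card_inter C R hR, hm] at h1
  have hst : 0 < √t := Real.sqrt_pos.2 ht
  have h2 := BE_abs hp C (fun S => ((S ∩ R).card : ℝ) - m) (√t) hst
  refine h2.trans ?_
  have : BE C P (fun S => (((S ∩ R).card : ℝ) - m) ^ 2) / √t ≤ √t := by
    rw [div_le_iff₀ hst, Real.mul_self_sqrt ht.le]
    linarith
  linarith


theorem rect_bound (c : ℝ)
    (H : ∀ t : ℝ, 0 < t → ∀ N : ℕ, 1 ≤ N → EL N N (pq (t ^ 2 / N ^ 2)) ≤ c * t)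
    (a b : ℕ) (ha : 1 ≤ a) (hb : 1 ≤ b) (q : ℝ) (hq : 0 < q) :
    EL a b (pq q) ≤ c * √(a * b * q) := by
  have ha' : (0 : ℝ) < a := by exact_mod_cast ha
  have hb' : (0 : ℝ) < b := by exact_mod_cast hb
  have h1 := EL_split a b b a hb ha (q / (a * b)) (by positivity)
  have e1 : (b : ℝ) * a * (q / (a * b)) = q := by field_simp
  rw [e1] at h1
  refine h1.trans ?_
  have h2 := H (√(a * b * q)) (by positivity) (a * b) (Nat.mul_pos ha hb)
  rw [Real.sq_sqrt (by positivity)] at h2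
  have e2 : (a : ℝ) * b * q / ((a * b : ℕ) : ℝ) ^ 2 = q / (a * b) := by
    push_cast; field_simp
  rw [e2] at h2
  rwa [mul_comm b a]

theorem exists_block (K M z : ℕ) (hK : 1 ≤ K) (hM : 1 ≤ M) (hz : z ≤ K * M) :
    ∃ j ∈ Finset.range K, j * M ≤ z ∧ z ≤ (j + 1) * M := by
  rcases Nat.lt_or_ge z (K * M) with h | h
  · refine ⟨z / M, ?_, Nat.div_mul_le_self z M, ?_⟩
    · rw [Finset.mem_range, Nat.div_lt_iff_lt_mul (by omega)]; exact h
    · have h1 := Nat.div_add_mod z M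
      have h2 := Nat.mod_lt z (by omega : 0 < M)
      nlinarith
  · obtain ⟨k, rfl⟩ : ∃ k, K = k + 1 := ⟨K - 1, by omega⟩
    refine ⟨k, by simp, ?_, hz⟩
    refine le_trans ?_ h
    exact Nat.mul_le_mul_right M (by omega)

theorem lb_step (c : ℝ) (hc0 : 0 ≤ c) (hc : c < 2)
    (H : ∀ t : ℝ, 0 < t → ∀ N : ℕ, 1 ≤ N → EL N N (pq (t ^ 2 / N ^ 2)) ≤ c * t)
    (K M : ℕ) (hK : 1 ≤ K) (hM : 1 ≤ M) (t : ℝ) (ht : 0 < t) :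
    2 * ((K * M : ℕ) * al (pq (t ^ 2 / (K * M : ℕ) ^ 2)))
      ≤ t * (1 / K + 1 + c ^ 2 / 4) + 10 * K * √t := by
  set N := K * M with hN
  have hN1 : 1 ≤ N := Nat.mul_pos hK hM
  have hN' : (0 : ℝ) < N := by exact_mod_cast hN1
  have hK' : (0 : ℝ) < K := by exact_mod_cast hK
  have hM' : (0 : ℝ) < M := by exact_mod_cast hM
  have hNe : (N : ℝ) = K * M := by rw [hN]; push_cast; rfl
  set q : ℝ := t ^ 2 / (N : ℝ) ^ 2 with hq
  have hq0 : 0 < q := by positivity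
  have hsq : √q = t / N := by
    rw [hq, ← div_pow, Real.sqrt_sq (by positivity)]
  set p := pq q with hpdef
  have hp : 0 ≤ p ∧ p ≤ 1 := ⟨pq_nonneg hq0.le, pq_le_one q⟩
  set α := al p with hα
  have hα1 : α ≤ t / N := by
    rw [← hsq]; exact (al_le_sqrt _).trans (Real.sqrt_le_sqrt (pq_le q))
  have hα0 : 0 ≤ α := al_nonneg p
  set E := BE (Gr N N) (Pst α p) with hE
  have hst : 0 < √t := Real.sqrt_pos.2 ht
  -- blocks
  have hjN : ∀ j ∈ Finset.range K, (j + 1) * M ≤ N := by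
    intro j hj
    rw [Finset.mem_range] at hj
    exact Nat.mul_le_mul_right M hj
  have hmean : ∀ a b : ℕ, 1 ≤ a → a ≤ N → b = N → True := fun _ _ _ _ _ => trivial
  let R1 : ℕ → Finset (ℕ × ℕ) := fun j => Finset.Ioc 0 ((j + 1) * M) ×ˢ {0}
  let R2 : ℕ → Finset (ℕ × ℕ) := fun j => {0} ×ˢ Finset.Ioc 0 ((j + 1) * M)
  let m1 : ℕ → ℝ := fun j => ((j + 1) * M : ℕ) * α
  let Q1 : ℕ → Finset (ℕ × ℕ) := fun j => Rect (j * M) N 0 N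
  let Q2 : ℕ → Finset (ℕ × ℕ) := fun j => Rect 0 N (j * M) N
  let l1 : ℕ → ℝ := fun j => BE (Q1 j) (fun _ => p) (fun S => (chainLen S : ℝ))
  let l2 : ℕ → ℝ := fun j => BE (Q2 j) (fun _ => p) (fun S => (chainLen S : ℝ))
  have hm1 : ∀ j ∈ Finset.range K, m1 j ≤ t * ((j + 1) / K) := by
    intro j hj
    have : m1 j ≤ ((j + 1) * M : ℕ) * (t / N) := mul_le_mul_of_nonneg_left hα1 (Nat.cast_nonneg _)
    refine this.trans (le_of_eq ?_)
    rw [hNe]; push_cast; field_simp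
  have hjK : ∀ j ∈ Finset.range K, ((j : ℝ) + 1) / K ≤ 1 := by
    intro j hj
    rw [Finset.mem_range] at hj
    rw [div_le_one hK']; exact_mod_cast hj
  have hrect : ∀ j ∈ Finset.range K, √(((N - j * M : ℕ) : ℝ) * N * q) = t * √(1 - j / K) := by
    intro j hj
    have h1 := hjN j hj
    have h2 : j * M ≤ N := le_trans (Nat.mul_le_mul_right M (by omega)) h1
    rw [Nat.cast_sub h2, hq]
    have : ((N : ℝ) - (j * M : ℕ)) * N * (t ^ 2 / (N : ℝ) ^ 2) = t ^ 2 * (1 - j / K) := by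
      rw [hNe]; push_cast; field_simp
    rw [this, Real.sqrt_mul (by positivity), Real.sqrt_sq ht.le]
  have hl1 : ∀ j ∈ Finset.range K, l1 j ≤ c * (t * √(1 - j / K)) := by
    intro j hj
    have h1 := hjN j hj
    have h0 : j * M + M ≤ N := by linarith [h1, Nat.add_mul j 1 M]
    have e := EL_translate (N - j * M) N (j * M) 0 p
    rw [Nat.zero_add, (by omega : j * M + (N - j * M) = N)] at e
    rw [← hrect j hj]
    have := rect_bound c H (N - j * M) N (by omega) hN1 q hq0
    rw [← e] at this
    exact this
  have hl2 : ∀ j ∈ Finset.range K, l2 j ≤ c * (t * √(1 - j / K)) := by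
    intro j hj
    have h1 := hjN j hj
    have h0 : j * M + M ≤ N := by linarith [h1, Nat.add_mul j 1 M]
    have e := EL_translate N (N - j * M) 0 (j * M) p
    rw [Nat.zero_add, (by omega : j * M + (N - j * M) = N)] at e
    rw [← hrect j hj, mul_comm ((N - j * M : ℕ) : ℝ) (N : ℝ)]
    have := rect_bound c H N (N - j * M) hN1 (by omega) q hq0
    rw [← e] at this
    exact this
  have hsle : ∀ j : ℕ, √(1 - (j : ℝ) / K) ≤ 1 := by
    intro j
    have : 0 ≤ (j : ℝ) / K := by positivity
    exact Real.sqrt_le_iff.2 ⟨by norm_num, by linarith⟩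
  have hl_small : ∀ j : ℕ, c * (t * √(1 - (j : ℝ) / K)) ≤ 2 * t := by
    intro j
    have := hsle j
    have h0 := Real.sqrt_nonneg (1 - (j : ℝ) / K)
    have : t * √(1 - (j : ℝ) / K) ≤ t := by nlinarith
    nlinarith
  have hB : ∀ j ∈ Finset.range K, t * ((j + 1) / K) + c * (t * √(1 - j / K))
      ≤ t * (1 / K + 1 + c ^ 2 / 4) := by
    intro j hj
    have h1 := hjK j hj
    have h2 : 0 ≤ 1 - (j : ℝ) / K := by
      have : (j : ℝ) / K ≤ ((j : ℝ) + 1) / K := by gcongr; linarith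
      linarith
    have h3 := Real.sq_sqrt h2
    set s := √(1 - (j : ℝ) / K)
    have e : ((j : ℝ) + 1) / K = 1 / K + (1 - s ^ 2) := by rw [h3]; ring
    rw [e]
    have : 1 / (K : ℝ) + (1 - s ^ 2) + c * s ≤ 1 / K + 1 + c ^ 2 / 4 := by
      nlinarith [sq_nonneg (s - c / 2)]
    calc t * (1 / (K : ℝ) + (1 - s ^ 2)) + c * (t * s)
        = t * (1 / (K : ℝ) + (1 - s ^ 2) + c * s) := by ring
      _ ≤ _ := mul_le_mul_of_nonneg_left this ht.le
  set B := t * (1 / K + 1 + c ^ 2 / 4) with hBdef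
  have hm1t : ∀ j ∈ Finset.range K, m1 j ≤ t := by
    intro j hj
    have := hm1 j hj
    have := hjK j hj
    nlinarith
  -- deviations
  have d1 : ∀ j ∈ Finset.range K, E (fun S => |((S ∩ R1 j).card : ℝ) - m1 j|) ≤ 2 * √t := by
    intro j hj
    have h1 := hjN j hj
    apply card_dev _ _ _ _ (Pst_mem hp) _ _ ht _ (hm1t j hj)
    · rintro ⟨x, y⟩
      simp only [R1, Finset.mem_product, Finset.mem_Ioc, Finset.mem_range, Finset.mem_singleton]
      omega
    · rw [Finset.sum_congr rfl (g := fun _ => α)]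
      · simp [R1, m1]
      · rintro ⟨x, y⟩ h
        simp only [R1, Finset.mem_product, Finset.mem_singleton] at h
        simp [Pst, h.2, hα]
  have d2 : ∀ j ∈ Finset.range K, E (fun S => |((S ∩ R2 j).card : ℝ) - m1 j|) ≤ 2 * √t := by
    intro j hj
    have h1 := hjN j hj
    apply card_dev _ _ _ _ (Pst_mem hp) _ _ ht _ (hm1t j hj)
    · rintro ⟨x, y⟩
      simp only [R2, Finset.mem_product, Finset.mem_Ioc, Finset.mem_range, Finset.mem_singleton]
      omega
    · rw [Finset.sum_congr rfl (g := fun _ => α)]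
      · simp [R2, m1]
      · rintro ⟨x, y⟩ h
        simp only [R2, Finset.mem_product, Finset.mem_singleton] at h
        simp [Pst, h.1, hα]
  have d3 : ∀ j ∈ Finset.range K, E (fun S => |(chainLen (S ∩ Q1 j) : ℝ) - l1 j|) ≤ 3 * √t := by
    intro j hj
    have e := BE_interior N (j * M) N 0 N le_rfl le_rfl α p (fun S => |(chainLen S : ℝ) - l1 j|)
    have := chain_dev (Q1 j) p hp 2 t ht ((hl1 j hj).trans (hl_small j))
    refine (le_of_eq e).trans (this.trans (by linarith))
  have d4 : ∀ j ∈ Finset.range K, E (fun S => |(chainLen (S ∩ Q2 j) : ℝ) - l2 j|) ≤ 3 * √t := by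
    intro j hj
    have e := BE_interior N 0 N (j * M) N le_rfl le_rfl α p (fun S => |(chainLen S : ℝ) - l2 j|)
    have := chain_dev (Q2 j) p hp 2 t ht ((hl2 j hj).trans (hl_small j))
    refine (le_of_eq e).trans (this.trans (by linarith))
  -- pointwise bound
  let D : ℕ → Finset (ℕ × ℕ) → ℝ := fun j S =>
    (|((S ∩ R1 j).card : ℝ) - m1 j| + |(chainLen (S ∩ Q1 j) : ℝ) - l1 j|)
    + (|((S ∩ R2 j).card : ℝ) - m1 j| + |(chainLen (S ∩ Q2 j) : ℝ) - l2 j|)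
  have hD0 : ∀ j S, 0 ≤ D j S := by intro j S; simp only [D]; positivity
  have hpt : ∀ S, (HH S N N : ℝ) ≤ B + ∑ j ∈ Finset.range K, D j S := by
    intro S
    have hsingle : ∀ j ∈ Finset.range K, D j S ≤ ∑ j ∈ Finset.range K, D j S := by
      intro j hj
      exact Finset.single_le_sum (f := fun j => D j S) (fun i _ => hD0 i S) hj
    rcases HH_exit S _ N N le_rfl with ⟨z, hz, h⟩ | ⟨z, hz, h⟩
    · obtain ⟨j, hj, hj1, hj2⟩ := exists_block K M z hK hM hz
      have g1 : HH S z 0 ≤ (S ∩ R1 j).card := by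
        rw [← HH_row0]; exact HH_mono S hj2 le_rfl
      have g2 : chainLen (S ∩ Rect z N 0 N) ≤ chainLen (S ∩ Q1 j) :=
        chainLen_rect_mono S hj1 le_rfl le_rfl le_rfl
      have g3 : (HH S N N : ℝ) ≤ (S ∩ R1 j).card + chainLen (S ∩ Q1 j) := by
        exact_mod_cast h.trans (add_le_add g1 g2)
      have g4 := hB j hj
      have g5 := hm1 j hj
      have g6 := hl1 j hj
      have g7 := le_abs_self (((S ∩ R1 j).card : ℝ) - m1 j)
      have g8 := le_abs_self ((chainLen (S ∩ Q1 j) : ℝ) - l1 j)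
      have g9 := abs_nonneg (((S ∩ R2 j).card : ℝ) - m1 j)
      have g10 := abs_nonneg ((chainLen (S ∩ Q2 j) : ℝ) - l2 j)
      have g11 := hsingle j hj
      simp only [D] at g11 ⊢
      linarith
    · obtain ⟨j, hj, hj1, hj2⟩ := exists_block K M z hK hM hz
      have g1 : HH S 0 z ≤ (S ∩ R2 j).card := by
        rw [← HH_col0]; exact HH_mono S le_rfl hj2
      have g2 : chainLen (S ∩ Rect 0 N z N) ≤ chainLen (S ∩ Q2 j) :=
        chainLen_rect_mono S le_rfl hj1 le_rfl le_rfl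
      have g3 : (HH S N N : ℝ) ≤ (S ∩ R2 j).card + chainLen (S ∩ Q2 j) := by
        exact_mod_cast h.trans (add_le_add g1 g2)
      have g4 := hB j hj
      have g5 := hm1 j hj
      have g6 := hl2 j hj
      have g7 := le_abs_self (((S ∩ R2 j).card : ℝ) - m1 j)
      have g8 := le_abs_self ((chainLen (S ∩ Q2 j) : ℝ) - l2 j)
      have g9 := abs_nonneg (((S ∩ R1 j).card : ℝ) - m1 j)
      have g10 := abs_nonneg ((chainLen (S ∩ Q1 j) : ℝ) - l1 j)
      have g11 := hsingle j hj
      simp only [D] at g11 ⊢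
      linarith
  have hfin : E (fun S => (HH S N N : ℝ)) ≤ E (fun S => B + ∑ j ∈ Finset.range K, D j S) :=
    BE_mono (Pst_mem hp) (fun S _ => hpt S)
  have hl : E (fun S => (HH S N N : ℝ)) = N * α + N * α := HH_mean α p (al_rel hp.1) N N
  have hr : E (fun S => B + ∑ j ∈ Finset.range K, D j S) ≤ B + ∑ j ∈ Finset.range K, 10 * √t := by
    simp only [hE]
    rw [BE_add, BE_const, BE_sum]
    gcongr with j hj
    simp only [D]
    rw [BE_add, BE_add, BE_add]
    have := d1 j hj
    have := d2 j hj
    have := d3 j hj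
    have := d4 j hj
    linarith
  rw [Finset.sum_const, Finset.card_range, nsmul_eq_mul] at hr
  linarith

theorem LB (c : ℝ) (hc0 : 0 ≤ c) (hc : c < 2) :
    ∃ t : ℝ, 0 < t ∧ ∃ N : ℕ, 1 ≤ N ∧ c * t < EL N N (pq (t ^ 2 / N ^ 2)) := by
  by_contra hcon
  have H : ∀ t : ℝ, 0 < t → ∀ N : ℕ, 1 ≤ N → EL N N (pq (t ^ 2 / N ^ 2)) ≤ c * t := by
    intro t ht N hN
    by_contra h
    exact hcon ⟨t, ht, N, hN, not_le.1 h⟩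
  set g : ℝ := 1 - c ^ 2 / 4 with hg
  have hg0 : 0 < g := by nlinarith
  obtain ⟨K, hK⟩ := exists_nat_gt (4 / g)
  have hK0 : (0 : ℝ) < K := lt_trans (by positivity) hK
  have hK1 : 1 ≤ K := by exact_mod_cast hK0
  set t : ℝ := (40 * K / g) ^ 2 with ht
  have hst : √t = 40 * K / g := Real.sqrt_sq (by positivity)
  have ht0 : 0 < t := by positivity
  obtain ⟨M, hM⟩ := exists_nat_gt (16 * t / g)
  have hM0 : (0 : ℝ) < M := lt_trans (by positivity) hM
  have hM1 : 1 ≤ M := by exact_mod_cast hM0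
  have h := lb_step c hc0 hc H K M hK1 hM1 t ht0
  set N := K * M with hN
  have hN1 : 1 ≤ N := Nat.mul_pos hK1 hM1
  have hN' : (0 : ℝ) < N := by exact_mod_cast hN1
  have hNM : (M : ℝ) ≤ N := by exact_mod_cast Nat.le_mul_of_pos_left M hK1
  have hq0 : 0 ≤ t ^ 2 / (N : ℝ) ^ 2 := by positivity
  have hsq : √(t ^ 2 / (N : ℝ) ^ 2) = t / N := by
    rw [← div_pow, Real.sqrt_sq (by positivity)]
  have ha := al_ge hq0
  rw [hsq] at ha
  have hη : 2 * (t / N) ≤ g / 8 := by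
    rw [← mul_div_assoc, div_le_iff₀ hN']
    rw [div_lt_iff₀ hg0] at hM
    nlinarith
  have hy : 0 ≤ t / (N : ℝ) := by positivity
  have h1 : t * (1 - g / 8) ≤ N * al (pq (t ^ 2 / (N : ℝ) ^ 2)) := by
    have : t / N * (1 - g / 8) ≤ al (pq (t ^ 2 / (N : ℝ) ^ 2)) := by
      refine le_trans ?_ ha
      rw [le_div_iff₀ (by linarith)]
      have : (1 - g / 8) * (1 + 2 * (t / N)) ≤ 1 := by nlinarith
      nlinarith
    calc t * (1 - g / 8) = N * (t / N * (1 - g / 8)) := by field_simp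
      _ ≤ _ := mul_le_mul_of_nonneg_left this hN'.le
  have h2 : 10 * K * √t = t * (g / 4) := by
    rw [show t * (g / 4) = √t * √t * (g / 4) by rw [Real.mul_self_sqrt ht0.le], hst]
    field_simp; ring
  have h3 : 1 / (K : ℝ) ≤ g / 4 := by
    rw [div_lt_iff₀ hg0] at hK
    rw [div_le_iff₀ hK0]; linarith
  rw [h2] at h
  have h4 : t * (1 / (K : ℝ) + 1 + c ^ 2 / 4) ≤ t * (g / 4 + 1 + c ^ 2 / 4) := by gcongr
  have h5 : t * (2 * (1 - g / 8)) ≤ t * (g / 4 + 1 + c ^ 2 / 4 + g / 4) := by linarith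
  have h6 := le_of_mul_le_mul_left h5 ht0
  linarith


set_option linter.unusedSectionVars false

section fixedsize
variable {ι : Type*} [DecidableEq ι]

theorem double_count (C : Finset ι) (k : ℕ) (g : Finset ι → ι → ℝ) :
    ∑ T ∈ C.powersetCard (k + 1), ∑ x ∈ T, g T x
      = ∑ S ∈ C.powersetCard k, ∑ x ∈ C \ S, g (insert x S) x := by
  rw [Finset.sum_sigma', Finset.sum_sigma']
  refine Finset.sum_bij' (fun a _ => ⟨a.1.erase a.2, a.2⟩) (fun a _ => ⟨insert a.2 a.1, a.2⟩)
    ?_ ?_ ?_ ?_ ?_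
  · rintro ⟨T, x⟩ h
    simp only [Finset.mem_sigma, Finset.mem_powersetCard, Finset.mem_sdiff] at h ⊢
    refine ⟨⟨(Finset.erase_subset _ _).trans h.1.1, ?_⟩, h.1.1 h.2, Finset.notMem_erase _ _⟩
    rw [Finset.card_erase_of_mem h.2, h.1.2]; rfl
  · rintro ⟨T, x⟩ h
    simp only [Finset.mem_sigma, Finset.mem_powersetCard, Finset.mem_sdiff] at h ⊢
    refine ⟨⟨Finset.insert_subset h.2.1 h.1.1, ?_⟩, Finset.mem_insert_self _ _⟩
    rw [Finset.card_insert_of_notMem h.2.2, h.1.2]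
  · rintro ⟨T, x⟩ h
    simp only [Finset.mem_sigma] at h
    simp [Finset.insert_erase h.2]
  · rintro ⟨T, x⟩ h
    simp only [Finset.mem_sigma, Finset.mem_sdiff] at h
    simp [Finset.erase_insert h.2.2]
  · rintro ⟨T, x⟩ h
    simp only [Finset.mem_sigma] at h
    simp [Finset.insert_erase h.2]

/-- Average of `f` over the `k`-subsets of `C`. -/
noncomputable def avg (C : Finset ι) (f : Finset ι → ℝ) (k : ℕ) : ℝ :=
  (∑ S ∈ C.powersetCard k, f S) / (C.card.choose k : ℝ)

theorem avg_mul (C : Finset ι) (f : Finset ι → ℝ) {k : ℕ} (hk : k ≤ C.card) :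
    ∑ S ∈ C.powersetCard k, f S = avg C f k * (C.card.choose k : ℝ) := by
  have : (C.card.choose k : ℝ) ≠ 0 := by exact_mod_cast (Nat.choose_pos hk).ne'
  unfold avg; field_simp

theorem choose_id (M k : ℕ) (hk : k ≤ M) :
    (M.choose (k + 1) : ℝ) * (k + 1) = M.choose k * ((M : ℝ) - k) := by
  have := Nat.choose_succ_right_eq M k
  rw [← Nat.cast_sub hk]
  exact_mod_cast this

theorem avg_mono_step (C : Finset ι) (f : Finset ι → ℝ) (hf : ∀ S T, S ⊆ T → f S ≤ f T)
    {k : ℕ} (hk : k + 1 ≤ C.card) : avg C f k ≤ avg C f (k + 1) := by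
  have h1 := double_count C k (fun T _ => f T)
  have e1 : ∑ T ∈ C.powersetCard (k + 1), ∑ x ∈ T, f T
      = (k + 1) * ∑ T ∈ C.powersetCard (k + 1), f T := by
    rw [Finset.mul_sum]
    apply Finset.sum_congr rfl
    intro T hT
    rw [Finset.sum_const, (Finset.mem_powersetCard.1 hT).2]; simp
  have e2 : ((C.card : ℝ) - k) * ∑ S ∈ C.powersetCard k, f S
      ≤ ∑ S ∈ C.powersetCard k, ∑ x ∈ C \ S, f (insert x S) := by
    rw [Finset.mul_sum]
    apply Finset.sum_le_sum
    intro S hS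
    have h := Finset.mem_powersetCard.1 hS
    calc ((C.card : ℝ) - k) * f S = ∑ x ∈ C \ S, f S := by
          rw [Finset.sum_const, Finset.card_sdiff_of_subset h.1, h.2, nsmul_eq_mul,
            Nat.cast_sub (by omega)]
      _ ≤ _ := Finset.sum_le_sum (fun x _ => hf _ _ (Finset.subset_insert x S))
  rw [e1] at h1
  rw [← h1, avg_mul C f hk, avg_mul C f (by omega : k ≤ C.card)] at e2
  have hc := choose_id C.card k (by omega)
  have hpos : (0 : ℝ) < (C.card.choose (k + 1) : ℝ) * (k + 1) := by
    have : (0 : ℝ) < (C.card.choose (k + 1) : ℝ) := by exact_mod_cast Nat.choose_pos hk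
    positivity
  have : avg C f k * ((C.card.choose (k + 1) : ℝ) * (k + 1))
      ≤ avg C f (k + 1) * ((C.card.choose (k + 1) : ℝ) * (k + 1)) := by
    calc _ = ((C.card : ℝ) - k) * (avg C f k * (C.card.choose k : ℝ)) := by rw [hc]; ring
      _ ≤ _ := e2
      _ = _ := by ring
  exact le_of_mul_le_mul_right this hpos

theorem avg_anti_step (C : Finset ι) (f : Finset ι → ℝ) (hf : ∀ S T, S ⊆ T → f T ≤ f S)
    {k : ℕ} (hk : k + 1 ≤ C.card) : avg C f (k + 1) ≤ avg C f k := by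
  have h := avg_mono_step C (fun S => - f S) (fun S T h => neg_le_neg (hf S T h)) hk
  simp only [avg, Finset.sum_neg_distrib, neg_div] at h ⊢
  linarith

theorem avg_mono (C : Finset ι) (f : Finset ι → ℝ) (hf : ∀ S T, S ⊆ T → f S ≤ f T)
    {j k : ℕ} (hjk : j ≤ k) (hk : k ≤ C.card) : avg C f j ≤ avg C f k := by
  induction k, hjk using Nat.le_induction with
  | base => exact le_rfl
  | succ k h ih => exact (ih (by omega)).trans (avg_mono_step C f hf hk)

theorem avg_anti (C : Finset ι) (f : Finset ι → ℝ) (hf : ∀ S T, S ⊆ T → f T ≤ f S)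
    {j k : ℕ} (hjk : j ≤ k) (hk : k ≤ C.card) : avg C f k ≤ avg C f j := by
  induction k, hjk using Nat.le_induction with
  | base => exact le_rfl
  | succ k h ih => exact (avg_anti_step C f hf hk).trans (ih (by omega))

theorem BE_avg (C : Finset ι) (p : ℝ) (f : Finset ι → ℝ) :
    BE C (fun _ => p) f = ∑ k ∈ Finset.range (C.card + 1),
      p ^ k * (1 - p) ^ (C.card - k) * (avg C f k * (C.card.choose k : ℝ)) := by
  unfold BE
  rw [Finset.sum_powerset]
  apply Finset.sum_congr rfl
  intro k hk
  rw [Finset.mem_range] at hk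
  rw [← avg_mul C f (by omega), Finset.mul_sum]
  apply Finset.sum_congr rfl
  intro S hS
  have h := Finset.mem_powersetCard.1 hS
  rw [Finset.prod_const, Finset.prod_const, Finset.card_sdiff_of_subset h.1, h.2]

theorem avg_card (C : Finset ι) (P : ℕ → Prop) [DecidablePred P] {k : ℕ} (hk : k ≤ C.card) :
    avg C (fun S => if P S.card then 1 else 0) k = if P k then 1 else 0 := by
  have hne : (C.card.choose k : ℝ) ≠ 0 := by exact_mod_cast (Nat.choose_pos hk).ne'
  have : ∑ S ∈ C.powersetCard k, (if P S.card then (1 : ℝ) else 0)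
      = ∑ S ∈ C.powersetCard k, (if P k then (1 : ℝ) else 0) := by
    apply Finset.sum_congr rfl
    intro S hS
    rw [(Finset.mem_powersetCard.1 hS).2]
  unfold avg
  rw [this, Finset.sum_const, Finset.card_powersetCard, nsmul_eq_mul]
  field_simp

theorem avg_nonneg (C : Finset ι) (f : Finset ι → ℝ) (h0 : ∀ S, 0 ≤ f S) (k : ℕ) :
    0 ≤ avg C f k := div_nonneg (Finset.sum_nonneg (fun S _ => h0 S)) (by positivity)

theorem BE_ge_avg (C : Finset ι) (p : ℝ) (hp : 0 ≤ p ∧ p ≤ 1) (f : Finset ι → ℝ)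
    (h0 : ∀ S, 0 ≤ f S) (P : ℕ → Prop) [DecidablePred P] (n : ℕ)
    (h : ∀ k, k ≤ C.card → P k → avg C f n ≤ avg C f k) :
    avg C f n * BE C (fun _ => p) (fun S => if P S.card then 1 else 0) ≤ BE C (fun _ => p) f := by
  rw [BE_avg, BE_avg, Finset.mul_sum]
  apply Finset.sum_le_sum
  intro k hk
  rw [Finset.mem_range] at hk
  have hk' : k ≤ C.card := by omega
  rw [avg_card C P hk']
  have hw : 0 ≤ p ^ k * (1 - p) ^ (C.card - k) * (C.card.choose k : ℝ) := by
    have := hp.1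
    have : 0 ≤ 1 - p := by linarith [hp.2]
    positivity
  have : avg C f n * (if P k then 1 else 0) ≤ avg C f k := by
    split_ifs with hP
    · rw [mul_one]; exact h k hk' hP
    · rw [mul_zero]; exact avg_nonneg C f h0 k
  have := mul_le_mul_of_nonneg_left this hw
  nlinarith

end fixedsize


/-- The increasing enumeration of a set of naturals of size `n`. -/
noncomputable def enumF (n : ℕ) (A : Finset ℕ) (i : Fin n) : ℕ :=
  if h : A.card = n then A.orderEmbOfFin h i else 0

theorem enumF_strictMono {n : ℕ} {A : Finset ℕ} (h : A.card = n) : StrictMono (enumF n A) := by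
  intro i j hij
  simp only [enumF, h, dif_pos]
  exact (A.orderEmbOfFin h).strictMono hij

theorem enumF_image {n : ℕ} {A : Finset ℕ} (h : A.card = n) :
    Finset.univ.image (enumF n A) = A := by
  apply Finset.eq_of_subset_of_card_le
  · intro x hx
    obtain ⟨i, -, rfl⟩ := Finset.mem_image.1 hx
    simp only [enumF, h, dif_pos]
    exact Finset.orderEmbOfFin_mem A h i
  · rw [Finset.card_image_of_injective _ (enumF_strictMono h).injective]
    simp [h]

theorem enumF_mem {n : ℕ} {A : Finset ℕ} (h : A.card = n) (i : Fin n) : enumF n A i ∈ A := by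
  have := Finset.mem_image_of_mem (enumF n A) (Finset.mem_univ i)
  rwa [enumF_image h] at this

/-- The point set of a permutation with prescribed coordinate sets. -/
noncomputable def PS {n : ℕ} (A B : Finset ℕ) (π : Equiv.Perm (Fin n)) : Finset (ℕ × ℕ) :=
  Finset.univ.image (fun i => (enumF n A i, enumF n B (π i)))

theorem pt_inj {n : ℕ} {A : Finset ℕ} (B : Finset ℕ) (hA : A.card = n) (π : Equiv.Perm (Fin n)) :
    Function.Injective (fun i => (enumF n A i, enumF n B (π i))) := by
  intro i j h
  exact (enumF_strictMono hA).injective (Prod.ext_iff.1 h).1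

theorem PS_fst {n : ℕ} {A B : Finset ℕ} (hA : A.card = n) (π : Equiv.Perm (Fin n)) :
    (PS A B π).image Prod.fst = A := by
  unfold PS
  rw [Finset.image_image]
  exact enumF_image hA

theorem PS_snd {n : ℕ} {A B : Finset ℕ} (hB : B.card = n) (π : Equiv.Perm (Fin n)) :
    (PS A B π).image Prod.snd = B := by
  unfold PS
  rw [Finset.image_image]
  have : (Prod.snd ∘ fun i => (enumF n A i, enumF n B (π i))) = enumF n B ∘ π := rfl
  rw [this, ← Finset.image_image, Finset.image_univ_of_surjective π.surjective, enumF_image hB]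

theorem PS_inj {n : ℕ} {A B : Finset ℕ} (hA : A.card = n) (hB : B.card = n)
    {π π' : Equiv.Perm (Fin n)} (h : PS A B π = PS A B π') : π = π' := by
  ext i
  have : (enumF n A i, enumF n B (π i)) ∈ PS A B π' := by
    rw [← h]; exact Finset.mem_image_of_mem _ (Finset.mem_univ i)
  obtain ⟨j, -, hj⟩ := Finset.mem_image.1 this
  rw [Prod.ext_iff] at hj
  have h1 : j = i := (enumF_strictMono hA).injective hj.1
  subst h1
  rw [(enumF_strictMono hB).injective hj.2]

theorem PS_chainLen {n : ℕ} {A B : Finset ℕ} (hA : A.card = n) (hB : B.card = n)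
    (π : Equiv.Perm (Fin n)) : chainLen (PS A B π) = lisLength π := by
  apply le_antisymm
  · obtain ⟨T, hT, hc, he⟩ := exists_chain (PS A B π)
    set s : Finset (Fin n) := Finset.univ.filter (fun i => (enumF n A i, enumF n B (π i)) ∈ T) with hs
    have hsT : s.image (fun i => (enumF n A i, enumF n B (π i))) = T := by
      ext x
      simp only [hs, Finset.mem_image, Finset.mem_filter, Finset.mem_univ, true_and]
      constructor
      · rintro ⟨i, hi, rfl⟩; exact hi
      · intro hx
        obtain ⟨i, -, rfl⟩ := Finset.mem_image.1 (hT hx)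
        exact ⟨i, hx, rfl⟩
    have hcard : s.card = T.card := by
      rw [← hsT, Finset.card_image_of_injective _ (pt_inj B hA π)]
    have hinc : ∀ i ∈ s, ∀ j ∈ s, i < j → π i < π j := by
      intro i hi j hj hij
      have h1 := (Finset.mem_filter.1 hi).2
      have h2 := (Finset.mem_filter.1 hj).2
      have h3 := enumF_strictMono hA hij
      rcases hc _ h1 _ h2 (fun e => hij.ne (pt_inj B hA π e)) with h | h
      · exact (enumF_strictMono hB).lt_iff_lt.1 h.2
      · exact absurd h.1 (not_lt.2 h3.le)
    rw [← he, ← hcard]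
    unfold lisLength
    have := Finset.le_sup (f := fun s : Finset (Fin n) =>
      if ∀ i ∈ s, ∀ j ∈ s, i < j → π i < π j then s.card else 0)
      (Finset.mem_powerset.2 (Finset.subset_univ s))
    simp only [if_pos hinc] at this
    exact this
  · unfold lisLength
    apply Finset.sup_le
    intro s _
    split_ifs with h
    · rw [← Finset.card_image_of_injective s (pt_inj B hA π)]
      apply card_le_chainLen
      · exact Finset.image_subset_image (Finset.subset_univ s)
      · intro x hx y hy hxy
        obtain ⟨i, hi, rfl⟩ := Finset.mem_image.1 hx
        obtain ⟨j, hj, rfl⟩ := Finset.mem_image.1 hy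
        rcases lt_trichotomy i j with hij | hij | hij
        · exact Or.inl ⟨enumF_strictMono hA hij, enumF_strictMono hB (h i hi j hj hij)⟩
        · subst hij; exact absurd rfl hxy
        · exact Or.inr ⟨enumF_strictMono hA hij, enumF_strictMono hB (h j hj i hi hij)⟩
    · exact Nat.zero_le _

theorem count_le (n N : ℕ) (Q : ℕ → Prop) [DecidablePred Q] :
    N.choose n ^ 2 * (Finset.univ.filter (fun π : Equiv.Perm (Fin n) => Q (lisLength π))).card
      ≤ (((Rect 0 N 0 N).powersetCard n).filter (fun S => Q (chainLen S))).card := by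
  have e : N.choose n ^ 2 *
      (Finset.univ.filter (fun π : Equiv.Perm (Fin n) => Q (lisLength π))).card
      = (((Finset.Ioc 0 N).powersetCard n) ×ˢ ((Finset.Ioc 0 N).powersetCard n) ×ˢ
      (Finset.univ.filter (fun π : Equiv.Perm (Fin n) => Q (lisLength π)))).card := by
    simp only [Finset.card_product, Finset.card_powersetCard, Nat.card_Ioc]
    rw [Nat.sub_zero]; ring
  rw [e]
  apply Finset.card_le_card_of_injOn (fun x => PS x.1 x.2.1 x.2.2)
  · rintro ⟨A, B, π⟩ h
    simp only [Finset.coe_product, Set.mem_prod, Finset.mem_coe, Finset.mem_powersetCard,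
      Finset.mem_filter, Finset.mem_univ, true_and] at h ⊢
    obtain ⟨⟨hA, hA'⟩, ⟨hB, hB'⟩, hQ⟩ := h
    refine ⟨⟨?_, ?_⟩, ?_⟩
    · intro x hx
      obtain ⟨i, -, rfl⟩ := Finset.mem_image.1 hx
      exact Finset.mem_product.2 ⟨hA (enumF_mem hA' i), hB (enumF_mem hB' _)⟩
    · unfold PS
      rw [Finset.card_image_of_injective _ (pt_inj B hA' π)]; simp
    · rw [PS_chainLen hA' hB']; exact hQ
  · rintro ⟨A, B, π⟩ h ⟨A', B', π'⟩ h' heq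
    simp only [Finset.coe_product, Set.mem_prod, Finset.mem_coe, Finset.mem_powersetCard] at h h'
    simp only at heq
    have h1 := PS_fst (B := B) h.1.2 π
    rw [heq, PS_fst h'.1.2] at h1
    have h2 := PS_snd (A := A) h.2.1.2 π
    rw [heq, PS_snd h'.2.1.2] at h2
    subst h1 h2
    rw [PS_inj h.1.2 h.2.1.2 heq]

theorem choose_ratio (n N : ℕ) (hn : 1 ≤ n) (hN : 4 * n ^ 2 ≤ N) :
    (((N * N).choose n : ℕ) : ℝ) ≤ 2 * ((N.choose n : ℝ) ^ 2 * n.factorial) := by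
  have hnN : n ≤ N := by nlinarith
  have hf : (0 : ℝ) < n.factorial := by exact_mod_cast Nat.factorial_pos n
  have hNp : (0 : ℝ) < N := by exact_mod_cast (by omega : 0 < N)
  have h1 : (((N * N).choose n : ℕ) : ℝ) * n.factorial ≤ (N : ℝ) ^ (2 * n) := by
    have := Nat.choose_le_pow_div (α := ℝ) n (N * N)
    rw [le_div_iff₀ hf] at this
    refine this.trans (le_of_eq ?_)
    push_cast; rw [← sq, ← pow_mul]
  have h2 : ((N : ℝ) - n) ^ n ≤ n.factorial * N.choose n := by
    have := Nat.pow_le_choose (α := ℝ) n N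
    rw [div_le_iff₀ hf] at this
    rw [mul_comm]
    refine le_trans ?_ this
    have hh : (n : ℝ) ≤ N := by exact_mod_cast hnN
    push_cast [Nat.cast_sub (by omega : n ≤ N + 1)]
    exact pow_le_pow_left₀ (by linarith) (by linarith) _
  have hh : (n : ℝ) ≤ N := by exact_mod_cast hnN
  have h3 : (N : ℝ) ^ (2 * n) ≤ 2 * ((N : ℝ) - n) ^ (2 * n) := by
    have hb := one_add_mul_le_pow (a := -((n : ℝ) / N)) (by
      have : (n : ℝ) / N ≤ 1 := by rw [div_le_one hNp]; exact hh
      linarith) (2 * n)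
    have e : (N : ℝ) - n = N * (1 + -((n : ℝ) / N)) := by field_simp; ring
    rw [e, mul_pow]
    have : (1 : ℝ) / 2 ≤ (1 + -((n : ℝ) / N)) ^ (2 * n) := by
      refine le_trans ?_ hb
      push_cast
      have : (n : ℝ) * n / N ≤ 1 / 4 := by
        rw [div_le_iff₀ hNp]
        have : (4 : ℝ) * n ^ 2 ≤ N := by exact_mod_cast hN
        linarith
      have e2 : (2 : ℝ) * n * -((n : ℝ) / N) = - 2 * (n * n / N) := by ring
      rw [e2]; linarith
    have hp : (0 : ℝ) < (N : ℝ) ^ (2 * n) := by positivity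
    nlinarith
  have h4 : ((N : ℝ) - n) ^ (2 * n) ≤ (n.factorial * N.choose n) ^ 2 := by
    rw [mul_comm, pow_mul]
    exact pow_le_pow_left₀ (pow_nonneg (by linarith) _) h2 2
  have h5 : (((N * N).choose n : ℕ) : ℝ) * n.factorial
      ≤ (2 * ((N.choose n : ℝ) ^ 2 * n.factorial)) * n.factorial := by
    calc _ ≤ _ := h1
      _ ≤ _ := h3
      _ ≤ 2 * (n.factorial * N.choose n : ℝ) ^ 2 := by linarith
      _ = _ := by ring
  exact le_of_mul_le_mul_right h5 hf

theorem Rect_card (N : ℕ) : (Rect 0 N 0 N).card = N * N := by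
  simp [Rect]

theorem mallows_le_avg (n N : ℕ) (hn : 1 ≤ n) (hN : 4 * n ^ 2 ≤ N) (Q : ℕ → Prop)
    [DecidablePred Q] :
    mallowsProb n 1 {π | Q (lisLength π)}
      ≤ 2 * avg (Rect 0 N 0 N) (fun S => if Q (chainLen S) then 1 else 0) n := by
  have hf : (0 : ℝ) < n.factorial := by exact_mod_cast Nat.factorial_pos n
  have hnN : n ≤ N := by nlinarith
  have hch : (0 : ℝ) < N.choose n := by exact_mod_cast Nat.choose_pos hnN
  have hch2 : (0 : ℝ) < (N * N).choose n := by
    exact_mod_cast Nat.choose_pos (by nlinarith : n ≤ N * N)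
  have e : mallowsProb n 1 {π | Q (lisLength π)}
      = ((Finset.univ.filter (fun π : Equiv.Perm (Fin n) => Q (lisLength π))).card : ℝ)
        / n.factorial := by
    unfold mallowsProb
    simp [Set.indicator_apply, Fintype.card_perm]
  have c1 : (N.choose n : ℝ) ^ 2 *
      (Finset.univ.filter (fun π : Equiv.Perm (Fin n) => Q (lisLength π))).card
      ≤ (((Rect 0 N 0 N).powersetCard n).filter (fun S => Q (chainLen S))).card := by
    exact_mod_cast count_le n N Q
  have c2 := choose_ratio n N hn hN
  rw [e]
  unfold avg
  rw [Finset.sum_boole, Rect_card, ← mul_div_assoc, div_le_div_iff₀ hf hch2]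
  set X := ((Finset.univ.filter (fun π : Equiv.Perm (Fin n) => Q (lisLength π))).card : ℝ)
  have hX : 0 ≤ X := Nat.cast_nonneg _
  calc X * ((N * N).choose n : ℕ) ≤ X * (2 * ((N.choose n : ℝ) ^ 2 * n.factorial)) :=
        mul_le_mul_of_nonneg_left c2 hX
    _ = 2 * ((N.choose n : ℝ) ^ 2 * X) * n.factorial := by ring
    _ ≤ _ := by
      apply mul_le_mul_of_nonneg_right _ hf.le
      linarith


theorem card_mean (N : ℕ) (p : ℝ) :
    BE (Rect 0 N 0 N) (fun _ => p) (fun S => ((S ∩ Rect 0 N 0 N).card : ℝ)) = N * N * p := by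
  rw [BE_card_inter _ _ (Finset.Subset.refl _), Finset.sum_const, Rect_card, nsmul_eq_mul]
  push_cast; ring

theorem card_cheb (N : ℕ) (p : ℝ) (hp : 0 ≤ p ∧ p ≤ 1) (P : ℕ → Prop) [DecidablePred P] (d : ℝ)
    (hd : 0 < d) (hP : ∀ k : ℕ, ¬ P k → d ≤ |(k : ℝ) - N * N * p|)
    (h2 : 2 * (N * N * p) ≤ d ^ 2) :
    1 / 2 ≤ BE (Rect 0 N 0 N) (fun _ => p) (fun S => if P S.card then 1 else 0) := by
  have hh := card_inter_self_bounding (Rect 0 N 0 N)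
  have h1 := var_self_bounding (fun _ => hp) (Rect 0 N 0 N)
    (fun S => ((S ∩ Rect 0 N 0 N).card : ℝ)) hh.1 hh.2.1 hh.2.2
  rw [card_mean] at h1
  have h3 := BE_cheb (p := fun _ : ℕ × ℕ => p) (fun _ => hp) (Rect 0 N 0 N)
    (fun S => ((S ∩ Rect 0 N 0 N).card : ℝ)) (fun S => ¬ P S.card) (N * N * p) d hd
    (by
      intro S hS h
      have := hP _ h
      rwa [Finset.inter_eq_left.2 hS])
  have h4 : BE (Rect 0 N 0 N) (fun _ => p)
      (fun S => ((S ∩ Rect 0 N 0 N).card - (N * N * p : ℝ)) ^ 2) / d ^ 2 ≤ 1 / 2 := by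
    rw [div_le_iff₀ (by positivity)]; linarith
  have h5 : BE (Rect 0 N 0 N) (fun _ => p) (fun S => if P S.card then (1 : ℝ) else 0)
      + BE (Rect 0 N 0 N) (fun _ => p) (fun S => if ¬ P S.card then (1 : ℝ) else 0) = 1 := by
    rw [← BE_add]
    refine Eq.trans ?_ (BE_const (Rect 0 N 0 N) (fun _ => p) 1)
    apply BE_congr
    intro S _
    by_cases h : P S.card <;> simp [h]
  linarith

theorem chain_cheb (N : ℕ) (p : ℝ) (hp : 0 ≤ p ∧ p ≤ 1) (Q : ℕ → Prop) [DecidablePred Q]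
    (d v : ℝ) (hd : 0 < d) (hv : EL N N p ≤ v) (hQ : ∀ l : ℕ, Q l → d ≤ |(l : ℝ) - EL N N p|) :
    BE (Rect 0 N 0 N) (fun _ => p) (fun S => if Q (chainLen S) then 1 else 0) ≤ v / d ^ 2 := by
  have h1 := var_self_bounding (fun _ => hp) (Rect 0 N 0 N) (fun S => (chainLen S : ℝ))
    chainLen_self_bounding.1 chainLen_self_bounding.2.1 chainLen_self_bounding.2.2
  have h3 := BE_cheb (p := fun _ : ℕ × ℕ => p) (fun _ => hp) (Rect 0 N 0 N)
    (fun S => (chainLen S : ℝ)) (fun S => Q (chainLen S)) (EL N N p) d hd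
    (fun S _ h => hQ _ h)
  refine h3.trans ?_
  apply div_le_div_of_nonneg_right _ (by positivity)
  exact le_trans h1 hv

theorem upper_n (n N : ℕ) (hn : 1 ≤ n) (hN : 4 * n ^ 2 ≤ N) (p : ℝ) (hp : 0 ≤ p ∧ p ≤ 1) (x : ℝ)
    (hK : 1 / 2 ≤ BE (Rect 0 N 0 N) (fun _ => p) (fun S => if n ≤ S.card then 1 else 0)) :
    mallowsProb n 1 {π | x < (lisLength π : ℝ)} ≤
      4 * BE (Rect 0 N 0 N) (fun _ => p) (fun S => if x < (chainLen S : ℝ) then 1 else 0) := by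
  have h1 := mallows_le_avg n N hn hN (fun l => x < (l : ℝ))
  have h2 := BE_ge_avg (Rect 0 N 0 N) p hp
    (fun S => if x < (chainLen S : ℝ) then 1 else 0) (by intro S; split_ifs <;> norm_num)
    (fun k => n ≤ k) n (by
      intro k hk hnk
      apply avg_mono _ _ _ hnk hk
      intro S T hST
      have : (chainLen S : ℝ) ≤ chainLen T := by exact_mod_cast chainLen_mono hST
      split_ifs with h h'
      · exact le_rfl
      · exact absurd (h.trans_le this) h'
      · exact zero_le_one
      · exact le_rfl)
  have h0 := avg_nonneg (Rect 0 N 0 N) (fun S => if x < (chainLen S : ℝ) then 1 else 0)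
    (by intro S; split_ifs <;> norm_num) n
  nlinarith

theorem lower_n (n N : ℕ) (hn : 1 ≤ n) (hN : 4 * n ^ 2 ≤ N) (p : ℝ) (hp : 0 ≤ p ∧ p ≤ 1) (x : ℝ)
    (hK : 1 / 2 ≤ BE (Rect 0 N 0 N) (fun _ => p) (fun S => if S.card ≤ n then 1 else 0)) :
    mallowsProb n 1 {π | (lisLength π : ℝ) < x} ≤
      4 * BE (Rect 0 N 0 N) (fun _ => p) (fun S => if (chainLen S : ℝ) < x then 1 else 0) := by
  have h1 := mallows_le_avg n N hn hN (fun l => (l : ℝ) < x)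
  have h2 := BE_ge_avg (Rect 0 N 0 N) p hp
    (fun S => if (chainLen S : ℝ) < x then 1 else 0) (by intro S; split_ifs <;> norm_num)
    (fun k => k ≤ n) n (by
      intro k hk hnk
      apply avg_anti _ _ _ hnk
      · rw [Rect_card]
        have h5 : n ≤ N := by nlinarith
        have h6 : N ≤ N * N := Nat.le_mul_self N
        omega
      intro S T hST
      have : (chainLen S : ℝ) ≤ chainLen T := by exact_mod_cast chainLen_mono hST
      split_ifs with h h'
      · exact le_rfl
      · exact absurd (this.trans_lt h) h'
      · exact zero_le_one
      · exact le_rfl)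
  have h0 := avg_nonneg (Rect 0 N 0 N) (fun S => if (chainLen S : ℝ) < x then 1 else 0)
    (by intro S; split_ifs <;> norm_num) n
  nlinarith

theorem ratio_bound (ε s t : ℝ) (hε : 0 < ε) (hs : 0 < s) (h : t ≤ 5 / 4 * s) :
    2 * t / (ε / 2 * s) ^ 2 ≤ 10 / ε ^ 2 / s := by
  calc 2 * t / (ε / 2 * s) ^ 2 ≤ 2 * (5 / 4 * s) / (ε / 2 * s) ^ 2 := by gcongr
    _ = 10 / ε ^ 2 / s := by field_simp; norm_num

set_option maxHeartbeats 2000000 in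
theorem upper_tail (ε : ℝ) (hε : 0 < ε) (hε1 : ε ≤ 1) :
    ∀ᶠ n : ℕ in atTop,
      mallowsProb n 1 {π | (2 + ε) * √n < (lisLength π : ℝ)} ≤ 40 / ε ^ 2 / √n := by
  obtain ⟨n1, hn1⟩ := exists_nat_ge (128 / ε ^ 2)
  filter_upwards [eventually_ge_atTop (max n1 1)] with n hn
  have hn0 : 1 ≤ n := le_trans (le_max_right _ _) hn
  have hnn : (128 / ε ^ 2) ≤ (n : ℝ) :=
    hn1.trans (by exact_mod_cast le_trans (le_max_left _ _) hn)
  have hnp : (0 : ℝ) < n := by exact_mod_cast hn0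
  have hs : 0 < √(n : ℝ) := Real.sqrt_pos.2 hnp
  have hss : √(n : ℝ) ^ 2 = n := Real.sq_sqrt hnp.le
  set s := √(n : ℝ) with hsdef
  set t := (1 + ε / 4) * s with ht
  have htp : 0 < t := by positivity
  obtain ⟨N1, hN1⟩ := exists_nat_ge (t ^ 2 / (ε / 4))
  set N := max N1 (4 * n ^ 2) with hNdef
  have hN4 : 4 * n ^ 2 ≤ N := le_max_right _ _
  have hNone : 1 ≤ N := by nlinarith
  have hNp : (0 : ℝ) < N := by exact_mod_cast hNone
  have hNone' : (1 : ℝ) ≤ N := by exact_mod_cast hNone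
  have hNt : t ^ 2 / (ε / 4) ≤ N := hN1.trans (by exact_mod_cast le_max_left _ _)
  set q := t ^ 2 / (N : ℝ) ^ 2 with hq
  have hq0 : 0 ≤ q := by positivity
  have hp : 0 ≤ pq q ∧ pq q ≤ 1 := ⟨pq_nonneg hq0, pq_le_one q⟩
  have hqε : q ≤ ε / 4 := by
    rw [div_le_iff₀ (by positivity)] at hNt
    rw [hq, div_le_iff₀ (by positivity)]
    nlinarith [mul_pos hNp (by positivity : 0 < ε / 4)]
  have hqN : (N : ℝ) * N * q = t ^ 2 := by rw [hq]; field_simp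
  have ht2 : t ^ 2 = (1 + ε / 4) ^ 2 * n := by rw [ht, mul_pow, hss]
  have hmu_le : (N : ℝ) * N * pq q ≤ t ^ 2 := by
    rw [← hqN]; exact mul_le_mul_of_nonneg_left (pq_le q) (by positivity)
  have hmu_ge : (1 + ε / 4) * n ≤ (N : ℝ) * N * pq q := by
    have h1 : (N : ℝ) * N * (q / (1 + q)) ≤ N * N * pq q :=
      mul_le_mul_of_nonneg_left (pq_ge hq0) (by positivity)
    have h2 : (N : ℝ) * N * (q / (1 + q)) = (1 + ε / 4) ^ 2 * n / (1 + q) := by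
      rw [← ht2, ← hqN]; ring
    rw [h2] at h1
    refine le_trans ?_ h1
    rw [le_div_iff₀ (by positivity)]
    have : (1 + ε / 4) * n * (1 + q) ≤ (1 + ε / 4) * n * (1 + ε / 4) :=
      mul_le_mul_of_nonneg_left (by linarith) (by positivity)
    linarith
  have hcard : 1 / 2 ≤ BE (Rect 0 N 0 N) (fun _ => pq q) (fun S => if n ≤ S.card then 1 else 0) := by
    apply card_cheb N (pq q) hp (fun k => n ≤ k) (ε / 4 * n) (by positivity)
    · intro k hk
      have : (k : ℝ) < n := by exact_mod_cast not_le.1 hk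
      rw [abs_sub_comm]
      refine le_trans ?_ (le_abs_self _)
      linarith
    · rw [div_le_iff₀ (by positivity)] at hnn
      have h3 : (1 + ε / 4) ^ 2 ≤ 4 := by nlinarith
      have h4 : (1 + ε / 4) ^ 2 * n ≤ 4 * n := mul_le_mul_of_nonneg_right h3 hnp.le
      have h5 : 128 * (n : ℝ) ≤ n * ε ^ 2 * n := mul_le_mul_of_nonneg_right hnn hnp.le
      nlinarith
  refine (upper_n n N hn0 hN4 (pq q) hp _ hcard).trans ?_
  have hEL : EL N N (pq q) ≤ 2 * t := by
    refine (EL_le N q hq0).trans (le_of_eq ?_)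
    rw [hq, Real.sqrt_div (by positivity), Real.sqrt_sq htp.le, Real.sqrt_sq hNp.le]
    field_simp
  have h6 := chain_cheb N (pq q) hp (fun l => (2 + ε) * s < (l : ℝ)) (ε / 2 * s) (2 * t)
    (by positivity) hEL (by
      intro l hl
      refine le_trans ?_ (le_abs_self _)
      rw [ht] at hEL
      nlinarith)
  have h7 : 2 * t / (ε / 2 * s) ^ 2 ≤ 10 / ε ^ 2 / s := by
    exact ratio_bound ε s t hε hs (by rw [ht]; nlinarith)
  have e : 40 / ε ^ 2 / s = 4 * (10 / ε ^ 2 / s) := by ring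
  rw [e]
  linarith

set_option maxHeartbeats 2000000 in
theorem lower_tail (ε : ℝ) (hε : 0 < ε) (hε1 : ε ≤ 1) :
    ∀ᶠ n : ℕ in atTop,
      mallowsProb n 1 {π | (lisLength π : ℝ) < (2 - ε) * √n} ≤ 40 / ε ^ 2 / √n := by
  obtain ⟨t0, ht0, N0, hN0, hLB⟩ := LB (2 - ε / 4) (by linarith) (by linarith)
  obtain ⟨n1, hn1⟩ := exists_nat_ge (512 / ε ^ 2 + (16 * t0 / ε) ^ 2)
  filter_upwards [eventually_ge_atTop (max n1 1)] with n hn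
  have hn0 : 1 ≤ n := le_trans (le_max_right _ _) hn
  have hnn0 : 512 / ε ^ 2 + (16 * t0 / ε) ^ 2 ≤ (n : ℝ) :=
    hn1.trans (by exact_mod_cast le_trans (le_max_left _ _) hn)
  have hnn : 512 / ε ^ 2 ≤ (n : ℝ) := by nlinarith [sq_nonneg (16 * t0 / ε)]
  have hnt : (16 * t0 / ε) ^ 2 ≤ (n : ℝ) := by
    have : 0 < 512 / ε ^ 2 := by positivity
    linarith
  have hnp : (0 : ℝ) < n := by exact_mod_cast hn0
  have hs : 0 < √(n : ℝ) := Real.sqrt_pos.2 hnp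
  have hss : √(n : ℝ) ^ 2 = n := Real.sq_sqrt hnp.le
  have hst : 16 * t0 / ε ≤ √(n : ℝ) := Real.le_sqrt_of_sq_le hnt
  set s := √(n : ℝ) with hsdef
  have hst' : t0 ≤ ε / 16 * s := by
    rw [div_le_iff₀ hε] at hst; linarith
  set k := ⌊(1 - ε / 16) * s / t0⌋₊ with hk
  have hk1 : (k : ℝ) * t0 ≤ (1 - ε / 16) * s := by
    have := Nat.floor_le (a := (1 - ε / 16) * s / t0)
      (div_nonneg (mul_nonneg (by linarith) hs.le) ht0.le)
    rwa [le_div_iff₀ ht0] at this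
  have hk2 : (1 - ε / 8) * s ≤ k * t0 := by
    have := Nat.lt_floor_add_one ((1 - ε / 16) * s / t0)
    rw [div_lt_iff₀ ht0] at this
    rw [← hk] at this
    linarith
  set t := (k : ℝ) * t0 with ht
  have htp : 0 < t := lt_of_lt_of_le (mul_pos (by linarith) hs) hk2
  have hkpos : 0 < k := by
    rcases Nat.eq_zero_or_pos k with h | h
    · rw [ht, h] at htp; simp at htp
    · exact h
  set r := 4 * n ^ 2 with hr
  have hrpos : 1 ≤ r := by rw [hr]; nlinarith
  set N := r * (k * N0) with hNdef
  have hkN : 1 ≤ k * N0 := Nat.mul_pos hkpos hN0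
  have hN4 : 4 * n ^ 2 ≤ N := Nat.le_mul_of_pos_right _ hkN
  have hNone : 1 ≤ N := Nat.mul_pos hrpos hkN
  have hNp : (0 : ℝ) < N := by exact_mod_cast hNone
  set q := t ^ 2 / (N : ℝ) ^ 2 with hq
  have hq0 : 0 ≤ q := by positivity
  have hp : 0 ≤ pq q ∧ pq q ≤ 1 := ⟨pq_nonneg hq0, pq_le_one q⟩
  have hqN : (N : ℝ) * N * q = t ^ 2 := by rw [hq]; field_simp
  have hmu_le : (N : ℝ) * N * pq q ≤ t ^ 2 := by
    rw [← hqN]; exact mul_le_mul_of_nonneg_left (pq_le q) (by positivity)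
  have hmu_n : t ^ 2 ≤ (1 - ε / 16) * n := by
    have h1 : t ^ 2 ≤ ((1 - ε / 16) * s) ^ 2 := pow_le_pow_left₀ htp.le hk1 2
    rw [mul_pow (1 - ε / 16) s, hss] at h1
    refine h1.trans (mul_le_mul_of_nonneg_right ?_ hnp.le)
    nlinarith
  have hcard : 1 / 2 ≤ BE (Rect 0 N 0 N) (fun _ => pq q) (fun S => if S.card ≤ n then 1 else 0) := by
    apply card_cheb N (pq q) hp (fun k => k ≤ n) (ε / 16 * n) (by positivity)
    · intro k hk
      have : (n : ℝ) < k := by exact_mod_cast not_le.1 hk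
      refine le_trans ?_ (le_abs_self _)
      linarith
    · rw [div_le_iff₀ (by positivity)] at hnn
      have h5 : 512 * (n : ℝ) ≤ n * ε ^ 2 * n := mul_le_mul_of_nonneg_right hnn hnp.le
      nlinarith [mul_pos hε hnp]
  refine (lower_n n N hn0 hN4 (pq q) hp _ hcard).trans ?_
  have hEL : EL N N (pq q) ≤ 2 * t := by
    refine (EL_le N q hq0).trans (le_of_eq ?_)
    rw [hq, Real.sqrt_div (by positivity), Real.sqrt_sq htp.le, Real.sqrt_sq hNp.le]
    field_simp
  have hELge : (2 - ε / 4) * t ≤ EL N N (pq q) := by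
    have hN0p : (0 : ℝ) < N0 := by exact_mod_cast hN0
    have hkp : (0 : ℝ) < k := by exact_mod_cast hkpos
    have hrp : (0 : ℝ) < r := by exact_mod_cast hrpos
    have e : (r : ℝ) * r * q = t0 ^ 2 / (N0 : ℝ) ^ 2 := by
      rw [hq, ht, hNdef]; push_cast; field_simp
    have h1 := EL_split (k * N0) (k * N0) r r hrpos hrpos q hq0
    rw [e] at h1
    have h2 := EL_super N0 k (pq (t0 ^ 2 / (N0 : ℝ) ^ 2))
      ⟨pq_nonneg (by positivity), pq_le_one _⟩
    have h3 := mul_le_mul_of_nonneg_left hLB.le hkp.le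
    calc (2 - ε / 4) * t = k * ((2 - ε / 4) * t0) := by rw [ht]; ring
      _ ≤ _ := h3
      _ ≤ _ := h2
      _ ≤ _ := h1
  have h6 := chain_cheb N (pq q) hp (fun l => (l : ℝ) < (2 - ε) * s) (ε / 2 * s) (2 * t)
    (by positivity) hEL (by
      intro l hl
      rw [abs_sub_comm]
      refine le_trans ?_ (le_abs_self _)
      have : (2 - ε / 4) * ((1 - ε / 8) * s) ≤ (2 - ε / 4) * t :=
        mul_le_mul_of_nonneg_left hk2 (by linarith)
      nlinarith [mul_pos (mul_pos hε hε) hs])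
  have h7 : 2 * t / (ε / 2 * s) ^ 2 ≤ 10 / ε ^ 2 / s := by
    have h8 : 0 < ε * s := mul_pos hε hs
    exact ratio_bound ε s t hε hs (by linarith)
  have e : 40 / ε ^ 2 / s = 4 * (10 / ε ^ 2 / s) := by ring
  rw [e]
  linarith

theorem mallows_nonneg (n : ℕ) (A : Set (Equiv.Perm (Fin n))) : 0 ≤ mallowsProb n 1 A := by
  unfold mallowsProb
  apply div_nonneg
  · apply Finset.sum_nonneg
    intro π _
    apply Set.indicator_nonneg
    intro _ _; simp
  · simp

theorem mallows_le_add (n : ℕ) (A B D : Set (Equiv.Perm (Fin n))) (h : A ⊆ B ∪ D) :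
    mallowsProb n 1 A ≤ mallowsProb n 1 B + mallowsProb n 1 D := by
  classical
  unfold mallowsProb
  rw [← add_div, ← Finset.sum_add_distrib]
  apply div_le_div_of_nonneg_right _ (by simp)
  apply Finset.sum_le_sum
  intro π _
  simp only [Set.indicator_apply, one_pow]
  by_cases hA : π ∈ A
  · rcases h hA with hB | hD
    · simp only [hA, hB, if_true]; split_ifs <;> norm_num
    · simp only [hA, hD, if_true]; split_ifs <;> norm_num
  · simp only [hA, if_false]; split_ifs <;> norm_num

/-- Vershik–Kerov / Logan–Shepp: weak law of large numbers for the length of the longest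
increasing subsequence of a uniformly random permutation. -/
theorem uniform_lis_wlln :
    ∀ ε > 0, Tendsto (fun n : ℕ =>
        mallowsProb n 1 {π | ε < |(lisLength π : ℝ) / Real.sqrt n - 2|})
      atTop (nhds 0) := by
  intro ε0 hε0
  set ε := min ε0 1 with hεdef
  have hε : 0 < ε := lt_min hε0 one_pos
  have hε1 : ε ≤ 1 := min_le_right _ _
  have hεle : ε ≤ ε0 := min_le_left _ _
  have hlim : Tendsto (fun n : ℕ => 80 / ε ^ 2 / √(n : ℝ)) atTop (nhds 0) :=
    Tendsto.const_div_atTop (Real.tendsto_sqrt_atTop.comp tendsto_natCast_atTop_atTop) _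
  refine tendsto_of_tendsto_of_tendsto_of_le_of_le' tendsto_const_nhds hlim
    (Eventually.of_forall (fun n => mallows_nonneg n _)) ?_
  filter_upwards [upper_tail ε hε hε1, lower_tail ε hε hε1, eventually_ge_atTop 1]
    with n h1 h2 hn
  have hs : 0 < √(n : ℝ) := Real.sqrt_pos.2 (by exact_mod_cast hn)
  refine (mallows_le_add n _ {π | (2 + ε) * √(n : ℝ) < (lisLength π : ℝ)}
    {π | (lisLength π : ℝ) < (2 - ε) * √(n : ℝ)} ?_).trans ?_
  · intro π hπ
    have hπ' : ε < |(lisLength π : ℝ) / Real.sqrt n - 2| := lt_of_le_of_lt hεle hπ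
    rcases lt_abs.1 hπ' with h | h
    · left
      show (2 + ε) * √(n : ℝ) < (lisLength π : ℝ)
      rw [← lt_div_iff₀ hs]; linarith
    · right
      show (lisLength π : ℝ) < (2 - ε) * √(n : ℝ)
      rw [← div_lt_iff₀ hs]; linarith
  · have e : 80 / ε ^ 2 / √(n : ℝ) = 40 / ε ^ 2 / √(n : ℝ) + 40 / ε ^ 2 / √(n : ℝ) := by ring
    rw [e]; linarith
end

section
/- Suppose (q_n)_{n≥1} is a sequence of positive reals with β = lim_{n→∞} n(1−q_n) ∈ ℝ. For each n, let π ∈ S_n be Mallows(n,q_n)-distributed and let ρ̃_n be the random empirical probability measure on ℝ² given by ρ̃_n(A) = (1/n) Σ_{k=1}^n 1{(k/n, π(k)/n) ∈ A}. Then ρ̃_n converges in distribution, relative to the weak topology on Borel probability measures on ℝ², to the non-random measure ρ_β on ℝ² with density dρ_β(x,y) = (β/2) sinh(β/2) 1_{[0,1]²}(x,y) / (e^{β/4} cosh(β(x−y)/2) − e^{−β/4} cosh(β(x+y−1)/2))² dx dy for β ≠ 0, and with ρ_0 equal to Lebesgue measure on [0,1]². -/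
open Filter MeasureTheory
open scoped ENNReal

/-- The random empirical probability measure `ρ̃_n(A) = (1/n) Σ_{k=1}^n 1{(k/n, π(k)/n) ∈ A}`
associated to a permutation `π ∈ S_n` (junk value, a Dirac mass, for `n = 0`). -/
noncomputable def empiricalPerm (n : ℕ) (π : Equiv.Perm (Fin n)) : ProbabilityMeasure (ℝ × ℝ) :=
  if h : n = 0 then ⟨Measure.dirac (0, 0), Measure.dirac.isProbabilityMeasure⟩
  else
    ⟨(n : ℝ≥0∞)⁻¹ • ∑ k : Fin n,
        Measure.dirac ((((k : ℕ) : ℝ) + 1) / n, (((π k : ℕ) : ℝ) + 1) / n),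
      ⟨by
        have hn : (n : ℝ≥0∞) ≠ 0 := by exact_mod_cast h
        simp [Measure.smul_apply, Measure.finset_sum_apply, smul_eq_mul,
          ENNReal.inv_mul_cancel hn (by simp)]⟩⟩

/-- The density of the limiting measure `ρ_β`. -/
noncomputable def rhoDen (β : ℝ) (p : ℝ × ℝ) : ℝ :=
  (β / 2) * Real.sinh (β / 2) /
    (Real.exp (β / 4) * Real.cosh (β * (p.1 - p.2) / 2) -
      Real.exp (-β / 4) * Real.cosh (β * (p.1 + p.2 - 1) / 2)) ^ 2

/-- The limiting measure `ρ_β` on `ℝ²`: for `β ≠ 0` it has density `rhoDen β` on the unit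
square `[0,1]²`, and `ρ_0` is Lebesgue measure on `[0,1]²`. -/
noncomputable def rhoMeasure (β : ℝ) : Measure (ℝ × ℝ) :=
  if β = 0 then (volume : Measure (ℝ × ℝ)).restrict (Set.Icc (0, 0) (1, 1))
  else ((volume : Measure (ℝ × ℝ)).restrict (Set.Icc (0, 0) (1, 1))).withDensity
    fun p => ENNReal.ofReal (rhoDen β p)


/-! ### Combinatorics -/

/-- The permutation with first value `j`, followed by the pattern `σ`. -/
def insPerm {n : ℕ} (x : Fin (n + 1) × Equiv.Perm (Fin n)) : Equiv.Perm (Fin (n + 1)) :=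
  (Equiv.Perm.decomposeFin.symm (0, x.2)).trans x.1.cycleRange.symm

lemma insPerm_zero {n : ℕ} (x : Fin (n + 1) × Equiv.Perm (Fin n)) : insPerm x 0 = x.1 := by
  simp [insPerm]

lemma insPerm_succ {n : ℕ} (x : Fin (n + 1) × Equiv.Perm (Fin n)) (i : Fin n) :
    insPerm x i.succ = x.1.succAbove (x.2 i) := by
  simp [insPerm]

lemma insPerm_bijective (n : ℕ) :
    Function.Bijective (insPerm : Fin (n + 1) × Equiv.Perm (Fin n) → _) := by
  rw [Fintype.bijective_iff_injective_and_card]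
  constructor
  · rintro ⟨j, σ⟩ ⟨j', σ'⟩ h
    have h0 : j = j' := by
      have := congrArg (fun e : Equiv.Perm (Fin (n + 1)) => e 0) h
      simpa [insPerm_zero] using this
    subst h0
    have h1 : σ = σ' := by
      ext i
      have := congrArg (fun e : Equiv.Perm (Fin (n + 1)) => e i.succ) h
      simp only [insPerm_succ] at this
      rw [Fin.succAbove_right_injective this]
    rw [h1]
  · simp [Fintype.card_perm, Nat.factorial_succ]

lemma inversions_eq_sum {n : ℕ} (π : Equiv.Perm (Fin n)) :
    inversions π = ∑ a : Fin n, ∑ b : Fin n, if a < b ∧ π b < π a then 1 else 0 := by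
  rw [inversions, Finset.card_filter, Fintype.sum_prod_type]

lemma inversions_insPerm {n : ℕ} (x : Fin (n + 1) × Equiv.Perm (Fin n)) :
    inversions (insPerm x) = (x.1 : ℕ) + inversions x.2 := by
  obtain ⟨j, σ⟩ := x
  rw [inversions_eq_sum, inversions_eq_sum, Fin.sum_univ_succ]
  congr 1
  · rw [Fin.sum_univ_succ]
    simp only [insPerm_zero, insPerm_succ]
    simp only [lt_self_iff_false, and_self, if_false, zero_add, Fin.succ_pos, true_and]
    rw [Equiv.sum_comp σ (fun c => if j.succAbove c < j then 1 else 0)]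
    simp only [Fin.succAbove_lt_iff_castSucc_lt]
    rw [← Finset.card_filter]
    have := Fin.card_filter_val_lt (n := n) (m := (j : ℕ))
    rw [min_eq_right (by omega)] at this
    rw [← this]
    congr 1
  · refine Finset.sum_congr rfl fun a _ => ?_
    rw [Fin.sum_univ_succ]
    simp [insPerm_succ, Fin.succ_lt_succ_iff]

/-- number of positions `≥ k` with value `< t`. -/
def cnt (n k t : ℕ) (π : Equiv.Perm (Fin n)) : ℕ :=
  (Finset.univ.filter (fun i : Fin n => k ≤ (i : ℕ) ∧ (π i : ℕ) < t)).card

lemma cnt_zero {n t : ℕ} (ht : t ≤ n) (π : Equiv.Perm (Fin n)) : cnt n 0 t π = t := by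
  have h := Fin.card_filter_val_lt (n := n) (m := t)
  rw [min_eq_right ht] at h
  rw [cnt, Finset.card_filter]
  simp only [zero_le, true_and]
  rw [Equiv.sum_comp π (fun c : Fin n => if (c : ℕ) < t then 1 else 0), ← Finset.card_filter, h]

lemma cnt_le {n k t : ℕ} (π : Equiv.Perm (Fin n)) : cnt n k t π ≤ n - k := by
  have h : cnt n k t π ≤ (Finset.univ.filter (fun i : Fin n => ¬ (i : ℕ) < k)).card := by
    apply Finset.card_le_card
    intro i
    simp only [Finset.mem_filter, Finset.mem_univ, true_and]
    omega
  have h2 := Finset.card_filter_add_card_filter_not (s := (Finset.univ : Finset (Fin n)))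
    (fun i : Fin n => (i : ℕ) < k)
  have h3 := Fin.card_filter_val_lt (n := n) (m := k)
  simp only [Finset.card_univ, Fintype.card_fin] at h2
  omega

lemma cnt_insPerm {n k t : ℕ} (x : Fin (n + 1) × Equiv.Perm (Fin n)) :
    cnt (n + 1) (k + 1) t (insPerm x) = cnt n k (if (x.1 : ℕ) < t then t - 1 else t) x.2 := by
  obtain ⟨j, σ⟩ := x
  rw [cnt, cnt, Finset.card_filter, Finset.card_filter, Fin.sum_univ_succ]
  rw [if_neg (show ¬ (k + 1 ≤ ((0 : Fin (n + 1)) : ℕ) ∧ ((insPerm (j, σ) 0 : Fin (n + 1)) : ℕ) < t)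
    by simp), zero_add]
  simp only [insPerm_succ, Fin.val_succ]
  refine Finset.sum_congr rfl fun i _ => ?_
  refine if_congr ?_ rfl rfl
  simp only [Fin.succAbove, Fin.lt_def, Fin.val_castSucc]
  split_ifs <;> simp only [Fin.val_castSucc, Fin.val_succ] <;> omega

/-- q-integers -/
noncomputable def qi (q : ℝ) (m : ℕ) : ℝ := ∑ i ∈ Finset.range m, q ^ i

@[simp] lemma qi_zero (q : ℝ) : qi q 0 = 0 := by simp [qi]
@[simp] lemma qi_one (q : ℝ) : qi q 1 = 1 := by simp [qi]
lemma qi_succ (q : ℝ) (m : ℕ) : qi q (m + 1) = 1 + q * qi q m := by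
  rw [qi, Finset.sum_range_succ', qi, Finset.mul_sum, add_comm]
  simp [pow_succ']
lemma qi_pos {q : ℝ} (hq : 0 < q) {m : ℕ} (hm : 0 < m) : 0 < qi q m := by
  apply Finset.sum_pos (fun i _ => pow_pos hq i)
  simpa using hm.ne'
lemma qi_mul (q : ℝ) (m : ℕ) : (q - 1) * qi q m = q ^ m - 1 := by
  rw [qi, mul_comm, geom_sum_mul]
lemma qi_inv {q : ℝ} (hq : 0 < q) (m : ℕ) : q ^ m * qi q⁻¹ m = q * qi q m := by
  induction m with
  | zero => simp
  | succ m ih =>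
    rw [qi_succ, pow_succ]
    have h2 : qi q (m + 1) = qi q m + q ^ m := by rw [qi, Finset.sum_range_succ, ← qi]
    rw [h2]
    have : q ^ m * q * (1 + q⁻¹ * qi q⁻¹ m) = q ^ m * q + q ^ m * qi q⁻¹ m * (q * q⁻¹) := by ring
    rw [this, mul_inv_cancel₀ hq.ne', ih]; ring

/-- weighted sum -/
noncomputable def wS (q : ℝ) (n k t : ℕ) (f : ℕ → ℝ) : ℝ :=
  ∑ π : Equiv.Perm (Fin n), q ^ inversions π * f (cnt n k t π)

noncomputable def wZ (q : ℝ) (n : ℕ) : ℝ := ∑ π : Equiv.Perm (Fin n), q ^ inversions π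

lemma wZ_pos {q : ℝ} (hq : 0 < q) (n : ℕ) : 0 < wZ q n :=
  Finset.sum_pos (fun _ _ => pow_pos hq _) Finset.univ_nonempty

lemma wZ_succ (q : ℝ) (n : ℕ) : wZ q (n + 1) = qi q (n + 1) * wZ q n := by
  rw [wZ, ← (insPerm_bijective n).sum_comp, Fintype.sum_prod_type]
  simp only [inversions_insPerm, pow_add, ← Finset.mul_sum]
  rw [← Finset.sum_mul, wZ, qi, Finset.sum_range]

lemma wS_zero (q : ℝ) {n t : ℕ} (ht : t ≤ n) (f : ℕ → ℝ) : wS q n 0 t f = wZ q n * f t := by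
  simp only [wS, cnt_zero ht]
  rw [← Finset.sum_mul, wZ]

lemma wS_succ (q : ℝ) {n k t : ℕ} (ht : t ≤ n + 1) (f : ℕ → ℝ) :
    wS q (n + 1) (k + 1) t f =
      qi q t * wS q n k (t - 1) f + (qi q (n + 1) - qi q t) * wS q n k t f := by
  rw [wS, ← (insPerm_bijective n).sum_comp, Fintype.sum_prod_type]
  simp only [inversions_insPerm, pow_add, cnt_insPerm, mul_assoc, ← Finset.mul_sum]
  have h1 : ∀ j : Fin (n + 1), q ^ (j : ℕ) * ∑ σ : Equiv.Perm (Fin n), q ^ inversions σ *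
      f (cnt n k (if (j : ℕ) < t then t - 1 else t) σ) =
      (fun i : ℕ => q ^ i * (if i < t then wS q n k (t - 1) f else wS q n k t f)) j := by
    intro j
    simp only []
    split_ifs <;> rfl
  rw [Finset.sum_congr rfl fun j _ => h1 j, ← Finset.sum_range (n := n + 1)
    (fun i : ℕ => q ^ i * (if i < t then wS q n k (t - 1) f else wS q n k t f))]
  have h2 : Finset.range (n + 1) = Finset.range t ∪ Finset.Ico t (n + 1) := by
    ext; simp; omega
  have h3 : Disjoint (Finset.range t) (Finset.Ico t (n + 1)) := by
    rw [Finset.disjoint_left]; intro a; simp; omega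
  have h4 : qi q (n + 1) - qi q t = ∑ i ∈ Finset.Ico t (n + 1), q ^ i := by
    rw [Finset.sum_Ico_eq_sub _ ht, qi, qi]
  rw [h4, h2, Finset.sum_union h3, qi, Finset.sum_mul, Finset.sum_mul]
  congr 1
  · refine Finset.sum_congr rfl fun i hi => ?_
    rw [if_pos (by simpa using hi)]
  · refine Finset.sum_congr rfl fun i hi => ?_
    rw [if_neg (by simp at hi; omega)]

/-- First moment. -/
lemma wS_first {q : ℝ} (hq : 0 < q) (k : ℕ) : ∀ n t : ℕ, k ≤ n → t ≤ n →
    wS q n k t (qi q⁻¹) * qi q n = wZ q n * qi q⁻¹ t * q ^ k * qi q (n - k) := by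
  induction k with
  | zero => intro n t _ ht; rw [wS_zero q ht]; simp
  | succ k ih =>
    intro n t hk ht
    obtain ⟨n, rfl⟩ : ∃ m, n = m + 1 := ⟨n - 1, by omega⟩
    rcases Nat.eq_zero_or_pos n with rfl | hn
    · have : k = 0 := by omega
      subst this
      have h0 : ∀ π : Equiv.Perm (Fin (0 + 1)), cnt (0 + 1) (0 + 1) t π = 0 := fun π => by
        have := cnt_le (k := 0 + 1) (t := t) π
        omega
      simp [wS, h0]
    · have hn' := (qi_pos hq hn).ne'
      rw [wS_succ q ht, wZ_succ, Nat.add_sub_add_right]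
      have key : (qi q t * wS q n k (t - 1) (qi q⁻¹) +
          (qi q (n + 1) - qi q t) * wS q n k t (qi q⁻¹)) =
          wZ q n * qi q⁻¹ t * q ^ (k + 1) * qi q (n - k) := by
        apply mul_right_cancel₀ hn'
        have e1 := ih n (t - 1) (by omega) (by omega)
        have e2 : (qi q (n + 1) - qi q t) * (wS q n k t (qi q⁻¹) * qi q n) =
            (qi q (n + 1) - qi q t) * (wZ q n * qi q⁻¹ t * q ^ k * qi q (n - k)) := by
          rcases ht.eq_or_lt with rfl | h
          · simp
          · rw [ih n t (by omega) (by omega)]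
        have e3 : qi q t * qi q⁻¹ (t - 1) + (qi q (n + 1) - qi q t) * qi q⁻¹ t =
            qi q⁻¹ t * (q * qi q n) := by
          rcases t with _ | s
          · simp
          · have a1 := qi_inv hq s
            have a2 := qi_inv hq (s + 1)
            simp only [Nat.add_sub_cancel]
            have a3 : q ^ s * qi q⁻¹ (s + 1) = qi q (s + 1) := by
              apply mul_left_cancel₀ hq.ne'
              rw [← a2]; ring
            rw [← a3, mul_comm (q ^ s), mul_assoc, a1, mul_comm _ (q ^ s), a3,
              qi_succ q n, qi_succ q s]
            ring
        calc _ = qi q t * (wS q n k (t - 1) (qi q⁻¹) * qi q n) +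
            (qi q (n + 1) - qi q t) * (wS q n k t (qi q⁻¹) * qi q n) := by ring
          _ = (qi q t * qi q⁻¹ (t - 1) + (qi q (n + 1) - qi q t) * qi q⁻¹ t) *
            (wZ q n * q ^ k * qi q (n - k)) := by rw [e1, e2]; ring
          _ = _ := by rw [e3]; ring
      rw [key]; ring

/-- `[m]² - [m]`. -/
noncomputable def qf (q : ℝ) (m : ℕ) : ℝ := qi q m ^ 2 - qi q m

lemma qf_succ (q : ℝ) (m : ℕ) : qf q (m + 1) = q * qi q (m + 1) * qi q m := by
  rw [qf]
  have := qi_succ q m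
  have h : qi q (m + 1) ^ 2 - qi q (m + 1) = qi q (m + 1) * (qi q (m + 1) - 1) := by ring
  rw [h]; nth_rewrite 2 [this]; ring

/-- Second moment. -/
lemma wS_second {q : ℝ} (hq : 0 < q) (k : ℕ) : ∀ n t : ℕ, k ≤ n → t ≤ n →
    wS q n k t (qf q⁻¹) * qf q n = wZ q n * qf q⁻¹ t * q ^ (2 * k) * qf q (n - k) := by
  induction k with
  | zero => intro n t _ ht; rw [wS_zero q ht]; simp
  | succ k ih =>
    intro n t hk ht
    obtain ⟨n, rfl⟩ : ∃ m, n = m + 1 := ⟨n - 1, by omega⟩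
    rcases Nat.lt_or_ge n 2 with hn | hn
    · have h0 : ∀ π : Equiv.Perm (Fin (n + 1)), qf q⁻¹ (cnt (n + 1) (k + 1) t π) = 0 := fun π => by
        have := cnt_le (k := k + 1) (t := t) π
        have h : cnt (n + 1) (k + 1) t π = 0 ∨ cnt (n + 1) (k + 1) t π = 1 := by omega
        rcases h with h | h <;> simp [h, qf]
      have h1 : n - k = 0 ∨ n - k = 1 := by omega
      rw [Nat.add_sub_add_right]
      simp only [wS, h0]
      rcases h1 with h | h <;> simp [h, qf]
    · obtain ⟨m, rfl⟩ : ∃ m, n = m + 1 := ⟨n - 1, by omega⟩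
      have hn0 := (qi_pos hq (show 0 < m + 1 by omega)).ne'
      have hm0 := (qi_pos hq (show 0 < m by omega)).ne'
      have hn' : qf q (m + 1) ≠ 0 := by
        rw [qf_succ]; exact mul_ne_zero (mul_ne_zero hq.ne' hn0) hm0
      rw [wZ_succ, Nat.add_sub_add_right, qf_succ q (m + 1), wS_succ q ht]
      have key : (qi q t * wS q (m + 1) k (t - 1) (qf q⁻¹) +
          (qi q (m + 1 + 1) - qi q t) * wS q (m + 1) k t (qf q⁻¹)) * (q * qi q (m + 1)) =
          wZ q (m + 1) * qf q⁻¹ t * q ^ (2 * k + 2) * qf q (m + 1 - k) := by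
        apply mul_right_cancel₀ hm0
        have e1 := ih (m + 1) (t - 1) (by omega) (by omega)
        have e2 : (qi q (m + 1 + 1) - qi q t) * (wS q (m + 1) k t (qf q⁻¹) * qf q (m + 1)) =
            (qi q (m + 1 + 1) - qi q t) *
              (wZ q (m + 1) * qf q⁻¹ t * q ^ (2 * k) * qf q (m + 1 - k)) := by
          rcases ht.eq_or_lt with rfl | h
          · simp
          · rw [ih (m + 1) t (by omega) (by omega)]
        have e3 : qi q t * qf q⁻¹ (t - 1) + (qi q (m + 1 + 1) - qi q t) * qf q⁻¹ t =
            qf q⁻¹ t * (q ^ 2 * qi q m) := by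
          rcases t with _ | _ | s
          · simp [qf]
          · simp [qf]
          · have a1 := qi_inv hq s
            have a2 := qi_inv hq (s + 1 + 1)
            simp only [Nat.add_sub_cancel]
            rw [qf_succ, qf_succ]
            have a3 : q ^ s * q * qi q⁻¹ (s + 1 + 1) = qi q (s + 1 + 1) := by
              apply mul_left_cancel₀ hq.ne'
              rw [← a2]; ring
            have a4 : qi q (s + 1 + 1) * qi q⁻¹ s = q ^ 2 * qi q⁻¹ (s + 1 + 1) * qi q s := by
              rw [← a3]
              linear_combination (q * qi q⁻¹ (s + 1 + 1)) * a1
            have a5 : qi q (s + 1 + 1) = 1 + q + q ^ 2 * qi q s := by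
              rw [qi_succ, qi_succ]; ring
            have a6 : qi q (m + 1 + 1) = 1 + q + q ^ 2 * qi q m := by
              rw [qi_succ, qi_succ]; ring
            have : qi q (s + 1 + 1) * (q⁻¹ * qi q⁻¹ (s + 1) * qi q⁻¹ s) =
              q⁻¹ * qi q⁻¹ (s + 1) * (q ^ 2 * qi q⁻¹ (s + 1 + 1) * qi q s) := by
              rw [← a4]; ring
            rw [this, a5, a6]
            ring
        calc _ = qi q t * (wS q (m + 1) k (t - 1) (qf q⁻¹) * qf q (m + 1)) +
            (qi q (m + 1 + 1) - qi q t) * (wS q (m + 1) k t (qf q⁻¹) * qf q (m + 1)) := by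
              rw [qf_succ]; ring
          _ = (qi q t * qf q⁻¹ (t - 1) + (qi q (m + 1 + 1) - qi q t) * qf q⁻¹ t) *
            (wZ q (m + 1) * q ^ (2 * k) * qf q (m + 1 - k)) := by rw [e1, e2]; ring
          _ = _ := by rw [e3]; ring
      have e : 2 * (k + 1) = 2 * k + 2 := by ring
      rw [e]
      linear_combination (qi q (m + 1 + 1)) * key

/-! ### The filter of convergence in probability -/

lemma mallowsProb_nonneg (n : ℕ) {q : ℝ} (hq : 0 < q) (A : Set (Equiv.Perm (Fin n))) :
    0 ≤ mallowsProb n q A :=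
  div_nonneg (Finset.sum_nonneg fun _ _ => Set.indicator_nonneg (fun _ _ => (pow_pos hq _).le) _)
    (wZ_pos hq n).le

lemma mallowsProb_mono (n : ℕ) {q : ℝ} (hq : 0 < q) {A B : Set (Equiv.Perm (Fin n))}
    (h : A ⊆ B) : mallowsProb n q A ≤ mallowsProb n q B := by
  apply div_le_div_of_nonneg_right _ (wZ_pos hq n).le
  exact Finset.sum_le_sum fun _ _ =>
    Set.indicator_le_indicator_of_subset h (fun _ => (pow_pos hq _).le) _

lemma mallowsProb_union (n : ℕ) {q : ℝ} (hq : 0 < q) (A B : Set (Equiv.Perm (Fin n))) :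
    mallowsProb n q (A ∪ B) ≤ mallowsProb n q A + mallowsProb n q B := by
  unfold mallowsProb
  rw [← add_div, ← Finset.sum_add_distrib]
  apply div_le_div_of_nonneg_right _ (wZ_pos hq n).le
  refine Finset.sum_le_sum fun π _ => ?_
  have := pow_pos hq (inversions π)
  by_cases h1 : π ∈ A <;> by_cases h2 : π ∈ B <;> simp [h1, h2, this.le]

lemma mallowsProb_empty (n : ℕ) (q : ℝ) : mallowsProb n q ∅ = 0 := by
  simp [mallowsProb]

lemma mallowsProb_singleton (n : ℕ) (q : ℝ) (π : Equiv.Perm (Fin n)) :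
    mallowsProb n q {π} = q ^ inversions π / wZ q n := by
  classical
  unfold mallowsProb
  rw [Finset.sum_eq_single π]
  · simp [wZ]
  · intro b _ hb; simp [hb]
  · simp

lemma mallowsProb_eq_sum (n : ℕ) (q : ℝ) (A : Set (Equiv.Perm (Fin n))) :
    mallowsProb n q A = ∑ π, mallowsProb n q {π} * A.indicator 1 π := by
  simp only [mallowsProb_singleton]
  unfold mallowsProb
  rw [Finset.sum_div]
  refine Finset.sum_congr rfl fun π _ => ?_
  by_cases h : π ∈ A <;> simp [h, wZ]

lemma mallowsProb_sum_one (n : ℕ) {q : ℝ} (hq : 0 < q) :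
    ∑ π : Equiv.Perm (Fin n), mallowsProb n q {π} = 1 := by
  simp only [mallowsProb_singleton]
  rw [← Finset.sum_div, ← wZ, div_self (wZ_pos hq n).ne']

/-- Filter of events of asymptotically full probability. -/
noncomputable def mL (q : ℕ → ℝ) (hq : ∀ n, 0 < q n) : Filter (Σ n : ℕ, Equiv.Perm (Fin n)) where
  sets := {A | Tendsto (fun n => mallowsProb n (q n) {π | (⟨n, π⟩ : Σ n : ℕ, Equiv.Perm (Fin n)) ∉ A})
    atTop (nhds 0)}
  univ_sets := by simp [mallowsProb_empty]
  sets_of_superset := by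
    intro A B hA hAB
    refine squeeze_zero (fun n => mallowsProb_nonneg n (hq n) _) (fun n => ?_) hA
    exact mallowsProb_mono n (hq n) fun π hπ h => hπ (hAB h)
  inter_sets := by
    intro A B hA hB
    have h := Tendsto.add hA hB
    rw [add_zero] at h
    refine squeeze_zero (fun n => mallowsProb_nonneg n (hq n) _) (fun n => ?_) h
    refine le_trans (mallowsProb_mono n (hq n) ?_) (mallowsProb_union n (hq n) _ _)
    intro π hπ
    simp only [Set.mem_inter_iff, Set.mem_ofPred_eq, not_and_or] at hπ
    exact hπ

lemma mem_mL (q : ℕ → ℝ) (hq : ∀ n, 0 < q n) (A : Set (Σ n : ℕ, Equiv.Perm (Fin n))) :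
    A ∈ mL q hq ↔ Tendsto (fun n => mallowsProb n (q n)
      {π | (⟨n, π⟩ : Σ n : ℕ, Equiv.Perm (Fin n)) ∉ A}) atTop (nhds 0) := Iff.rfl

lemma mL_fst (q : ℕ → ℝ) (hq : ∀ n, 0 < q n) : Tendsto Sigma.fst (mL q hq) atTop := by
  rw [tendsto_atTop]
  intro N
  change _ ∈ mL q hq
  rw [mem_mL]
  refine Tendsto.congr' ?_ tendsto_const_nhds
  filter_upwards [eventually_ge_atTop N] with n hn
  simp [hn, mallowsProb_empty]

lemma mL_chebyshev (q : ℕ → ℝ) (hq : ∀ n, 0 < q n) (X : (Σ n : ℕ, Equiv.Perm (Fin n)) → ℝ) (c : ℝ)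
    (h : Tendsto (fun n => ∑ π : Equiv.Perm (Fin n), mallowsProb n (q n) {π} * (X ⟨n, π⟩ - c) ^ 2)
      atTop (nhds 0)) : Tendsto X (mL q hq) (nhds c) := by
  rw [Metric.tendsto_nhds]
  intro ε hε
  change _ ∈ mL q hq
  rw [mem_mL]
  have h' := h.div_const (ε ^ 2)
  rw [zero_div] at h'
  refine squeeze_zero (fun n => mallowsProb_nonneg n (hq n) _) (fun n => ?_) h'
  rw [mallowsProb_eq_sum, Finset.sum_div]
  refine Finset.sum_le_sum fun π _ => ?_
  rw [mul_div_assoc]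
  refine mul_le_mul_of_nonneg_left ?_ (mallowsProb_nonneg n (hq n) _)
  by_cases hb : dist (X ⟨n, π⟩) c < ε
  · rw [Set.indicator_of_notMem (by simpa using hb)]
    positivity
  · rw [Set.indicator_of_mem (by simpa using hb)]
    rw [Real.dist_eq, not_lt] at hb
    rw [Pi.one_apply, le_div_iff₀ (by positivity), one_mul, ← sq_abs (X _ - c)]
    gcongr

lemma mL_integral (q : ℕ → ℝ) (hq : ∀ n, 0 < q n) (G : (Σ n : ℕ, Equiv.Perm (Fin n)) → ℝ) (c C : ℝ)
    (hC : ∀ x, |G x - c| ≤ C) (h : Tendsto G (mL q hq) (nhds c)) :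
    Tendsto (fun n => ∑ π : Equiv.Perm (Fin n), mallowsProb n (q n) {π} * G ⟨n, π⟩)
      atTop (nhds c) := by
  rw [Metric.tendsto_nhds] at h ⊢
  intro ε hε
  have h1 := h (ε / 2) (by positivity)
  change _ ∈ mL q hq at h1
  rw [mem_mL] at h1
  have h2 := h1.mul_const C
  rw [zero_mul] at h2
  filter_upwards [h2.eventually (gt_mem_nhds (show (0 : ℝ) < ε / 2 by positivity))] with n hn
  have e1 : ∑ π : Equiv.Perm (Fin n), mallowsProb n (q n) {π} * G ⟨n, π⟩ - c =
      ∑ π : Equiv.Perm (Fin n), mallowsProb n (q n) {π} * (G ⟨n, π⟩ - c) := by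
    simp only [mul_sub, Finset.sum_sub_distrib]
    rw [← Finset.sum_mul, mallowsProb_sum_one n (hq n), one_mul]
  rw [Real.dist_eq, e1]
  refine lt_of_le_of_lt (Finset.abs_sum_le_sum_abs _ _) ?_
  have e2 : ∑ π : Equiv.Perm (Fin n), |mallowsProb n (q n) {π} * (G ⟨n, π⟩ - c)| ≤
      ∑ π : Equiv.Perm (Fin n), (mallowsProb n (q n) {π} * (ε / 2) +
        mallowsProb n (q n) {π} * {π | (⟨n, π⟩ : Σ n : ℕ, Equiv.Perm (Fin n)) ∉
          {x | dist (G x) c < ε / 2}}.indicator 1 π * C) := by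
    refine Finset.sum_le_sum fun π _ => ?_
    have hp := mallowsProb_nonneg n (hq n) {π}
    rw [abs_mul, abs_of_nonneg hp, mul_assoc, ← mul_add]
    refine mul_le_mul_of_nonneg_left ?_ hp
    by_cases hb : dist (G ⟨n, π⟩) c < ε / 2
    · rw [Set.indicator_of_notMem (by simpa using hb)]
      rw [Real.dist_eq] at hb
      linarith
    · rw [Set.indicator_of_mem (by simpa using hb)]
      have := hC ⟨n, π⟩
      simp only [Pi.one_apply]
      linarith
  rw [Finset.sum_add_distrib, ← Finset.sum_mul, ← Finset.sum_mul, mallowsProb_sum_one n (hq n),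
    ← mallowsProb_eq_sum] at e2
  have hn' : mallowsProb n (q n) {π | (⟨n, π⟩ : Σ n : ℕ, Equiv.Perm (Fin n)) ∉
          {x | dist (G x) c < ε / 2}} * C < ε / 2 := hn
  linarith

/-! ### Asymptotics of q-integers -/

/-- `(e^z - 1)/z`. -/
noncomputable def hh (z : ℝ) : ℝ := dslope Real.exp 0 z

lemma hh_mul (z : ℝ) : z * hh z = Real.exp z - 1 := by
  have := sub_smul_dslope Real.exp 0 z
  simpa [hh] using this

lemma hh_zero : hh 0 = 1 := by simp [hh, dslope_same]

lemma hh_ne (z : ℝ) : hh z ≠ 0 := by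
  rcases eq_or_ne z 0 with rfl | hz
  · simp [hh_zero]
  · intro h
    have := hh_mul z
    rw [h, mul_zero] at this
    exact hz (Real.exp_eq_one_iff z |>.1 (by linarith))

lemma hh_cont : Continuous hh := by
  have : ContinuousOn (dslope Real.exp 0) Set.univ :=
    (continuousOn_dslope univ_mem).2 ⟨Real.continuous_exp.continuousOn, Real.differentiableAt_exp⟩
  exact continuousOn_univ.1 this

noncomputable def EE (β x : ℝ) : ℝ := x * hh (β * x)

lemma EE_mul (β x : ℝ) : β * EE β x = Real.exp (β * x) - 1 := by
  rw [← hh_mul, EE]; ring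

lemma EE_zero (x : ℝ) : EE 0 x = x := by simp [EE, hh_zero]

section asymp
variable {ι : Type*} {l : Filter ι} {N M : ι → ℕ} {p : ι → ℝ} {β : ℝ}

lemma p_tendsto_one (hN : Tendsto N l atTop)
    (hp1 : Tendsto (fun i => (N i : ℝ) * (p i - 1)) l (nhds β)) : Tendsto p l (nhds 1) := by
  have hN' : Tendsto (fun i => (N i : ℝ)) l atTop := tendsto_natCast_atTop_atTop.comp hN
  have h := (hp1.div_atTop hN').add_const 1
  rw [zero_add] at h
  refine h.congr' ?_
  filter_upwards [hN'.eventually_gt_atTop 0] with i hi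
  field_simp
  ring

lemma log_tendsto (hN : Tendsto N l atTop)
    (hp1 : Tendsto (fun i => (N i : ℝ) * (p i - 1)) l (nhds β)) :
    Tendsto (fun i => (N i : ℝ) * Real.log (p i)) l (nhds β) := by
  have h1 := p_tendsto_one hN hp1
  have hc : ContinuousAt (dslope Real.log 1) 1 :=
    continuousAt_dslope_same.2 (Real.differentiableAt_log one_ne_zero)
  have h2 := hp1.mul (hc.tendsto.comp h1)
  have h3 : dslope Real.log 1 1 = 1 := by simp [dslope_same]
  rw [h3, mul_one] at h2
  refine h2.congr fun i => ?_
  have := sub_smul_dslope Real.log 1 (p i)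
  simp only [smul_eq_mul, Real.log_one, sub_zero] at this
  rw [Function.comp_apply, mul_assoc, this]

lemma qi_eq_hh {p : ℝ} (hp : 0 < p) (m : ℕ) :
    qi p m * hh (Real.log p) = m * hh (m * Real.log p) := by
  rcases eq_or_ne (Real.log p) 0 with h | h
  · have : p = 1 := Real.eq_one_of_pos_of_log_eq_zero hp h
    subst this
    simp [qi, hh_zero]
  · apply mul_left_cancel₀ h
    have e1 := hh_mul (Real.log p)
    have e2 := hh_mul (m * Real.log p)
    have e3 := qi_mul p m
    rw [Real.exp_nat_mul, Real.exp_log hp] at e2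
    rw [Real.exp_log hp] at e1
    linear_combination qi p m * e1 - e2 + e3

lemma logp_zero (hN : Tendsto N l atTop)
    (hp1 : Tendsto (fun i => (N i : ℝ) * (p i - 1)) l (nhds β)) :
    Tendsto (fun i => Real.log (p i)) l (nhds 0) := by
  have h1 := p_tendsto_one hN hp1
  have := h1.log one_ne_zero
  rwa [Real.log_one] at this

lemma qi_tendsto (hp : ∀ i, 0 < p i) (hN : Tendsto N l atTop)
    (hp1 : Tendsto (fun i => (N i : ℝ) * (p i - 1)) l (nhds β)) {x : ℝ}
    (hM : Tendsto (fun i => (M i : ℝ) / N i) l (nhds x)) :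
    Tendsto (fun i => qi (p i) (M i) / N i) l (nhds (EE β x)) := by
  have hN' : Tendsto (fun i => (N i : ℝ)) l atTop := tendsto_natCast_atTop_atTop.comp hN
  have hb := log_tendsto hN hp1
  have h1 : Tendsto (fun i => hh (Real.log (p i))) l (nhds 1) := by
    have := (hh_cont.tendsto 0).comp (logp_zero hN hp1)
    rwa [hh_zero] at this
  have h2 := (hh_cont.tendsto _).comp (hb.mul hM)
  have h3 := (hM.mul h2).div h1 one_ne_zero
  rw [div_one] at h3
  refine h3.congr' ?_
  filter_upwards [hN'.eventually_gt_atTop 0] with i hi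
  have e := qi_eq_hh (hp i) (M i)
  have e2 : (N i : ℝ) * Real.log (p i) * ((M i : ℝ) / N i) = M i * Real.log (p i) := by
    field_simp
  simp only [Function.comp_apply, Pi.div_apply]
  rw [e2, div_eq_iff (hh_ne _), div_mul_eq_mul_div, ← e]
  ring

lemma pow_tendsto (hp : ∀ i, 0 < p i) (hN : Tendsto N l atTop)
    (hp1 : Tendsto (fun i => (N i : ℝ) * (p i - 1)) l (nhds β)) {x : ℝ}
    (hM : Tendsto (fun i => (M i : ℝ) / N i) l (nhds x)) :
    Tendsto (fun i => p i ^ (M i)) l (nhds (Real.exp (β * x))) := by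
  have hN' : Tendsto (fun i => (N i : ℝ)) l atTop := tendsto_natCast_atTop_atTop.comp hN
  have h := (Real.continuous_exp.tendsto _).comp ((log_tendsto hN hp1).mul hM)
  refine h.congr' ?_
  filter_upwards [hN'.eventually_gt_atTop 0] with i hi
  simp only [Function.comp_apply]
  rw [show (N i : ℝ) * Real.log (p i) * ((M i : ℝ) / N i) = M i * Real.log (p i) by field_simp,
    Real.exp_nat_mul, Real.exp_log (hp i)]

lemma ratio_tendsto (hN : Tendsto N l atTop)
    (hp1 : Tendsto (fun i => (N i : ℝ) * (p i - 1)) l (nhds β)) {e : ℝ}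
    (he : 0 < 1 + β * e) (hβ : β ≠ 0)
    (hM : Tendsto (fun i => qi (p i) (M i) / N i) l (nhds e)) :
    Tendsto (fun i => (M i : ℝ) / N i) l (nhds (Real.log (1 + β * e) / β)) := by
  have hN' : Tendsto (fun i => (N i : ℝ)) l atTop := tendsto_natCast_atTop_atTop.comp hN
  have hb := log_tendsto hN hp1
  have h1 := (((hp1.mul hM).const_add 1).log he.ne').div hb hβ
  refine h1.congr' ?_
  filter_upwards [hN'.eventually_gt_atTop 0, hb.eventually_ne hβ] with i hi hi2
  have e1 := qi_mul (p i) (M i)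
  have e2 : 1 + (N i : ℝ) * (p i - 1) * (qi (p i) (M i) / N i) = p i ^ M i := by
    have : (N i : ℝ) * (p i - 1) * (qi (p i) (M i) / N i) = (p i - 1) * qi (p i) (M i) := by
      field_simp
    rw [this, e1]; ring
  simp only [Pi.div_apply]
  rw [e2, Real.log_pow]
  have : Real.log (p i) ≠ 0 := right_ne_zero_of_mul hi2
  field_simp

lemma ratio_tendsto_zero (hp : ∀ i, 0 < p i) (hN : Tendsto N l atTop)
    (hp1 : Tendsto (fun i => (N i : ℝ) * (p i - 1)) l (nhds 0)) {e : ℝ}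
    (hMN : ∀ i, M i ≤ N i)
    (hM : Tendsto (fun i => qi (p i) (M i) / N i) l (nhds e)) :
    Tendsto (fun i => (M i : ℝ) / N i) l (nhds e) := by
  have hN' : Tendsto (fun i => (N i : ℝ)) l atTop := tendsto_natCast_atTop_atTop.comp hN
  have hb := log_tendsto hN hp1
  have h1 : Tendsto (fun i => hh (Real.log (p i))) l (nhds 1) := by
    have := (hh_cont.tendsto 0).comp (logp_zero hN hp1)
    rwa [hh_zero] at this
  have h2 : Tendsto (fun i => (M i : ℝ) * Real.log (p i)) l (nhds 0) := by
    refine squeeze_zero_norm (fun i => ?_) (tendsto_zero_iff_norm_tendsto_zero.1 hb)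
    rw [norm_mul, norm_mul]
    refine mul_le_mul_of_nonneg_right ?_ (norm_nonneg _)
    simpa using hMN i
  have h3 : Tendsto (fun i => hh (M i * Real.log (p i))) l (nhds 1) := by
    have := (hh_cont.tendsto 0).comp h2
    rwa [hh_zero] at this
  have h4 := (hM.mul h1).div h3 one_ne_zero
  rw [mul_one, div_one] at h4
  refine h4.congr' ?_
  filter_upwards [hN'.eventually_gt_atTop 0] with i hi
  have e := qi_eq_hh (hp i) (M i)
  simp only [Pi.div_apply]
  rw [div_mul_eq_mul_div, e]
  field_simp [hh_ne]

end asymp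

/-! ### Convergence of the counting functions -/

lemma p_inv_tendsto (q : ℕ → ℝ) (hq : ∀ n, 0 < q n) (β : ℝ)
    (hβ : Tendsto (fun n : ℕ => (n : ℝ) * (1 - q n)) atTop (nhds β)) :
    Tendsto (fun n : ℕ => (n : ℝ) * (q n - 1)) atTop (nhds (-β)) ∧
    Tendsto (fun n : ℕ => (n : ℝ) * ((q n)⁻¹ - 1)) atTop (nhds β) := by
  have h1 : Tendsto (fun n : ℕ => (n : ℝ) * (q n - 1)) atTop (nhds (-β)) :=
    hβ.neg.congr fun n => by ring
  refine ⟨h1, ?_⟩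
  have h2 : Tendsto q atTop (nhds 1) := p_tendsto_one (N := fun n => n) tendsto_id h1
  have h3 := hβ.div h2 one_ne_zero
  rw [div_one] at h3
  refine h3.congr fun n => ?_
  have := (hq n).ne'
  simp only [Pi.div_apply]
  field_simp

/-- limit of the rescaled q-count -/
noncomputable def ee (β x y : ℝ) : ℝ :=
  EE β y * Real.exp (-β * x) * (EE (-β) (1 - x) / EE (-β) 1)

lemma moments_tendsto (q : ℕ → ℝ) (hq : ∀ n, 0 < q n) (β : ℝ)
    (hβ : Tendsto (fun n : ℕ => (n : ℝ) * (1 - q n)) atTop (nhds β)) {x y : ℝ}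
    (hx : x ∈ Set.Icc (0 : ℝ) 1) (hy : y ∈ Set.Icc (0 : ℝ) 1) :
    Tendsto (fun n : ℕ => wS (q n) n ⌊x * n⌋₊ ⌊y * n⌋₊ (qi (q n)⁻¹) / wZ (q n) n / n)
      atTop (nhds (ee β x y)) ∧
    Tendsto (fun n : ℕ => wS (q n) n ⌊x * n⌋₊ ⌊y * n⌋₊ (qf (q n)⁻¹) / wZ (q n) n / (n : ℝ) ^ 2)
      atTop (nhds (ee β x y ^ 2)) := by
  obtain ⟨h1, h2⟩ := p_inv_tendsto q hq β hβ
  have hle : ∀ {z : ℝ}, z ∈ Set.Icc (0 : ℝ) 1 → ∀ n : ℕ, ⌊z * n⌋₊ ≤ n := by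
    intro z hz n
    have : z * n ≤ n := by
      have := hz.2
      have hn : (0 : ℝ) ≤ n := Nat.cast_nonneg n
      nlinarith
    exact_mod_cast (Nat.floor_le (mul_nonneg hz.1 (Nat.cast_nonneg n))).trans this
  have hfl : ∀ {z : ℝ}, z ∈ Set.Icc (0 : ℝ) 1 →
      Tendsto (fun n : ℕ => (⌊z * n⌋₊ : ℝ) / n) atTop (nhds z) := fun hz =>
    (tendsto_nat_floor_mul_div_atTop hz.1).comp tendsto_natCast_atTop_atTop
  have hnn : Tendsto (fun n : ℕ => (n : ℝ) / n) atTop (nhds 1) := by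
    refine tendsto_const_nhds.congr' ?_
    filter_upwards [eventually_gt_atTop 0] with n hn
    rw [div_self (by positivity)]
  have hx' : Tendsto (fun n : ℕ => ((n - ⌊x * n⌋₊ : ℕ) : ℝ) / n) atTop (nhds (1 - x)) := by
    refine (hnn.sub (hfl hx)).congr fun n => ?_
    rw [Nat.cast_sub (hle hx n), sub_div]
  have hid : Tendsto (fun n : ℕ => n) atTop atTop := tendsto_id
  have hpi : ∀ n, 0 < (q n)⁻¹ := fun n => inv_pos.2 (hq n)
  have at_ := qi_tendsto hpi hid h2 (hfl hy)
  have ax := qi_tendsto hq hid h1 hx'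
  have an := qi_tendsto hq hid h1 hnn
  have ak := pow_tendsto hq hid h1 (hfl hx)
  have hE1 : EE (-β) 1 ≠ 0 := by simpa [EE] using hh_ne (-β)
  have hinv : Tendsto (fun n : ℕ => (1 : ℝ) / n) atTop (nhds 0) := tendsto_one_div_atTop_nhds_zero_nat
  have conv : ∀ {p : ℕ → ℝ} {m : ℕ → ℕ} {c : ℝ},
      Tendsto (fun n => qi (p n) (m n) / n) atTop (nhds c) →
      Tendsto (fun n => qf (p n) (m n) / (n : ℝ) ^ 2) atTop (nhds (c ^ 2)) := by
    intro p m c h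
    have := (h.pow 2).sub (h.mul hinv)
    rw [mul_zero, sub_zero] at this
    refine this.congr fun n => ?_
    rw [qf]; ring
  constructor
  · have := (at_.mul ak).mul (ax.div an hE1)
    refine this.congr' ?_
    filter_upwards [eventually_gt_atTop 0] with n hn
    have e := wS_first (hq n) ⌊x * n⌋₊ n ⌊y * n⌋₊ (hle hx n) (hle hy n)
    have hz := (wZ_pos (hq n) n).ne'
    have hqn := (qi_pos (hq n) hn).ne'
    have hn' : (n : ℝ) ≠ 0 := by positivity
    simp only [Pi.div_apply]
    generalize ⌊x * n⌋₊ = k at e ⊢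
    generalize ⌊y * n⌋₊ = t at e ⊢
    generalize wS (q n) n k t (qi (q n)⁻¹) = A at e ⊢
    generalize qi (q n)⁻¹ t = B at e ⊢
    field_simp
    linear_combination -e
  · have an2 := conv an
    have hE2 : EE (-β) 1 ^ 2 ≠ 0 := pow_ne_zero 2 hE1
    have := ((conv at_).mul (ak.pow 2)).mul ((conv ax).div an2 hE2)
    have e0 : EE β y ^ 2 * Real.exp (-β * x) ^ 2 * (EE (-β) (1 - x) ^ 2 / EE (-β) 1 ^ 2) =
      ee β x y ^ 2 := by rw [ee]; ring
    rw [e0] at this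
    refine this.congr' ?_
    filter_upwards [eventually_gt_atTop 0, an2.eventually_ne hE2] with n hn hqf
    have e := wS_second (hq n) ⌊x * n⌋₊ n ⌊y * n⌋₊ (hle hx n) (hle hy n)
    have hz := (wZ_pos (hq n) n).ne'
    have hn' : (n : ℝ) ≠ 0 := by positivity
    have hqn : qf (q n) n ≠ 0 := fun h => hqf (by rw [h, zero_div])
    simp only [Pi.div_apply]
    generalize ⌊x * n⌋₊ = k at e ⊢
    generalize ⌊y * n⌋₊ = t at e ⊢
    generalize wS (q n) n k t (qf (q n)⁻¹) = A at e ⊢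
    generalize qf (q n)⁻¹ t = B at e ⊢
    field_simp
    rw [← pow_mul, mul_comm _ 2]
    linear_combination -e

lemma qcount_tendsto (q : ℕ → ℝ) (hq : ∀ n, 0 < q n) (β : ℝ)
    (hβ : Tendsto (fun n : ℕ => (n : ℝ) * (1 - q n)) atTop (nhds β)) {x y : ℝ}
    (hx : x ∈ Set.Icc (0 : ℝ) 1) (hy : y ∈ Set.Icc (0 : ℝ) 1) :
    Tendsto (fun s : Σ n : ℕ, Equiv.Perm (Fin n) =>
      qi (q s.1)⁻¹ (cnt s.1 ⌊x * s.1⌋₊ ⌊y * s.1⌋₊ s.2) / s.1) (mL q hq) (nhds (ee β x y)) := by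
  apply mL_chebyshev
  obtain ⟨h1, h2⟩ := moments_tendsto q hq β hβ hx hy
  have hinv : Tendsto (fun n : ℕ => (1 : ℝ) / n) atTop (nhds 0) := tendsto_one_div_atTop_nhds_zero_nat
  have h3 := ((h2.add (h1.mul hinv)).sub (h1.const_mul (2 * ee β x y))).add_const (ee β x y ^ 2)
  have e0 : ee β x y ^ 2 + ee β x y * 0 - 2 * ee β x y * ee β x y + ee β x y ^ 2 = 0 := by ring
  rw [e0] at h3
  refine h3.congr' ?_
  filter_upwards [eventually_gt_atTop 0] with n hn
  have hz := (wZ_pos (hq n) n).ne'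
  have hs := mallowsProb_sum_one n (hq n)
  simp only [mallowsProb_singleton] at hs ⊢
  have e1 : ∀ f : ℕ → ℝ, wS (q n) n ⌊x * n⌋₊ ⌊y * n⌋₊ f / wZ (q n) n =
      ∑ π : Equiv.Perm (Fin n), q n ^ inversions π / wZ (q n) n *
        f (cnt n ⌊x * n⌋₊ ⌊y * n⌋₊ π) := by
    intro f
    rw [wS, Finset.sum_div]
    exact Finset.sum_congr rfl fun π _ => by ring
  rw [e1, e1]
  have e2 : ee β x y ^ 2 = ∑ π : Equiv.Perm (Fin n), q n ^ inversions π / wZ (q n) n * ee β x y ^ 2 := by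
    rw [← Finset.sum_mul, hs, one_mul]
  nth_rewrite 1 [e2]
  rw [Finset.sum_div, Finset.sum_div, Finset.sum_mul, Finset.mul_sum, ← Finset.sum_add_distrib,
    ← Finset.sum_sub_distrib, ← Finset.sum_add_distrib]
  refine Finset.sum_congr rfl fun π _ => ?_
  rw [qf]
  have hn' : (n : ℝ) ≠ 0 := by positivity
  field_simp
  ring

/-- limiting distribution function -/
noncomputable def uu (β x y : ℝ) : ℝ :=
  if β = 0 then x * y else
    -Real.log (1 - (1 - Real.exp (-β * x)) * (1 - Real.exp (-β * y)) / (1 - Real.exp (-β))) / β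

lemma one_sub_exp_ne {β : ℝ} (hβ : β ≠ 0) : 1 - Real.exp (-β) ≠ 0 := by
  intro h
  have : Real.exp (-β) = 1 := by linarith
  rw [Real.exp_eq_one_iff] at this
  exact hβ (by linarith)

lemma ee_eq {β : ℝ} (hβ : β ≠ 0) (x y : ℝ) : 1 + β * ee β x y = Real.exp (β * y) *
    (1 - (1 - Real.exp (-β * x)) * (1 - Real.exp (-β * y)) / (1 - Real.exp (-β))) := by
  have h0 := one_sub_exp_ne hβ
  have e1 := EE_mul β y
  have e2 := EE_mul (-β) (1 - x)
  have e3 := EE_mul (-β) 1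
  rw [mul_one] at e3
  have hE1 : EE (-β) 1 ≠ 0 := by simpa [EE] using hh_ne (-β)
  have e4 : Real.exp (-β * x) * (EE (-β) (1 - x) / EE (-β) 1) =
      (Real.exp (-β * x) - Real.exp (-β)) / (1 - Real.exp (-β)) := by
    have hx : Real.exp (-β * x) * Real.exp (-β * (1 - x)) = Real.exp (-β) := by
      rw [← Real.exp_add]; ring_nf
    have : EE (-β) (1 - x) / EE (-β) 1 = (1 - Real.exp (-β * (1 - x))) / (1 - Real.exp (-β)) := by
      rw [div_eq_div_iff hE1 h0]
      apply mul_left_cancel₀ hβ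
      linear_combination (Real.exp (-β) - 1) * e2 - (Real.exp (-β * (1 - x)) - 1) * e3
    rw [this, mul_div_assoc', mul_sub, hx, mul_one]
  have hy : Real.exp (β * y) * Real.exp (-β * y) = 1 := by
    rw [← Real.exp_add]; simp
  rw [ee, mul_assoc, e4, ← mul_assoc, e1]
  generalize Real.exp (-β * x) = A
  generalize Real.exp (-β * y) = B at hy ⊢
  field_simp
  linear_combination (A - 1) * hy

lemma den_pos {β x y : ℝ} (hβ : β ≠ 0)
    (hx : x ∈ Set.Icc (0 : ℝ) 1) :
    0 < 1 - (1 - Real.exp (-β * x)) * (1 - Real.exp (-β * y)) / (1 - Real.exp (-β)) := by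
  have hs : ∃ s ∈ Set.Icc (0 : ℝ) 1, (1 - Real.exp (-β * x)) = s * (1 - Real.exp (-β)) := by
    refine ⟨(1 - Real.exp (-β * x)) / (1 - Real.exp (-β)), ?_, by
      rw [div_mul_cancel₀ _ (one_sub_exp_ne hβ)]⟩
    rcases lt_or_gt_of_ne hβ with h | h
    · have a1 : 1 ≤ Real.exp (-β * x) := Real.one_le_exp (by nlinarith [hx.1])
      have a2 : Real.exp (-β * x) ≤ Real.exp (-β) := Real.exp_le_exp.2 (by nlinarith [hx.2])
      have a3 : 1 < Real.exp (-β) := by rw [Real.one_lt_exp_iff]; linarith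
      constructor
      · exact div_nonneg_of_nonpos (by linarith) (by linarith)
      · rw [div_le_one_of_neg (by linarith)]; linarith
    · have a1 : Real.exp (-β * x) ≤ 1 := by rw [Real.exp_le_one_iff]; nlinarith [hx.1]
      have a2 : Real.exp (-β) ≤ Real.exp (-β * x) := Real.exp_le_exp.2 (by nlinarith [hx.2])
      have a3 : Real.exp (-β) < 1 := by rw [Real.exp_lt_one_iff]; linarith
      constructor
      · exact div_nonneg (by linarith) (by linarith)
      · rw [div_le_one (by linarith)]; linarith
  obtain ⟨s, hs, e⟩ := hs
  have h0 := one_sub_exp_ne hβ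
  have : s * (1 - Real.exp (-β)) * (1 - Real.exp (-β * y)) / (1 - Real.exp (-β)) =
    s * (1 - Real.exp (-β * y)) := by field_simp
  rw [e, this]
  have hp := Real.exp_pos (-β * y)
  rcases hs.2.eq_or_lt with h | h
  · rw [h]; linarith
  · nlinarith [hs.1, mul_nonneg hs.1 hp.le]

lemma count_tendsto (q : ℕ → ℝ) (hq : ∀ n, 0 < q n) (β : ℝ)
    (hβ : Tendsto (fun n : ℕ => (n : ℝ) * (1 - q n)) atTop (nhds β)) {x y : ℝ}
    (hx : x ∈ Set.Icc (0 : ℝ) 1) (hy : y ∈ Set.Icc (0 : ℝ) 1) :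
    Tendsto (fun s : Σ n : ℕ, Equiv.Perm (Fin n) =>
      (cnt s.1 ⌊x * s.1⌋₊ ⌊y * s.1⌋₊ s.2 : ℝ) / s.1) (mL q hq) (nhds (y - uu β x y)) := by
  have h := qcount_tendsto q hq β hβ hx hy
  have hfst := mL_fst q hq
  have hp := (p_inv_tendsto q hq β hβ).2.comp hfst
  have hpi : ∀ s : Σ n : ℕ, Equiv.Perm (Fin n), 0 < (q s.1)⁻¹ := fun s => inv_pos.2 (hq _)
  by_cases hb : β = 0
  · subst hb
    have := ratio_tendsto_zero (N := Sigma.fst) (p := fun s => (q s.1)⁻¹) hpi hfst hp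
      (fun s => (cnt_le s.2).trans (Nat.sub_le _ _)) h
    convert this using 2
    simp [uu, ee, EE_zero]
    ring
  · have hd := den_pos (y := y) hb hx
    have he := ee_eq hb x y
    have := ratio_tendsto (N := Sigma.fst) (p := fun s => (q s.1)⁻¹) hfst hp
      (by rw [he]; positivity) hb h
    convert this using 2
    rw [he, Real.log_mul (Real.exp_pos _).ne' hd.ne', Real.log_exp, uu, if_neg hb]
    field_simp
    ring

/-! ### The limiting measure -/

/-- the half-open unit square -/
def QQ : Set (ℝ × ℝ) := Set.Ioc 0 1 ×ˢ Set.Ioc 0 1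

lemma measurableSet_QQ : MeasurableSet QQ := measurableSet_Ioc.prod measurableSet_Ioc

lemma restrict_square :
    (volume : Measure (ℝ × ℝ)).restrict (Set.Icc (0, 0) (1, 1)) = volume.restrict QQ := by
  apply Measure.restrict_congr_set
  rw [← Set.Icc_prod_Icc, QQ, Measure.volume_eq_prod]
  exact (Measure.set_prod_ae_eq Ioc_ae_eq_Icc Ioc_ae_eq_Icc).symm

lemma rhoMeasure_compl (β : ℝ) : rhoMeasure β QQᶜ = 0 := by
  have h : (volume : Measure (ℝ × ℝ)).restrict (Set.Icc (0, 0) (1, 1)) QQᶜ = 0 := by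
    rw [restrict_square, Measure.restrict_apply measurableSet_QQ.compl]
    simp
  unfold rhoMeasure
  split_ifs
  · exact h
  · exact withDensity_absolutelyContinuous _ _ h

/-- `D = 1 - ab/c`. -/
noncomputable def DD (β x y : ℝ) : ℝ :=
  1 - (1 - Real.exp (-β * x)) * (1 - Real.exp (-β * y)) / (1 - Real.exp (-β))

lemma rhoDen_eq {β : ℝ} (hβ : β ≠ 0) (x y : ℝ) (hD : DD β x y ≠ 0) :
    rhoDen β (x, y) = β * Real.exp (-β * x) * Real.exp (-β * y) /
      ((1 - Real.exp (-β)) * DD β x y ^ 2) := by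
  have h0 := one_sub_exp_ne hβ
  set X := Real.exp (β * x / 2) with hX
  set Y := Real.exp (β * y / 2) with hY
  set B := Real.exp (β / 4) with hB
  have hXp : X ≠ 0 := (Real.exp_pos _).ne'
  have hYp : Y ≠ 0 := (Real.exp_pos _).ne'
  have hBp : B ≠ 0 := (Real.exp_pos _).ne'
  have e1 : Real.exp (-β * x) = (X ^ 2)⁻¹ := by
    rw [hX, ← Real.exp_nat_mul, ← Real.exp_neg]; congr 1; push_cast; ring
  have e2 : Real.exp (-β * y) = (Y ^ 2)⁻¹ := by
    rw [hY, ← Real.exp_nat_mul, ← Real.exp_neg]; congr 1; push_cast; ring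
  have e3 : Real.exp (-β) = (B ^ 4)⁻¹ := by
    rw [hB, ← Real.exp_nat_mul, ← Real.exp_neg]; congr 1; push_cast; ring
  have e4 : Real.exp (-β / 4) = B⁻¹ := by rw [hB, ← Real.exp_neg]; congr 1; ring
  have e5 : Real.sinh (β / 2) = (B ^ 2 - (B ^ 2)⁻¹) / 2 := by
    rw [Real.sinh_eq, hB, ← Real.exp_nat_mul, ← Real.exp_neg]
    congr 3 <;> push_cast <;> ring
  have e6 : Real.cosh (β * (x - y) / 2) = (X * Y⁻¹ + Y * X⁻¹) / 2 := by
    rw [Real.cosh_eq, hX, hY, ← Real.exp_neg, ← Real.exp_neg, ← Real.exp_add, ← Real.exp_add]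
    congr 3 <;> ring
  have e7 : Real.cosh (β * (x + y - 1) / 2) = (X * Y * (B ^ 2)⁻¹ + X⁻¹ * Y⁻¹ * B ^ 2) / 2 := by
    rw [Real.cosh_eq, hX, hY, hB, ← Real.exp_nat_mul, ← Real.exp_neg, ← Real.exp_neg,
      ← Real.exp_neg, ← Real.exp_add, ← Real.exp_add, ← Real.exp_add, ← Real.exp_add]
    congr 3 <;> push_cast <;> ring
  have e8 : B * ((X * Y⁻¹ + Y * X⁻¹) / 2) - B⁻¹ * ((X * Y * (B ^ 2)⁻¹ + X⁻¹ * Y⁻¹ * B ^ 2) / 2) =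
      B * X * Y / 2 * ((1 - Real.exp (-β)) * DD β x y) := by
    have : (1 - Real.exp (-β)) * DD β x y =
        (1 - Real.exp (-β)) - (1 - Real.exp (-β * x)) * (1 - Real.exp (-β * y)) := by
      rw [DD]; field_simp
    rw [this, e1, e2, e3]
    field_simp
    ring
  have e9 : (B ^ 2 - (B ^ 2)⁻¹) / 2 = B ^ 2 / 2 * (1 - Real.exp (-β)) := by
    rw [e3]; field_simp
  unfold rhoDen
  simp only []
  rw [← hB, e4, e5, e6, e7, e8, e9, e1, e2]
  generalize 1 - Real.exp (-β) = c at *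
  generalize DD β x y = D at *
  field_simp

lemma lintegral_ftc {f g : ℝ → ℝ} {y : ℝ} (hy : 0 ≤ y)
    (hd : ∀ t ∈ Set.Icc 0 y, HasDerivAt g (f t) t) (hc : ContinuousOn f (Set.Icc 0 y))
    (hf : ∀ t ∈ Set.Icc 0 y, 0 ≤ f t) :
    ∫⁻ t in Set.Ioc 0 y, ENNReal.ofReal (f t) = ENNReal.ofReal (g y - g 0) := by
  have hi : IntervalIntegrable f volume 0 y := by
    apply ContinuousOn.intervalIntegrable; rwa [Set.uIcc_of_le hy]
  rw [← ofReal_integral_eq_lintegral_ofReal, ← intervalIntegral.integral_of_le hy,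
    intervalIntegral.integral_eq_sub_of_hasDerivAt _ hi]
  · rwa [Set.uIcc_of_le hy]
  · exact (intervalIntegrable_iff_integrableOn_Ioc_of_le hy).1 hi
  · rw [EventuallyLE, ae_restrict_iff' measurableSet_Ioc]
    exact Eventually.of_forall fun t ht => hf t ⟨ht.1.le, ht.2⟩

lemma hasDerivAt_aux (β x : ℝ) :
    HasDerivAt (fun x => 1 - Real.exp (-β * x)) (β * Real.exp (-β * x)) x := by
  have h := ((hasDerivAt_id x).const_mul (-β)).exp.const_sub 1
  refine HasDerivAt.congr_deriv h ?_
  simp only [id]; ring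

lemma hasDerivAt_DD (β x y : ℝ) :
    HasDerivAt (fun y => DD β x y)
      (-((1 - Real.exp (-β * x)) * (β * Real.exp (-β * y)) / (1 - Real.exp (-β)))) y :=
  (((hasDerivAt_aux β y).const_mul _).div_const _).const_sub 1

lemma DD_comm (β x y : ℝ) : DD β x y = DD β y x := by unfold DD; ring

lemma continuous_DD (β x : ℝ) : Continuous (fun y => DD β x y) := by
  unfold DD; fun_prop

lemma beta_div_pos {β : ℝ} (hβ : β ≠ 0) : 0 < β / (1 - Real.exp (-β)) := by
  rcases lt_or_gt_of_ne hβ with h | h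
  · have a3 : 1 < Real.exp (-β) := by rw [Real.one_lt_exp_iff]; linarith
    exact div_pos_of_neg_of_neg h (by linarith)
  · have a3 : Real.exp (-β) < 1 := by rw [Real.exp_lt_one_iff]; linarith
    exact div_pos h (by linarith)

lemma frac_nonneg {β y : ℝ} (hβ : β ≠ 0) (hy : 0 ≤ y) :
    0 ≤ (1 - Real.exp (-β * y)) / (1 - Real.exp (-β)) := by
  rcases lt_or_gt_of_ne hβ with h | h
  · have a3 : 1 < Real.exp (-β) := by rw [Real.one_lt_exp_iff]; linarith
    have a1 : 1 ≤ Real.exp (-β * y) := Real.one_le_exp (by nlinarith)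
    exact div_nonneg_of_nonpos (by linarith) (by linarith)
  · have a3 : Real.exp (-β) < 1 := by rw [Real.exp_lt_one_iff]; linarith
    have a1 : Real.exp (-β * y) ≤ 1 := by rw [Real.exp_le_one_iff]; nlinarith
    exact div_nonneg (by linarith) (by linarith)

lemma measurable_rhoDen (β : ℝ) : Measurable (rhoDen β) := by
  unfold rhoDen
  fun_prop

lemma rho_inner {β s y : ℝ} (hβ : β ≠ 0) (hs : s ∈ Set.Icc (0 : ℝ) 1) (hy : 0 ≤ y) :
    ∫⁻ t in Set.Ioc 0 y, ENNReal.ofReal (rhoDen β (s, t)) =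
      ENNReal.ofReal (Real.exp (-β * s) * ((1 - Real.exp (-β * y)) / (1 - Real.exp (-β))) /
        DD β s y) := by
  have h0 := one_sub_exp_ne hβ
  have hD : ∀ t, 0 < DD β s t := fun t => den_pos hβ hs
  have hfun : (fun t => rhoDen β (s, t)) = fun t => β * Real.exp (-β * s) * Real.exp (-β * t) /
      ((1 - Real.exp (-β)) * DD β s t ^ 2) := funext fun t => rhoDen_eq hβ s t (hD t).ne'
  rw [lintegral_ftc (g := fun t => Real.exp (-β * s) *
    ((1 - Real.exp (-β * t)) / (1 - Real.exp (-β))) / DD β s t) hy]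
  · simp
  · intro t _
    have h := (((hasDerivAt_aux β t).div_const (1 - Real.exp (-β))).const_mul
      (Real.exp (-β * s))).div (hasDerivAt_DD β s t) (hD t).ne'
    refine HasDerivAt.congr_deriv h ?_
    rw [rhoDen_eq hβ s t (hD t).ne']
    have e : DD β s t = 1 - (1 - Real.exp (-β * s)) * (1 - Real.exp (-β * t)) / (1 - Real.exp (-β)) :=
      rfl
    have hDt := (hD t).ne'
    generalize DD β s t = D at *
    generalize Real.exp (-β * s) = A at *
    generalize Real.exp (-β * t) = T at *
    generalize 1 - Real.exp (-β) = c at *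
    field_simp
    rw [e]
    field_simp
    ring
  · rw [hfun]
    refine Continuous.continuousOn (Continuous.div (by fun_prop) ?_ ?_)
    · exact continuous_const.mul ((continuous_DD β s).pow 2)
    · intro t
      exact mul_ne_zero h0 (pow_ne_zero 2 (hD t).ne')
  · intro t _
    rw [rhoDen_eq hβ s t (hD t).ne', mul_assoc, mul_div_mul_comm]
    have := beta_div_pos hβ
    positivity

lemma rho_rect (β : ℝ) {x y : ℝ} (hx : x ∈ Set.Icc (0 : ℝ) 1) (hy : y ∈ Set.Icc (0 : ℝ) 1) :
    rhoMeasure β (Set.Ioc 0 x ×ˢ Set.Ioc 0 y) = ENNReal.ofReal (uu β x y) := by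
  have hm : MeasurableSet (Set.Ioc 0 x ×ˢ Set.Ioc 0 y) := measurableSet_Ioc.prod measurableSet_Ioc
  have hsub : Set.Ioc 0 x ×ˢ Set.Ioc 0 y ⊆ QQ :=
    Set.prod_mono (Set.Ioc_subset_Ioc_right hx.2) (Set.Ioc_subset_Ioc_right hy.2)
  unfold rhoMeasure
  rw [restrict_square]
  split_ifs with hβ
  · rw [Measure.restrict_apply hm, Set.inter_eq_left.2 hsub, Measure.volume_eq_prod,
      Measure.prod_prod]
    simp [uu, hβ, ENNReal.ofReal_mul hx.1]
  · rw [withDensity_apply _ hm, Measure.restrict_restrict hm, Set.inter_eq_left.2 hsub,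
      Measure.volume_eq_prod, ← Measure.prod_restrict, lintegral_prod _
        ((measurable_rhoDen β).ennreal_ofReal.aemeasurable)]
    have h0 := one_sub_exp_ne hβ
    rw [setLIntegral_congr_fun measurableSet_Ioc
      (fun s hs => rho_inner hβ ⟨hs.1.le, hs.2.trans hx.2⟩ hy.1)]
    have hD : ∀ t ∈ Set.Icc 0 x, 0 < DD β t y := fun t ht => den_pos hβ ⟨ht.1, ht.2.trans hx.2⟩
    rw [lintegral_ftc (g := fun s => -Real.log (DD β s y) / β) hx.1]
    · congr 1
      simp [uu, hβ, DD]
    · intro t ht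
      have h1 := hasDerivAt_DD β y t
      simp only [DD_comm β y] at h1
      have h := ((h1.log (hD t ht).ne').neg).div_const β
      refine HasDerivAt.congr_deriv h ?_
      generalize DD β t y = D at *
      field_simp
    · have hc : Continuous (fun s => DD β s y) := by
        simp only [DD_comm β _ y]; exact continuous_DD β y
      exact ContinuousOn.div (by fun_prop) hc.continuousOn fun t ht => (hD t ht).ne'
    · intro t ht
      exact div_nonneg (mul_nonneg (Real.exp_pos _).le (frac_nonneg hβ hy.1)) (hD t ht).le

lemma uu_one (β : ℝ) : uu β 1 1 = 1 := by
  unfold uu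
  split_ifs with h
  · simp
  · have h0 := one_sub_exp_ne h
    rw [mul_one, mul_div_assoc, div_self h0]
    simp [h]

lemma uu_nonneg (β : ℝ) {x y : ℝ} (hx : x ∈ Set.Icc (0 : ℝ) 1) (hy : y ∈ Set.Icc (0 : ℝ) 1) :
    0 ≤ uu β x y := by
  unfold uu
  split_ifs with h
  · exact mul_nonneg hx.1 hy.1
  · have hD := den_pos (y := y) h hx
    have a := frac_nonneg h hx.1
    have b := frac_nonneg h hy.1
    have c := beta_div_pos h
    set Z := (1 - Real.exp (-β * x)) * (1 - Real.exp (-β * y)) / (1 - Real.exp (-β)) with hZ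
    have hZ' : Z / β = (1 - Real.exp (-β * x)) / (1 - Real.exp (-β)) *
        ((1 - Real.exp (-β * y)) / (1 - Real.exp (-β))) / (β / (1 - Real.exp (-β))) := by
      have h0 := one_sub_exp_ne h
      rw [hZ]; field_simp
    have hpos : 0 ≤ Z / β := by rw [hZ']; positivity
    rcases lt_or_gt_of_ne h with h1 | h1
    · have : Z ≤ 0 := by
        by_contra! hc
        exact absurd hpos (not_le.2 (div_neg_of_pos_of_neg hc h1))
      apply div_nonneg_of_nonpos _ h1.le
      have := Real.log_nonneg (show 1 ≤ 1 - Z by linarith)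
      linarith
    · have : 0 ≤ Z := by
        by_contra! hc
        exact absurd hpos (not_le.2 (div_neg_of_neg_of_pos hc h1))
      apply div_nonneg _ h1.le
      have := Real.log_nonpos hD.le (show 1 - Z ≤ 1 by linarith)
      linarith

lemma rho_prob (β : ℝ) : IsProbabilityMeasure (rhoMeasure β) := by
  constructor
  have h1 := rho_rect β (x := 1) (y := 1) (by simp) (by simp)
  rw [uu_one, ENNReal.ofReal_one] at h1
  have h2 := measure_add_measure_compl (μ := rhoMeasure β) measurableSet_QQ
  rw [rhoMeasure_compl, add_zero] at h2
  rw [← h2]; exact h1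

/-! ### The empirical measure -/

lemma emp_real {n : ℕ} (hn : 0 < n) (π : Equiv.Perm (Fin n)) {S : Set (ℝ × ℝ)}
    (hS : MeasurableSet S) :
    ((empiricalPerm n π : ProbabilityMeasure (ℝ × ℝ)) : Measure (ℝ × ℝ)).real S =
      (∑ k : Fin n, S.indicator (1 : ℝ × ℝ → ℝ)
        ((((k : ℕ) : ℝ) + 1) / n, (((π k : ℕ) : ℝ) + 1) / n)) / n := by
  have hμ : ((empiricalPerm n π : ProbabilityMeasure (ℝ × ℝ)) : Measure (ℝ × ℝ)) =
      (n : ℝ≥0∞)⁻¹ • ∑ k : Fin n,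
        Measure.dirac ((((k : ℕ) : ℝ) + 1) / n, (((π k : ℕ) : ℝ) + 1) / n) := by
    have h := congrArg Subtype.val (show empiricalPerm n π = _ from dif_neg hn.ne')
    exact h
  rw [hμ, measureReal_def, Measure.smul_apply, Measure.finsetSum_apply, smul_eq_mul,
    ENNReal.toReal_mul, ENNReal.toReal_sum (fun _ _ => measure_ne_top _ _)]
  simp only [Measure.dirac_apply' _ hS]
  rw [ENNReal.toReal_inv, ENNReal.toReal_natCast, inv_mul_eq_div]
  congr 1
  refine Finset.sum_congr rfl fun k _ => ?_
  by_cases hk : ((((k : ℕ) : ℝ) + 1) / n, (((π k : ℕ) : ℝ) + 1) / n) ∈ S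
  · rw [Set.indicator_of_mem hk, Set.indicator_of_mem hk]; simp
  · rw [Set.indicator_of_notMem hk, Set.indicator_of_notMem hk]; simp

lemma emp_compl {n : ℕ} (hn : 0 < n) (π : Equiv.Perm (Fin n)) :
    ((empiricalPerm n π : ProbabilityMeasure (ℝ × ℝ)) : Measure (ℝ × ℝ)).real QQᶜ = 0 := by
  rw [emp_real hn π measurableSet_QQ.compl]
  rw [Finset.sum_eq_zero, zero_div]
  intro k _
  rw [Set.indicator_of_notMem]
  simp only [Set.mem_compl_iff, not_not, QQ, Set.mem_prod, Set.mem_Ioc]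
  have hn' : (0 : ℝ) < n := by positivity
  have h1 : ((k : ℕ) : ℝ) + 1 ≤ n := by exact_mod_cast k.2
  have h2 : ((π k : ℕ) : ℝ) + 1 ≤ n := by exact_mod_cast (π k).2
  refine ⟨⟨by positivity, ?_⟩, ⟨by positivity, ?_⟩⟩
  · rwa [div_le_one hn']
  · rwa [div_le_one hn']

lemma emp_rect {n : ℕ} (hn : 0 < n) (π : Equiv.Perm (Fin n)) {x y : ℝ}
    (hx : x ∈ Set.Icc (0 : ℝ) 1) (hy : y ∈ Set.Icc (0 : ℝ) 1) :
    ((empiricalPerm n π : ProbabilityMeasure (ℝ × ℝ)) : Measure (ℝ × ℝ)).real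
      (Set.Ioc 0 x ×ˢ Set.Ioc 0 y) =
      (⌊y * n⌋₊ : ℝ) / n - (cnt n ⌊x * n⌋₊ ⌊y * n⌋₊ π : ℝ) / n := by
  have hn' : (0 : ℝ) < n := by positivity
  rw [emp_real hn π (measurableSet_Ioc.prod measurableSet_Ioc), ← sub_div]
  congr 1
  have hle : ⌊y * n⌋₊ ≤ n := by
    have : y * n ≤ n := by nlinarith [hy.2]
    exact_mod_cast (Nat.floor_le (mul_nonneg hy.1 (Nat.cast_nonneg n))).trans this
  have h1 := cnt_zero hle π
  have key : ∀ z : ℝ, 0 ≤ z → ∀ m : ℕ, ((m : ℝ) + 1) / n ∈ Set.Ioc 0 z ↔ m < ⌊z * n⌋₊ := by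
    intro z hz m
    rw [Set.mem_Ioc, div_le_iff₀ hn', ← Nat.succ_le_iff, Nat.le_floor_iff (by positivity)]
    push_cast
    constructor
    · exact fun h => h.2
    · exact fun h => ⟨by positivity, h⟩
  rw [eq_sub_iff_add_eq]
  have h2 : (⌊y * n⌋₊ : ℝ) = (cnt n 0 ⌊y * n⌋₊ π : ℝ) := by rw [h1]
  rw [h2, cnt, cnt, Finset.card_filter, Finset.card_filter]
  push_cast
  rw [← Finset.sum_add_distrib]
  refine Finset.sum_congr rfl fun k _ => ?_
  simp only [Set.indicator_apply, Set.mem_prod, key x hx.1, key y hy.1, Pi.one_apply]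
  split_ifs <;> first | omega | simp

/-! ### From distribution functions to rectangles -/

noncomputable def cl (z : ℝ) : ℝ := max 0 (min z 1)

lemma cl_mem (z : ℝ) : cl z ∈ Set.Icc (0 : ℝ) 1 := by
  unfold cl; constructor
  · exact le_max_left _ _
  · exact max_le zero_le_one (min_le_right _ _)

lemma cl_mono {a b : ℝ} (h : a ≤ b) : cl a ≤ cl b :=
  max_le_max le_rfl (min_le_min h le_rfl)

lemma Ioc_cl (a b : ℝ) : Set.Ioc a b ∩ Set.Ioc 0 1 = Set.Ioc (cl a) (cl b) := by
  ext t
  simp only [Set.mem_inter_iff, Set.mem_Ioc, cl, max_lt_iff, le_max_iff, min_lt_iff, le_min_iff]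
  constructor
  · rintro ⟨⟨h1, h2⟩, h3, h4⟩
    exact ⟨⟨h3, Or.inl h1⟩, Or.inr ⟨h2, h4⟩⟩
  · rintro ⟨⟨h1, h2⟩, h3⟩
    rcases h3 with h3 | h3
    · linarith
    · rcases h2 with h2 | h2
      · exact ⟨⟨h2, h3.1⟩, h1, h3.2⟩
      · linarith [h3.2]

lemma rect_eq (μ : Measure (ℝ × ℝ)) [IsFiniteMeasure μ] (hμ : μ.real QQᶜ = 0) {a b c d : ℝ}
    (hab : a ≤ b) (hcd : c ≤ d) :
    μ.real (Set.Ioc a b ×ˢ Set.Ioc c d) =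
      μ.real (Set.Ioc 0 (cl b) ×ˢ Set.Ioc 0 (cl d)) - μ.real (Set.Ioc 0 (cl a) ×ˢ Set.Ioc 0 (cl d))
      - μ.real (Set.Ioc 0 (cl b) ×ˢ Set.Ioc 0 (cl c))
      + μ.real (Set.Ioc 0 (cl a) ×ˢ Set.Ioc 0 (cl c)) := by
  have h1 : μ.real (Set.Ioc a b ×ˢ Set.Ioc c d) =
      μ.real (Set.Ioc (cl a) (cl b) ×ˢ Set.Ioc (cl c) (cl d)) := by
    rw [← Ioc_cl, ← Ioc_cl, ← Set.prod_inter_prod, ← QQ,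
      ← measureReal_inter_add_sdiff (μ := μ) (s := Set.Ioc a b ×ˢ Set.Ioc c d) measurableSet_QQ]
    have : μ.real (Set.Ioc a b ×ˢ Set.Ioc c d \ QQ) = 0 := by
      refine le_antisymm ?_ measureReal_nonneg
      rw [← hμ]
      exact measureReal_mono (fun p hp => hp.2)
    rw [this, add_zero]
  rw [h1]
  have ma := (cl_mem a).1
  have mc := (cl_mem c).1
  have hab' := cl_mono hab
  have hcd' := cl_mono hcd
  have split1 : ∀ C : Set ℝ, MeasurableSet C → μ.real (Set.Ioc 0 (cl b) ×ˢ C) =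
      μ.real (Set.Ioc 0 (cl a) ×ˢ C) + μ.real (Set.Ioc (cl a) (cl b) ×ˢ C) := by
    intro C hC
    rw [← Set.Ioc_union_Ioc_eq_Ioc ma hab', Set.union_prod, measureReal_union _
      (measurableSet_Ioc.prod hC)]
    apply Set.Disjoint.set_prod_left
    exact Set.Ioc_disjoint_Ioc_of_le le_rfl
  have split2 : ∀ C : Set ℝ, MeasurableSet C → μ.real (C ×ˢ Set.Ioc 0 (cl d)) =
      μ.real (C ×ˢ Set.Ioc 0 (cl c)) + μ.real (C ×ˢ Set.Ioc (cl c) (cl d)) := by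
    intro C hC
    rw [← Set.Ioc_union_Ioc_eq_Ioc mc hcd', Set.prod_union, measureReal_union _
      (hC.prod measurableSet_Ioc)]
    apply Set.Disjoint.set_prod_right
    exact Set.Ioc_disjoint_Ioc_of_le le_rfl
  have s1 := split1 _ (measurableSet_Ioc (a := 0) (b := cl d))
  have s2 := split1 _ (measurableSet_Ioc (a := 0) (b := cl c))
  have s3 := split2 _ (measurableSet_Ioc (a := cl a) (b := cl b))
  linarith

/-- rational rectangles -/
def rr (r : (ℚ × ℚ) × (ℚ × ℚ)) : Set (ℝ × ℝ) :=
  Set.Ioc (r.1.1 : ℝ) r.1.2 ×ˢ Set.Ioc (r.2.1 : ℝ) r.2.2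

lemma rr_meas (r : (ℚ × ℚ) × (ℚ × ℚ)) : MeasurableSet (rr r) :=
  measurableSet_Ioc.prod measurableSet_Ioc

lemma rr_pi : IsPiSystem (Set.range rr) := by
  rintro _ ⟨r, rfl⟩ _ ⟨s, rfl⟩ _
  refine ⟨((max r.1.1 s.1.1, min r.1.2 s.1.2), (max r.2.1 s.2.1, min r.2.2 s.2.2)), ?_⟩
  simp only [rr, Set.prod_inter_prod, Set.Ioc_inter_Ioc, Rat.cast_max, Rat.cast_min]

lemma rr_nhds (u : Set (ℝ × ℝ)) (hu : IsOpen u) (x : ℝ × ℝ) (hx : x ∈ u) :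
    ∃ s ∈ Set.range rr, s ∈ nhds x ∧ s ⊆ u := by
  obtain ⟨ε, hε, hb⟩ := Metric.isOpen_iff.1 hu x hx
  obtain ⟨a, ha1, ha2⟩ := exists_rat_btwn (show x.1 - ε < x.1 by linarith)
  obtain ⟨b, hb1, hb2⟩ := exists_rat_btwn (show x.1 < x.1 + ε by linarith)
  obtain ⟨c, hc1, hc2⟩ := exists_rat_btwn (show x.2 - ε < x.2 by linarith)
  obtain ⟨d, hd1, hd2⟩ := exists_rat_btwn (show x.2 < x.2 + ε by linarith)
  refine ⟨_, ⟨((a, b), (c, d)), rfl⟩, ?_, ?_⟩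
  · exact prod_mem_nhds (Ioc_mem_nhds ha2 hb1) (Ioc_mem_nhds hc2 hd1)
  · refine Set.Subset.trans ?_ hb
    rintro ⟨p1, p2⟩ ⟨⟨h1, h2⟩, h3, h4⟩
    simp only at h1 h2 h3 h4
    rw [Metric.mem_ball, Prod.dist_eq, max_lt_iff, Real.dist_eq, Real.dist_eq, abs_lt, abs_lt]
    refine ⟨⟨?_, ?_⟩, ⟨?_, ?_⟩⟩ <;> simp only <;> linarith

lemma tendsto_of_rr {ι : Type*} {l : Filter ι} {μ : ι → ProbabilityMeasure (ℝ × ℝ)}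
    {ν : ProbabilityMeasure (ℝ × ℝ)}
    (h : ∀ r, Tendsto (fun i => μ i (rr r)) l (nhds (ν (rr r)))) : Tendsto μ l (nhds ν) := by
  let L : Filter (ProbabilityMeasure (ℝ × ℝ)) :=
    ⨅ r, comap (fun m : ProbabilityMeasure (ℝ × ℝ) => m (rr r)) (nhds (ν (rr r)))
  have h1 : Tendsto μ l L := by
    rw [tendsto_iInf]
    intro r
    rw [tendsto_comap_iff]
    exact h r
  have h2 : Tendsto (fun m : ProbabilityMeasure (ℝ × ℝ) => m) L (nhds ν) := by
    refine rr_pi.tendsto_probabilityMeasure_of_tendsto_of_mem ?_ rr_nhds ?_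
    · rintro _ ⟨r, rfl⟩; exact rr_meas r
    · rintro _ ⟨r, rfl⟩
      exact tendsto_comap.mono_left (iInf_le _ r)
  exact h2.comp h1

lemma emp_rect_tendsto (q : ℕ → ℝ) (hq : ∀ n, 0 < q n) (β : ℝ)
    (hβ : Tendsto (fun n : ℕ => (n : ℝ) * (1 - q n)) atTop (nhds β)) {x y : ℝ}
    (hx : x ∈ Set.Icc (0 : ℝ) 1) (hy : y ∈ Set.Icc (0 : ℝ) 1) :
    Tendsto (fun s : Σ n : ℕ, Equiv.Perm (Fin n) =>
      ((empiricalPerm s.1 s.2 : ProbabilityMeasure (ℝ × ℝ)) : Measure (ℝ × ℝ)).real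
      (Set.Ioc 0 x ×ˢ Set.Ioc 0 y)) (mL q hq)
      (nhds ((rhoMeasure β).real (Set.Ioc 0 x ×ˢ Set.Ioc 0 y))) := by
  have h1 := count_tendsto q hq β hβ hx hy
  have hfl : Tendsto (fun n : ℕ => (⌊y * n⌋₊ : ℝ) / n) atTop (nhds y) :=
    (tendsto_nat_floor_mul_div_atTop hy.1).comp tendsto_natCast_atTop_atTop
  have h2 := (hfl.comp (mL_fst q hq)).sub h1
  rw [measureReal_def, rho_rect β hx hy, ENNReal.toReal_ofReal (uu_nonneg β hx hy)]
  rw [sub_sub_cancel] at h2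
  refine h2.congr' ?_
  filter_upwards [(mL_fst q hq).eventually_gt_atTop 0] with s hs
  exact (emp_rect hs s.2 hx hy).symm

lemma emp_tendsto (q : ℕ → ℝ) (hq : ∀ n, 0 < q n) (β : ℝ)
    (hβ : Tendsto (fun n : ℕ => (n : ℝ) * (1 - q n)) atTop (nhds β)) :
    Tendsto (fun s : Σ n : ℕ, Equiv.Perm (Fin n) => empiricalPerm s.1 s.2) (mL q hq)
      (nhds ⟨rhoMeasure β, rho_prob β⟩) := by
  apply tendsto_of_rr
  intro r
  rw [← NNReal.tendsto_coe]
  change Tendsto (fun s : Σ n : ℕ, Equiv.Perm (Fin n) =>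
      ((empiricalPerm s.1 s.2 : ProbabilityMeasure (ℝ × ℝ)) : Measure (ℝ × ℝ)).real (rr r))
      (mL q hq) (nhds ((rhoMeasure β).real (rr r)))
  have := rho_prob β
  rcases lt_or_ge (r.1.2 : ℝ) (r.1.1 : ℝ) with h | hab
  · have : rr r = ∅ := by simp [rr, Set.Ioc_eq_empty_of_le h.le]
    simp only [this, measureReal_empty]
    exact tendsto_const_nhds
  rcases lt_or_ge (r.2.2 : ℝ) (r.2.1 : ℝ) with h | hcd
  · have : rr r = ∅ := by simp [rr, Set.Ioc_eq_empty_of_le h.le]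
    simp only [this, measureReal_empty]
    exact tendsto_const_nhds
  have hT := fun x y => emp_rect_tendsto q hq β hβ (cl_mem x) (cl_mem y)
  have := (((hT r.1.2 r.2.2).sub (hT r.1.1 r.2.2)).sub (hT r.1.2 r.2.1)).add (hT r.1.1 r.2.1)
  rw [← rect_eq (rhoMeasure β) (by simp [measureReal_def, rhoMeasure_compl]) hab hcd] at this
  refine this.congr' ?_
  filter_upwards [(mL_fst q hq).eventually_gt_atTop 0] with s hs
  exact (rect_eq _ (emp_compl hs s.2) hab hcd).symm

/-- The empirical measures of Mallows(n,qₙ) random permutations converge in distribution,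
relative to the weak topology on Borel probability measures on `ℝ²`, to the non-random
measure `ρ_β`.  (Convergence in distribution is expressed by testing the expectation against
an arbitrary bounded continuous function on the space of probability measures.) -/
theorem mallows_empirical_convergence (q : ℕ → ℝ) (hq : ∀ n, 0 < q n) (β : ℝ)
    (hβ : Tendsto (fun n : ℕ => (n : ℝ) * (1 - q n)) atTop (nhds β)) :
    ∃ _h : IsProbabilityMeasure (rhoMeasure β),
      ∀ F : BoundedContinuousFunction (ProbabilityMeasure (ℝ × ℝ)) ℝ,
        Tendsto (fun n : ℕ =>
            ∑ π : Equiv.Perm (Fin n), mallowsProb n (q n) {π} * F (empiricalPerm n π))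
          atTop (nhds (F ⟨rhoMeasure β, _h⟩)) := by

  refine ⟨rho_prob β, fun F => ?_⟩
  have h := (F.continuous.tendsto _).comp (emp_tendsto q hq β hβ)
  refine mL_integral q hq (fun s => F (empiricalPerm s.1 s.2)) _ (‖F‖ + ‖F‖) (fun s => ?_) h
  refine (abs_sub _ _).trans ?_
  exact add_le_add (F.norm_coe_le_norm _) (F.norm_coe_le_norm _)
end
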